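/- Fix n ≥ 2 and fix nonidentity elements w₁, w₂ of a free group of finite rank d. There exists a constant C > 0 such that for every prime power q with (n,q) ∉ {(2,2),(2,3)}, the following holds for G = PSL_n(𝔽_q): for every g ∈ G with g ≠ 1, |P_{w₁(G),w₂(G)}(g) − 1/|G|| ≤ (C/√q)·(1/|G|). -/

import Mathlib

/-- `P_{A,B}(g)`: the probability that `ab = g` for `a ∈ A`, `b ∈ B` chosen
uniformly and independently at random. -/
noncomputable def Pab {G : Type*} [Group G] (A B : Set G) (g : G) : ℝ :=
  (({p : G × G | p.1 ∈ A ∧ p.2 ∈ B ∧ p.1 * p.2 = g}).ncard : ℝ) /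
    ((A.ncard : ℝ) * (B.ncard : ℝ))

/-- The image of the word map `G^d → G` given by a word `w` in the free group
on `d` generators. -/
def wordImage {d : ℕ} (w : FreeGroup (Fin d)) (G : Type*) [Group G] : Set G :=
  Set.range fun f : Fin d → G => FreeGroup.lift f w

namespace SLWord

open scoped InnerProductSpace
open Module

section Unitary

variable {V : Type*} [NormedAddCommGroup V] [InnerProductSpace ℂ V]
variable {G H : Type*} [Group G] [Group H]

/-- A linear representation preserving the inner product. -/
def IsUnitary (ρ : G →* End ℂ V) : Prop :=
  ∀ g v w, ⟪ρ g v, ρ g w⟫_ℂ = ⟪v, w⟫_ℂ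

/-- The subspace of fixed vectors. -/
def fixed (σ : G →* End ℂ V) : Submodule ℂ V where
  carrier := {v | ∀ g, σ g v = v}
  add_mem' hv hw g := by rw [map_add, hv g, hw g]
  zero_mem' g := map_zero _
  smul_mem' c v hv g := by rw [map_smul, hv g]

lemma mem_fixed {σ : G →* End ℂ V} {v : V} : v ∈ fixed σ ↔ ∀ g, σ g v = v := Iff.rfl

lemma rep_mul_apply (ρ : G →* End ℂ V) (g h : G) (v : V) : ρ (g * h) v = ρ g (ρ h v) := by
  rw [map_mul]; rfl

lemma rep_inv_apply_self (ρ : G →* End ℂ V) (g : G) (v : V) : ρ g⁻¹ (ρ g v) = v := by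
  rw [← rep_mul_apply, inv_mul_cancel, map_one]; rfl

lemma rep_apply_inv_self (ρ : G →* End ℂ V) (g : G) (v : V) : ρ g (ρ g⁻¹ v) = v := by
  rw [← rep_mul_apply, mul_inv_cancel, map_one]; rfl

namespace IsUnitary

variable {ρ : G →* End ℂ V}

lemma norm (hρ : IsUnitary ρ) (g : G) (v : V) : ‖ρ g v‖ = ‖v‖ := by
  rw [norm_eq_sqrt_re_inner (𝕜 := ℂ), hρ, ← norm_eq_sqrt_re_inner]

lemma inner_left (hρ : IsUnitary ρ) (g : G) (v w : V) : ⟪ρ g v, w⟫_ℂ = ⟪v, ρ g⁻¹ w⟫_ℂ := by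
  rw [← hρ g v, rep_apply_inv_self]

lemma inner_right (hρ : IsUnitary ρ) (g : G) (v w : V) : ⟪v, ρ g w⟫_ℂ = ⟪ρ g⁻¹ v, w⟫_ℂ := by
  rw [← hρ g _ w, rep_apply_inv_self]

lemma comp (hρ : IsUnitary ρ) (u : H →* G) : IsUnitary (ρ.comp u) := fun h v w => hρ (u h) v w

end IsUnitary

/-- The average of the operators of a representation of a finite group. -/
noncomputable def avg [Fintype H] (σ : H →* End ℂ V) : End ℂ V :=
  (Fintype.card H : ℂ)⁻¹ • ∑ h, σ h

section avg

variable [Fintype H] (σ : H →* End ℂ V)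

lemma avg_apply (v : V) : avg σ v = (Fintype.card H : ℂ)⁻¹ • ∑ h, σ h v := by
  simp [avg, LinearMap.sum_apply]

lemma card_ne_zero_complex (H : Type*) [Group H] [Fintype H] : (Fintype.card H : ℂ) ≠ 0 :=
  Nat.cast_ne_zero.2 Fintype.card_ne_zero

lemma avg_mem (v : V) : avg σ v ∈ fixed σ := by
  intro g
  rw [avg_apply, map_smul, map_sum]
  congr 1
  simp_rw [← rep_mul_apply]
  exact Equiv.sum_comp (Equiv.mulLeft g) (fun h => σ h v)

variable {σ}

lemma avg_of_mem {v : V} (hv : v ∈ fixed σ) : avg σ v = v := by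
  rw [avg_apply, Finset.sum_congr rfl (fun h _ => hv h), Finset.sum_const, Finset.card_univ,
    ← Nat.cast_smul_eq_nsmul ℂ, smul_smul, inv_mul_cancel₀ (card_ne_zero_complex H), one_smul]

lemma inner_avg_left (hσ : IsUnitary σ) (v w : V) : ⟪avg σ v, w⟫_ℂ = ⟪v, avg σ w⟫_ℂ := by
  rw [avg_apply, avg_apply, inner_smul_left, inner_smul_right, sum_inner, inner_sum]
  congr 1
  · simp
  rw [← Equiv.sum_comp (Equiv.inv H)]
  exact Finset.sum_congr rfl fun h _ => by simp [hσ.inner_left]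

lemma inner_avg_self (hσ : IsUnitary σ) (v : V) : ⟪avg σ v, v⟫_ℂ = (‖avg σ v‖ : ℂ) ^ 2 := by
  have h := inner_self_eq_norm_sq_to_K (𝕜 := ℂ) (avg σ v)
  rw [inner_avg_left hσ, avg_of_mem (avg_mem σ v), ← inner_avg_left hσ] at h
  exact h

lemma inner_avg_of_mem (hσ : IsUnitary σ) {v w : V} (hw : w ∈ fixed σ) :
    ⟪avg σ v, w⟫_ℂ = ⟪v, w⟫_ℂ := by
  rw [inner_avg_left hσ, avg_of_mem hw]

end avg

end Unitary

section packing

variable {V : Type*} [NormedAddCommGroup V] [InnerProductSpace ℂ V] [FiniteDimensional ℂ V]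

lemma card_sq_le_finrank_mul_sum_inner {κ : Type*} [Fintype κ] (e : κ → V)
    (he : ∀ k, ‖e k‖ = 1) :
    (Fintype.card κ : ℝ) ^ 2 ≤ finrank ℂ V * ∑ k, ∑ l, ‖⟪e k, e l⟫_ℂ‖ ^ 2 := by
  set b := stdOrthonormalBasis ℂ V
  set g : Fin (finrank ℂ V) → Fin (finrank ℂ V) → ℂ :=
    fun i j => ∑ k, ⟪b i, e k⟫_ℂ * ⟪e k, b j⟫_ℂ with hg
  have h1 : ∑ i, g i i = (Fintype.card κ : ℂ) := by
    simp only [hg]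
    rw [Finset.sum_comm]
    have : ∀ k, ∑ i, ⟪b i, e k⟫_ℂ * ⟪e k, b i⟫_ℂ = 1 := fun k => by
      simp_rw [mul_comm]
      rw [b.sum_inner_mul_inner, inner_self_eq_norm_sq_to_K, he]; simp
    simp [this]
  have hgs : ∀ i j, starRingEnd ℂ (g i j) = g j i := fun i j => by
    simp only [hg, map_sum, map_mul, inner_conj_symm]
    exact Finset.sum_congr rfl fun k _ => mul_comm _ _
  have h2 : ((∑ k, ∑ l, ‖⟪e k, e l⟫_ℂ‖ ^ 2 : ℝ) : ℂ) = ((∑ i, ∑ j, ‖g i j‖ ^ 2 : ℝ) : ℂ) := by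
    push_cast
    have e1 : ∀ z : ℂ, (‖z‖ : ℂ) ^ 2 = z * starRingEnd ℂ z := fun z => by
      rw [Complex.mul_conj, Complex.normSq_eq_norm_sq]; push_cast; rfl
    simp_rw [e1, hgs, inner_conj_symm]
    have e2 : ∀ k l, ⟪e k, e l⟫_ℂ * ⟪e l, e k⟫_ℂ =
        ∑ i, ∑ j, (⟪b j, e k⟫_ℂ * ⟪e k, b i⟫_ℂ) * (⟪b i, e l⟫_ℂ * ⟪e l, b j⟫_ℂ) := fun k l => by
      rw [← b.sum_inner_mul_inner (e k) (e l), ← b.sum_inner_mul_inner (e l) (e k),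
        Finset.sum_mul_sum]
      exact Finset.sum_congr rfl fun i _ => Finset.sum_congr rfl fun j _ => by ring
    simp_rw [e2, hg, Finset.sum_mul_sum]
    calc _ = ∑ k, ∑ i, ∑ l, ∑ j, (⟪b j, e k⟫_ℂ * ⟪e k, b i⟫_ℂ) * (⟪b i, e l⟫_ℂ * ⟪e l, b j⟫_ℂ) :=
          Finset.sum_congr rfl fun k _ => Finset.sum_comm
      _ = ∑ i, ∑ k, ∑ l, ∑ j, (⟪b j, e k⟫_ℂ * ⟪e k, b i⟫_ℂ) * (⟪b i, e l⟫_ℂ * ⟪e l, b j⟫_ℂ) :=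
          Finset.sum_comm
      _ = ∑ i, ∑ k, ∑ j, ∑ l, (⟪b j, e k⟫_ℂ * ⟪e k, b i⟫_ℂ) * (⟪b i, e l⟫_ℂ * ⟪e l, b j⟫_ℂ) :=
          Finset.sum_congr rfl fun i _ => Finset.sum_congr rfl fun k _ => Finset.sum_comm
      _ = ∑ i, ∑ j, ∑ k, ∑ l, (⟪b j, e k⟫_ℂ * ⟪e k, b i⟫_ℂ) * (⟪b i, e l⟫_ℂ * ⟪e l, b j⟫_ℂ) :=
          Finset.sum_congr rfl fun i _ => Finset.sum_comm
      _ = _ := by rw [Finset.sum_comm]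
  have h2' := Complex.ofReal_injective h2
  rw [h2']
  have h3 : (Fintype.card κ : ℝ) ≤ ∑ i, ‖g i i‖ := by
    have := norm_sum_le Finset.univ (fun i => g i i)
    rwa [h1, Complex.norm_natCast] at this
  calc (Fintype.card κ : ℝ) ^ 2 ≤ (∑ i, ‖g i i‖) ^ 2 := by gcongr
    _ ≤ finrank ℂ V * ∑ i, ‖g i i‖ ^ 2 := by
        simpa using sq_sum_le_card_mul_sum_sq (s := Finset.univ) (f := fun i => ‖g i i‖)
    _ ≤ _ := by
        gcongr with i
        exact Finset.single_le_sum (f := fun j => ‖g i j‖ ^ 2) (fun _ _ => sq_nonneg _)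
          (Finset.mem_univ i)

lemma finrank_mul_card_le {ι : Type*} [Fintype ι] [DecidableEq ι] (X : ι → Submodule ℂ V) (m : ℕ)
    (hm : ∀ a, finrank ℂ (X a) = m)
    (h : ∀ a b, a ≠ b → ∀ v ∈ X a, ∀ w ∈ X b,
      Fintype.card ι * ‖⟪v, w⟫_ℂ‖ ^ 2 ≤ ‖v‖ ^ 2 * ‖w‖ ^ 2) :
    m * Fintype.card ι ≤ 2 * finrank ℂ V := by
  set q := Fintype.card ι with hq
  rcases Nat.eq_zero_or_pos (m * q) with h0 | h0
  · omega
  have hqpos : (0 : ℝ) < q := by exact_mod_cast Nat.pos_of_mul_pos_left h0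
  let e0 : ∀ a, OrthonormalBasis (Fin m) ℂ (X a) := fun a =>
    (stdOrthonormalBasis ℂ (X a)).reindex (finCongr (hm a))
  let e : ι × Fin m → V := fun p => (e0 p.1 p.2 : V)
  have he : ∀ p, ‖e p‖ = 1 := fun p => (e0 p.1).orthonormal.1 p.2
  have key := card_sq_le_finrank_mul_sum_inner e he
  have hdiag : ∀ a i, ∑ j, ‖⟪e (a, i), e (a, j)⟫_ℂ‖ ^ 2 = 1 := fun a i => by
    have := (e0 a).sum_sq_norm_inner_left (e0 a i)
    rw [(e0 a).orthonormal.1 i] at this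
    simpa [e] using this
  have hoff : ∀ a b, a ≠ b → ∀ i, q * ∑ j, ‖⟪e (a, i), e (b, j)⟫_ℂ‖ ^ 2 ≤ 1 := by
    intro a b hab i
    set S := ∑ j, ‖⟪e (a, i), e (b, j)⟫_ℂ‖ ^ 2 with hS
    let w : X b := ∑ j, ⟪e (b, j), e (a, i)⟫_ℂ • e0 b j
    have hw : ‖(w : V)‖ ^ 2 = S := by
      have h1 := (e0 b).sum_sq_norm_inner_right w
      have h2 : ∀ j, ⟪e0 b j, w⟫_ℂ = ⟪e (b, j), e (a, i)⟫_ℂ := fun j => by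
        simp only [w]
        rw [inner_sum]
        simp [inner_smul_right, orthonormal_iff_ite.1 (e0 b).orthonormal]
      simp_rw [h2, norm_inner_symm] at h1
      rw [Submodule.coe_norm] at h1
      exact h1.symm
    have hin : ⟪e (a, i), (w : V)⟫_ℂ = (S : ℂ) := by
      simp only [w, Submodule.coe_sum, Submodule.coe_smul, inner_sum, inner_smul_right, hS]
      push_cast
      refine Finset.sum_congr rfl fun j _ => ?_
      rw [← inner_conj_symm, mul_comm, Complex.mul_conj, Complex.normSq_eq_norm_sq]
      push_cast; rfl
    have h1 := h a b hab (e (a, i)) (e0 a i).2 w w.2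
    have hS0 : 0 ≤ S := Finset.sum_nonneg fun _ _ => sq_nonneg _
    rw [hin, hw, he, Complex.norm_real, Real.norm_of_nonneg hS0] at h1
    rcases hS0.eq_or_lt with h0 | h0
    · rw [← h0]; simp
    · have : S * (q * S) ≤ S * 1 := by nlinarith
      exact le_of_mul_le_mul_left this h0
  have hsum : ∑ p, ∑ r, ‖⟪e p, e r⟫_ℂ‖ ^ 2 ≤ 2 * (q * m) := by
    have hrow : ∀ p : ι × Fin m, ∑ r, ‖⟪e p, e r⟫_ℂ‖ ^ 2 ≤ 2 := by
      rintro ⟨a, i⟩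
      rw [Fintype.sum_prod_type, ← Finset.add_sum_erase _ _ (Finset.mem_univ a), hdiag]
      have : ∑ b ∈ Finset.univ.erase a, ∑ j, ‖⟪e (a, i), e (b, j)⟫_ℂ‖ ^ 2 ≤
          ∑ b ∈ Finset.univ.erase a, (1 / q : ℝ) :=
        Finset.sum_le_sum fun b hb => by
          rw [le_div_iff₀ hqpos, mul_comm]
          exact hoff a b (Finset.ne_of_mem_erase hb).symm i
      rw [Finset.sum_const, nsmul_eq_mul] at this
      have h3 : ((Finset.univ.erase a).card : ℝ) ≤ q := by
        exact_mod_cast Finset.card_le_univ _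
      have h4 : ((Finset.univ.erase a).card : ℝ) * (1 / q) ≤ 1 := by
        rw [mul_one_div, div_le_one hqpos]; exact h3
      linarith
    calc _ ≤ ∑ p : ι × Fin m, (2 : ℝ) := Finset.sum_le_sum fun p _ => hrow p
      _ = _ := by simp [hq]; ring
  have hcard : (Fintype.card (ι × Fin m) : ℝ) = q * m := by simp [hq]
  rw [hcard] at key
  have hpos : (0 : ℝ) < q * m := by
    have : 0 < q * m := by rwa [mul_comm]
    exact_mod_cast this
  have h5 : (q * m : ℝ) * (q * m) ≤ (q * m) * (2 * finrank ℂ V) := by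
    have := mul_le_mul_of_nonneg_left hsum (Nat.cast_nonneg (α := ℝ) (finrank ℂ V))
    nlinarith
  have h6 := le_of_mul_le_mul_left h5 hpos
  have : q * m ≤ 2 * finrank ℂ V := by exact_mod_cast h6
  rwa [mul_comm]

end packing

end SLWord

namespace SLWord

open scoped InnerProductSpace MatrixGroups
open Module Matrix

/-- The root subgroup `t ↦ 1 + t E_{ij}` of the special linear group. -/
def rootHom {ι : Type*} [Fintype ι] [DecidableEq ι] {F : Type*} [Field F] {i j : ι} (hij : i ≠ j) :
    Multiplicative F →* SpecialLinearGroup ι F where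
  toFun t := SpecialLinearGroup.transvection hij t.toAdd
  map_one' := SpecialLinearGroup.transvection_coeff_zero hij
  map_mul' _ _ := SpecialLinearGroup.transvection_add hij _ _

lemma natCast_mul_re (n : ℕ) (z : ℂ) : ((n : ℂ) * z).re = n * z.re := by
  rw [← Complex.ofReal_natCast, Complex.re_ofReal_mul]

section SLTwo

variable {F : Type*} [Field F]

abbrev up (t : F) : SL(2, F) := SpecialLinearGroup.transvection zero_ne_one t
abbrev lo (t : F) : SL(2, F) := SpecialLinearGroup.transvection one_ne_zero t

lemma coe_up (t : F) : (up t : Matrix (Fin 2) (Fin 2) F) = !![1, t; 0, 1] := by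
  ext i j
  fin_cases i <;> fin_cases j <;>
    simp [SpecialLinearGroup.transvection, Matrix.transvection, Matrix.single]

lemma coe_lo (t : F) : (lo t : Matrix (Fin 2) (Fin 2) F) = !![1, 0; t, 1] := by
  ext i j
  fin_cases i <;> fin_cases j <;>
    simp [SpecialLinearGroup.transvection, Matrix.transvection, Matrix.single]

/-- The Weyl element of `SL₂`. -/
def weyl : SL(2, F) := ⟨!![0, -1; 1, 0], by simp [Matrix.det_fin_two]⟩

/-- The diagonal torus of `SL₂`. -/
def tor (s : Fˣ) : SL(2, F) := ⟨!![(s : F), 0; 0, (s : F)⁻¹], by simp [Matrix.det_fin_two]⟩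

lemma coe_weyl : ((weyl : SL(2, F)) : Matrix (Fin 2) (Fin 2) F) = !![0, -1; 1, 0] := rfl
lemma coe_tor (s : Fˣ) : (tor s : Matrix (Fin 2) (Fin 2) F) = !![(s : F), 0; 0, (s : F)⁻¹] := rfl

lemma lo_eq (s : Fˣ) :
    lo (s : F) = up (s : F)⁻¹ * (weyl * tor s) * up (s : F)⁻¹ := by
  apply Subtype.ext
  simp [coe_up, coe_lo, coe_weyl, coe_tor]

lemma up_mul_tor (a : F) (s : Fˣ) : up a * tor s = tor s * up (a * (s : F)⁻¹ ^ 2) := by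
  apply Subtype.ext
  have := s.ne_zero
  simp [coe_up, coe_tor]
  field_simp

lemma weyl_mul_up_mul_weyl (a : Fˣ) :
    weyl * up (a : F) * weyl = up (-(a : F)⁻¹) * (weyl * (tor a * up (-(a : F)⁻¹))) := by
  apply Subtype.ext
  simp [coe_up, coe_weyl, coe_tor]

lemma weyl_mul_weyl : (weyl : SL(2, F)) * weyl = tor (-1) := by
  apply Subtype.ext
  simp [coe_weyl, coe_tor]

lemma weyl_mul_tor (s : Fˣ) : weyl * tor s = tor s⁻¹ * weyl := by
  apply Subtype.ext
  simp [coe_weyl, coe_tor]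

lemma tor_mul (s t : Fˣ) : tor s * tor t = tor (s * t) := by
  apply Subtype.ext
  simp [coe_tor, mul_comm]

lemma weyl_mul_lo (a : F) : weyl * lo a = up (-a) * weyl := by
  apply Subtype.ext
  simp [coe_up, coe_lo, coe_weyl]

lemma up_add (a b : F) : up a * up b = up (a + b) :=
  (SpecialLinearGroup.transvection_add zero_ne_one a b).symm

abbrev upHom : Multiplicative F →* SL(2, F) := rootHom zero_ne_one
abbrev loHom : Multiplicative F →* SL(2, F) := rootHom one_ne_zero

variable {V : Type*} [NormedAddCommGroup V] [InnerProductSpace ℂ V]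
variable {ρ : SL(2, F) →* End ℂ V}

lemma mem_fixed_up {v : V} : v ∈ fixed (ρ.comp upHom) ↔ ∀ t : F, ρ (up t) v = v := Iff.rfl
lemma mem_fixed_lo {v : V} : v ∈ fixed (ρ.comp loHom) ↔ ∀ t : F, ρ (lo t) v = v := Iff.rfl

lemma tor_mem_fixed_up {v : V} (hv : v ∈ fixed (ρ.comp upHom)) (s : Fˣ) :
    ρ (tor s) v ∈ fixed (ρ.comp upHom) := by
  rw [mem_fixed_up] at *
  intro t
  rw [← rep_mul_apply, up_mul_tor, rep_mul_apply, hv]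

lemma weyl_inv_mem_fixed_lo {v : V} (hv : v ∈ fixed (ρ.comp upHom)) :
    ρ weyl⁻¹ v ∈ fixed (ρ.comp loHom) := by
  rw [mem_fixed_up] at hv
  rw [mem_fixed_lo]
  intro t
  have : lo t * (weyl : SL(2, F))⁻¹ = weyl⁻¹ * up (-t) := by
    rw [mul_inv_eq_iff_eq_mul, mul_assoc, eq_inv_mul_iff_mul_eq, weyl_mul_lo]
  rw [← rep_mul_apply, this, rep_mul_apply, hv]

lemma mem_fixed_lo_of_weyl {v : V} (hv : v ∈ fixed (ρ.comp upHom)) (h : ρ weyl v = v) :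
    v ∈ fixed (ρ.comp loHom) := by
  have := weyl_inv_mem_fixed_lo hv
  rwa [show ρ weyl⁻¹ v = v by conv_lhs => rw [← h, rep_inv_apply_self]] at this

lemma tor_mem_fixed_both {v : V} (hv : v ∈ fixed (ρ.comp upHom) ⊓ fixed (ρ.comp loHom))
    (s : Fˣ) : ρ (tor s) v = v := by
  have hw : weyl * tor s = up (-(s : F)⁻¹) * lo (s : F) * up (-(s : F)⁻¹) := by
    apply Subtype.ext
    simp [coe_up, coe_lo, coe_weyl, coe_tor]
  have h1 : ∀ s : Fˣ, ρ (weyl * tor s) v = v := fun s => by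
    have hw : weyl * tor s = up (-(s : F)⁻¹) * lo (s : F) * up (-(s : F)⁻¹) := by
      apply Subtype.ext
      simp [coe_up, coe_lo, coe_weyl, coe_tor]
    rw [hw, rep_mul_apply, mem_fixed_up.1 hv.1, rep_mul_apply, mem_fixed_lo.1 hv.2,
      mem_fixed_up.1 hv.1]
  have h2 := h1 1
  have h3 := h1 s
  have ht : (tor 1 : SL(2, F)) = 1 := by
    apply Subtype.ext
    simp [coe_tor, Matrix.one_fin_two]
  rw [ht, mul_one] at h2
  rw [rep_mul_apply] at h3
  rw [← rep_inv_apply_self ρ weyl (ρ (tor s) v), h3]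
  conv_lhs => rw [← h2, rep_inv_apply_self]

variable [Fintype F] [DecidableEq F]

lemma inner_weyl_nonpos (hρ : IsUnitary ρ) {v : V} (hv : v ∈ fixed (ρ.comp upHom))
    (hY : v ∈ (fixed (ρ.comp upHom) ⊓ fixed (ρ.comp loHom))ᗮ) :
    (∑ s : Fˣ, ⟪ρ (weyl * tor s) v, v⟫_ℂ).re ≤ 0 := by
  obtain ⟨v0, hv0⟩ : ∃ v0, v0 = ∑ s : Fˣ, ρ (tor s) v := ⟨_, rfl⟩
  have hv0U : v0 ∈ fixed (ρ.comp upHom) :=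
    hv0 ▸ Submodule.sum_mem _ fun s _ => tor_mem_fixed_up hv s
  have hv0T : ∀ s : Fˣ, ρ (tor s) v0 = v0 := fun s => by
    rw [hv0, map_sum]
    simp_rw [← rep_mul_apply, tor_mul]
    exact Equiv.sum_comp (Equiv.mulLeft s) (fun t => ρ (tor t) v)
  have hv0Y : v0 ∈ (fixed (ρ.comp upHom) ⊓ fixed (ρ.comp loHom))ᗮ := by
    rw [hv0]
    refine Submodule.sum_mem _ fun s _ => ?_
    rw [Submodule.mem_orthogonal] at hY ⊢
    intro y hy
    rw [← hY y hy, ← hρ (tor s) y v, tor_mem_fixed_both hy]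
  obtain ⟨z, hz⟩ : ∃ z, z = v0 + ∑ a : F, ρ (up a) (ρ weyl v0) := ⟨_, rfl⟩
  have hzU : z ∈ fixed (ρ.comp upHom) := by
    rw [hz]
    refine Submodule.add_mem _ hv0U ?_
    rw [mem_fixed_up]
    intro t
    rw [map_sum]
    have : ∀ a, ρ (up t) (ρ (up a) (ρ weyl v0)) = ρ (up (t + a)) (ρ weyl v0) := fun a => by
      rw [← rep_mul_apply, up_add]
    simp_rw [this]
    exact Equiv.sum_comp (Equiv.addLeft t) (fun a => ρ (up a) (ρ weyl v0))
  have hsum : ∀ f : F → V, ∑ a, f a = f 0 + ∑ a : Fˣ, f a := fun f => by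
    rw [← Finset.add_sum_erase _ _ (Finset.mem_univ (0 : F))]
    congr 1
    refine (Finset.sum_bij (fun (a : Fˣ) _ => (a : F)) ?_ ?_ ?_ ?_).symm
    · intro a _; simp
    · intro a _ b _ h; exact Units.ext h
    · intro b hb; exact ⟨Units.mk0 b (Finset.ne_of_mem_erase hb), Finset.mem_univ _, rfl⟩
    · intro a _; rfl
  have hup0 : (up 0 : SL(2, F)) = 1 := SpecialLinearGroup.transvection_coeff_zero _
  have hzw : ρ weyl z = z := by
    rw [hz, map_add, map_sum, hsum (fun a => ρ weyl (ρ (up a) (ρ weyl v0))),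
      hsum (fun a => ρ (up a) (ρ weyl v0))]
    have e1 : ∀ a : Fˣ, ρ weyl (ρ (up (a : F)) (ρ weyl v0)) =
        ρ (up ((-a⁻¹ : Fˣ) : F)) (ρ weyl v0) := fun a => by
      rw [← rep_mul_apply, ← rep_mul_apply, weyl_mul_up_mul_weyl, rep_mul_apply, rep_mul_apply,
        rep_mul_apply, mem_fixed_up.1 hv0U, hv0T]
      simp
    have e2 : ρ weyl (ρ (up 0) (ρ weyl v0)) = v0 := by
      rw [hup0, map_one, End.one_apply, ← rep_mul_apply, weyl_mul_weyl, hv0T]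
    have e3 : ∑ a : Fˣ, ρ (up ((-a⁻¹ : Fˣ) : F)) (ρ weyl v0) =
        ∑ a : Fˣ, ρ (up (a : F)) (ρ weyl v0) :=
      Equiv.sum_comp ((Equiv.inv Fˣ).trans (Equiv.neg Fˣ))
        (fun a : Fˣ => ρ (up (a : F)) (ρ weyl v0))
    rw [e2, Finset.sum_congr rfl fun a _ => e1 a, e3, hup0, map_one, End.one_apply]
    abel
  have hzY : z ∈ fixed (ρ.comp upHom) ⊓ fixed (ρ.comp loHom) := ⟨hzU, mem_fixed_lo_of_weyl hzU hzw⟩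
  have hz0 : ⟪z, v0⟫_ℂ = 0 := (Submodule.mem_orthogonal _ _).1 hv0Y z hzY
  have e3 : ⟪z, v0⟫_ℂ = (‖v0‖ : ℂ) ^ 2 + Fintype.card F * ⟪ρ weyl v0, v0⟫_ℂ := by
    rw [hz, inner_add_left, inner_self_eq_norm_sq_to_K, sum_inner]
    congr 1
    have : ∀ a : F, ⟪ρ (up a) (ρ weyl v0), v0⟫_ℂ = ⟪ρ weyl v0, v0⟫_ℂ := fun a => by
      have := hρ (up a) (ρ weyl v0) v0
      rwa [mem_fixed_up.1 hv0U] at this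
    rw [Finset.sum_congr rfl fun a _ => this a, Finset.sum_const, Finset.card_univ, nsmul_eq_mul]
  have e4 : (Fintype.card Fˣ : ℂ) * ∑ s : Fˣ, ⟪ρ (weyl * tor s) v, v⟫_ℂ = ⟪ρ weyl v0, v0⟫_ℂ := by
    have h1 : ∑ s : Fˣ, ⟪ρ (weyl * tor s) v, v⟫_ℂ = ⟪ρ weyl v0, v⟫_ℂ := by
      rw [hv0, map_sum, sum_inner]
      exact Finset.sum_congr rfl fun s _ => by rw [rep_mul_apply]
    have h2 : ∀ s : Fˣ, ⟪ρ weyl v0, ρ (tor s) v⟫_ℂ = ⟪ρ weyl v0, v⟫_ℂ := fun s => by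
      rw [← hρ (tor s) _ v]
      congr 1
      conv_lhs => rw [← hv0T s⁻¹]
      rw [← rep_mul_apply, weyl_mul_tor, rep_mul_apply, inv_inv]
    rw [h1]
    conv_rhs => rw [hv0, inner_sum]
    rw [← hv0, Finset.sum_congr rfl fun s _ => h2 s, Finset.sum_const, Finset.card_univ,
      nsmul_eq_mul]
  rw [e3, ← e4] at hz0
  have h5 := congrArg Complex.re hz0
  have hc : (0 : ℝ) < Fintype.card F := Nat.cast_pos.2 Fintype.card_pos
  have hc' : (0 : ℝ) < Fintype.card Fˣ := Nat.cast_pos.2 Fintype.card_pos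
  rw [← mul_assoc, ← Nat.cast_mul, Complex.add_re, natCast_mul_re, ← Complex.ofReal_pow,
    Complex.ofReal_re, Complex.zero_re] at h5
  push_cast at h5
  by_contra hcon
  push Not at hcon
  have := mul_pos (mul_pos hc hc') hcon
  nlinarith [sq_nonneg ‖v0‖]

lemma card_mul_inner_sq_le (hρ : IsUnitary ρ) {v y : V} (hv : v ∈ fixed (ρ.comp upHom))
    (hY : v ∈ (fixed (ρ.comp upHom) ⊓ fixed (ρ.comp loHom))ᗮ)
    (hy : y ∈ fixed (ρ.comp loHom)) :
    Fintype.card F * ‖⟪v, y⟫_ℂ‖ ^ 2 ≤ ‖v‖ ^ 2 * ‖y‖ ^ 2 := by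
  have hlo := hρ.comp (loHom (F := F))
  have h1 : ⟪v, y⟫_ℂ = ⟪avg (ρ.comp loHom) v, y⟫_ℂ := (inner_avg_of_mem hlo hy).symm
  have h2 : Fintype.card F * ‖avg (ρ.comp loHom) v‖ ^ 2 ≤ ‖v‖ ^ 2 := by
    have h3 := inner_avg_self hlo v
    have hcard : Fintype.card (Multiplicative F) = Fintype.card F := Fintype.card_multiplicative F
    rw [avg_apply, inner_smul_left, hcard, sum_inner] at h3
    have h4 : ∑ h : Multiplicative F, ⟪(ρ.comp loHom) h v, v⟫_ℂ =
        (‖v‖ : ℂ) ^ 2 + ∑ s : Fˣ, ⟪ρ (weyl * tor s) v, v⟫_ℂ := by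
      rw [← Equiv.sum_comp Multiplicative.ofAdd]
      change ∑ h : F, ⟪ρ (lo h) v, v⟫_ℂ = _
      rw [← Finset.add_sum_erase _ _ (Finset.mem_univ (0 : F)),
        show (lo 0 : SL(2, F)) = 1 from SpecialLinearGroup.transvection_coeff_zero _,
        map_one, End.one_apply, inner_self_eq_norm_sq_to_K]
      congr 1
      symm
      refine Finset.sum_bij (fun (a : Fˣ) _ => (a : F)) ?_ ?_ ?_ ?_
      · intro a _; simp
      · intro a _ b _ h; exact Units.ext h
      · intro b hb; exact ⟨Units.mk0 b (Finset.ne_of_mem_erase hb), Finset.mem_univ _, rfl⟩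
      · intro a _
        have h5 : ρ (lo (a : F)) v = ρ (up (a : F)⁻¹) (ρ (weyl * tor a) v) := by
          rw [lo_eq, rep_mul_apply, mem_fixed_up.1 hv, rep_mul_apply]
        rw [h5, hρ.inner_left (up _), SpecialLinearGroup.transvection_inv, mem_fixed_up.1 hv]
    rw [h4] at h3
    have h5 := inner_weyl_nonpos hρ hv hY
    have hc : (Fintype.card F : ℂ) ≠ 0 := Nat.cast_ne_zero.2 Fintype.card_ne_zero
    have h6 : (Fintype.card F : ℂ) * (‖(Fintype.card F : ℂ)⁻¹ • ∑ h, (ρ.comp loHom) h v‖ : ℂ) ^ 2 =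
        (‖v‖ : ℂ) ^ 2 + ∑ s : Fˣ, ⟪ρ (weyl * tor s) v, v⟫_ℂ := by
      rw [← h3]
      simp only [map_inv₀, Complex.conj_natCast]
      rw [mul_inv_cancel_left₀ hc]
    have h7 := congrArg Complex.re h6
    rw [natCast_mul_re, ← Complex.ofReal_pow, Complex.ofReal_re, Complex.add_re,
      ← Complex.ofReal_pow, Complex.ofReal_re] at h7
    rw [avg_apply, hcard, h7]
    linarith
  rw [h1]
  have h8 := norm_inner_le_norm (𝕜 := ℂ) (avg (ρ.comp loHom) v) y
  have hc : (0 : ℝ) ≤ Fintype.card F := Nat.cast_nonneg _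
  calc _ ≤ (Fintype.card F : ℝ) * (‖avg (ρ.comp loHom) v‖ * ‖y‖) ^ 2 := by gcongr
    _ = (Fintype.card F * ‖avg (ρ.comp loHom) v‖ ^ 2) * ‖y‖ ^ 2 := by ring
    _ ≤ _ := by gcongr

theorem card_mul_finrank_fixed_up_le [FiniteDimensional ℂ V] (hρ : IsUnitary ρ) :
    Fintype.card F * finrank ℂ (fixed (ρ.comp upHom)) ≤
      Fintype.card F * finrank ℂ (fixed (ρ.comp upHom) ⊓ fixed (ρ.comp loHom) : Submodule ℂ V) +
        2 * finrank ℂ V := by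
  set Y := fixed (ρ.comp upHom) ⊓ fixed (ρ.comp loHom) with hYdef
  set X := Yᗮ ⊓ fixed (ρ.comp upHom) with hX
  have hdim : finrank ℂ Y + finrank ℂ X = finrank ℂ (fixed (ρ.comp upHom)) :=
    Submodule.finrank_add_inf_finrank_orthogonal inf_le_left
  have hinj : ∀ g, Function.Injective (ρ g) := fun g =>
    Function.LeftInverse.injective (rep_inv_apply_self ρ g)
  have key := finrank_mul_card_le (fun b : F => X.map (ρ (up b * weyl))) (finrank ℂ X)
    (fun b => (Submodule.equivMapOfInjective _ (hinj _) X).finrank_eq.symm) (by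
      rintro a b hab _ ⟨v, hv, rfl⟩ _ ⟨v', hv', rfl⟩
      rw [hρ.norm, hρ.norm]
      have hc : b - a ≠ 0 := sub_ne_zero.2 hab.symm
      set s : Fˣ := Units.mk0 (b - a) hc
      have e1 : (up b * weyl)⁻¹ * (up a * weyl) = lo (s : F) := by
        rw [inv_mul_eq_iff_eq_mul, mul_assoc, ← inv_mul_eq_iff_eq_mul,
          SpecialLinearGroup.transvection_inv, ← mul_assoc, up_add, ← mul_inv_eq_iff_eq_mul]
        rw [mul_inv_eq_iff_eq_mul]
        have : -b + a = -(s : F) := by simp [s]; abel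
        rw [this, ← weyl_mul_lo]
      have e2 : ⟪ρ (up a * weyl) v, ρ (up b * weyl) v'⟫_ℂ = ⟪ρ (tor s) v, ρ weyl⁻¹ v'⟫_ℂ := by
        rw [hρ.inner_right, ← rep_mul_apply, e1, lo_eq, rep_mul_apply, mem_fixed_up.1 hv.2,
          rep_mul_apply, hρ.inner_left, SpecialLinearGroup.transvection_inv, mem_fixed_up.1 hv'.2,
          rep_mul_apply, hρ.inner_left]
      rw [e2]
      have := card_mul_inner_sq_le hρ (tor_mem_fixed_up hv.2 s) (by
        rw [Submodule.mem_orthogonal]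
        intro y hy
        rw [← (Submodule.mem_orthogonal _ _).1 hv.1 y hy, ← hρ (tor s) y v,
          tor_mem_fixed_both hy]) (weyl_inv_mem_fixed_lo hv'.2)
      rwa [hρ.norm, hρ.norm] at this)
  rw [← hdim, mul_add]
  linarith [mul_comm (finrank ℂ X) (Fintype.card F)]

end SLTwo

end SLWord

namespace SLWord

open scoped InnerProductSpace MatrixGroups
open Module Matrix

section Embedding

variable {κ ι R : Type*} [Fintype κ] [DecidableEq κ] [Fintype ι] [DecidableEq ι] [CommRing R]

lemma submatrix_one_mul_submatrix_one (f : κ ↪ ι) :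
    ((1 : Matrix ι ι R).submatrix f id) * ((1 : Matrix ι ι R).submatrix id f) = 1 := by
  rw [← submatrix_mul _ _ _ _ _ Function.bijective_id, one_mul, submatrix_one_embedding]

/-- The block embedding of matrices along an injection of index sets. -/
def embM (f : κ ↪ ι) : Matrix κ κ R →* Matrix ι ι R where
  toFun A := 1 + (1 : Matrix ι ι R).submatrix id f * (A - 1) * (1 : Matrix ι ι R).submatrix f id
  map_one' := by simp
  map_mul' A B := by
    have h := submatrix_one_mul_submatrix_one (R := R) f
    set S := (1 : Matrix ι ι R).submatrix id f
    set T := (1 : Matrix ι ι R).submatrix f id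
    have : S * (A - 1) * T * (S * (B - 1) * T) = S * ((A - 1) * (B - 1)) * T := by
      rw [show S * (A - 1) * T * (S * (B - 1) * T) = S * (A - 1) * (T * S) * (B - 1) * T by
        simp only [Matrix.mul_assoc], h]
      simp only [Matrix.mul_assoc, Matrix.mul_one]
    have h2 : A * B - 1 = (A - 1) + (B - 1) + (A - 1) * (B - 1) := by noncomm_ring
    rw [h2, add_mul (1 : Matrix ι ι R), mul_add (S * (A - 1) * T), this, mul_one, one_mul,
      Matrix.mul_add, Matrix.mul_add, Matrix.add_mul, Matrix.add_mul]
    abel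

lemma embM_apply (f : κ ↪ ι) (A : Matrix κ κ R) : embM f A =
    1 + (1 : Matrix ι ι R).submatrix id f * (A - 1) * (1 : Matrix ι ι R).submatrix f id := rfl

lemma det_embM (f : κ ↪ ι) (A : Matrix κ κ R) : (embM f A).det = A.det := by
  rw [embM_apply, Matrix.mul_assoc, Matrix.det_one_add_mul_comm, Matrix.mul_assoc,
    submatrix_one_mul_submatrix_one, Matrix.mul_one, add_sub_cancel]

lemma submatrix_one_mul_single (f : κ ↪ ι) (a b : κ) (t : R) :
    (1 : Matrix ι ι R).submatrix id f * single a b t * (1 : Matrix ι ι R).submatrix f id =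
      single (f a) (f b) t := by
  ext x y
  rw [Matrix.mul_apply]
  simp only [Matrix.mul_apply, Matrix.single_apply, submatrix_apply, id, Matrix.one_apply]
  rw [Finset.sum_eq_single b, Finset.sum_eq_single a]
  · by_cases h1 : f a = x <;> by_cases h2 : f b = y <;> simp [h1, h2, eq_comm]
    intro h; exact absurd h.symm h1
  · intro c _ hc; simp [hc.symm]
  · simp
  · intro c _ hc; simp [hc.symm]
  · simp

end Embedding

section EmbSL

variable {κ ι F : Type*} [Fintype κ] [DecidableEq κ] [Fintype ι] [DecidableEq ι] [Field F]

/-- The block embedding of special linear groups along an injection of index sets. -/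
def embSL (f : κ ↪ ι) : SpecialLinearGroup κ F →* SpecialLinearGroup ι F where
  toFun A := ⟨embM f A, by rw [det_embM, A.det_coe]⟩
  map_one' := Subtype.ext (map_one (embM f))
  map_mul' A B := Subtype.ext (map_mul (embM f) A.1 B.1)

lemma embSL_transvection (f : κ ↪ ι) {a b : κ} (hab : a ≠ b) (hf : f a ≠ f b) (t : F) :
    embSL f (SpecialLinearGroup.transvection hab t) = SpecialLinearGroup.transvection hf t := by
  apply Subtype.ext
  change embM f (1 + single a b t) = 1 + single (f a) (f b) t
  rw [embM_apply, add_sub_cancel_left, submatrix_one_mul_single]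

lemma diag2n_eq_add {i j : ι} (hij : i ≠ j) {a : F} (ha : a ≠ 0) :
    (SpecialLinearGroup.diag2n hij a ha).1 = 1 + (single i i (a - 1) + single j j (a⁻¹ - 1)) := by
  rw [SpecialLinearGroup.diag2n_coe]
  ext x y
  by_cases hxy : x = y
  · subst hxy
    by_cases h1 : x = i
    · subst h1; simp [hij.symm]
    · by_cases h2 : x = j
      · subst h2; simp [hij, h1]
      · simp [h1, h2, Ne.symm h1, Ne.symm h2]
  · simp only [diagonal_apply_ne _ hxy, Matrix.add_apply, one_apply_ne hxy, single_apply]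
    by_cases h1 : i = x <;> by_cases h2 : j = x <;> simp_all

lemma embSL_diag2n (f : κ ↪ ι) {a b : κ} (hab : a ≠ b) (hf : f a ≠ f b) {t : F} (ht : t ≠ 0) :
    embSL f (SpecialLinearGroup.diag2n hab t ht) = SpecialLinearGroup.diag2n hf t ht := by
  apply Subtype.ext
  rw [diag2n_eq_add]
  change embM f (SpecialLinearGroup.diag2n hab t ht).1 = _
  rw [diag2n_eq_add, embM_apply, add_sub_cancel_left, Matrix.mul_add, Matrix.add_mul,
    submatrix_one_mul_single,
    submatrix_one_mul_single]

/-- The embedding of a two-element index set. -/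
def pairEmb {i j : ι} (hij : i ≠ j) : Fin 2 ↪ ι :=
  ⟨![i, j], by
    intro a b h
    fin_cases a <;> fin_cases b <;> simp_all [hij.symm]⟩

end EmbSL

section RootFixed

variable {ι F : Type*} [Fintype ι] [DecidableEq ι] [Field F]

local notation "tv" => SpecialLinearGroup.transvection

lemma transvection_mul_transvection {i j k : ι} (hij : i ≠ j) (hjk : j ≠ k) (hik : i ≠ k)
    (t b : F) : tv hij t * tv hjk b = tv hjk b * tv hij t * tv hik (t * b) := by
  apply Subtype.ext
  change (1 + single i j t) * (1 + single j k b) =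
    (1 + single j k b) * (1 + single i j t) * (1 + single i k (t * b))
  simp [mul_add, add_mul, hij.symm, hik.symm]
  abel

lemma transvection_comm_of_col {i j k : ι} (hjk : j ≠ k) (hik : i ≠ k)
    (t b : F) : tv hjk b * tv hik t = tv hik t * tv hjk b := by
  apply Subtype.ext
  change (1 + single j k b) * (1 + single i k t) =
    (1 + single i k t) * (1 + single j k b)
  simp [mul_add, add_mul, hjk.symm, hik.symm]
  abel

variable {V : Type*} [NormedAddCommGroup V] [InnerProductSpace ℂ V]
variable {ρ : SpecialLinearGroup ι F →* End ℂ V}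

lemma mem_fixed_root {i j : ι} {hij : i ≠ j} {v : V} :
    v ∈ fixed (ρ.comp (rootHom hij)) ↔ ∀ t : F, ρ (tv hij t) v = v := Iff.rfl

lemma comp_embSL_comp {i j : ι} (hij : i ≠ j) :
    (ρ.comp (embSL (pairEmb hij))).comp (upHom (F := F)) = ρ.comp (rootHom hij) :=
  MonoidHom.ext fun t =>
    congrArg ρ (embSL_transvection (F := F) (pairEmb hij) zero_ne_one hij t.toAdd)

lemma comp_embSL_comp' {i j : ι} (hij : i ≠ j) :
    (ρ.comp (embSL (pairEmb hij))).comp (loHom (F := F)) = ρ.comp (rootHom hij.symm) :=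
  MonoidHom.ext fun t => congrArg ρ
    (embSL_transvection (F := F) (pairEmb hij) one_ne_zero hij.symm t.toAdd)

lemma mem_fixed_of_root [Nontrivial ι] {v : V}
    (h : ∀ (i j : ι) (hij : i ≠ j) (t : F), ρ (tv hij t) v = v) : v ∈ fixed ρ := by
  intro g
  have hmul : ∀ A B, ρ A v = v → ρ B v = v → ρ (A * B) v = v := fun A B hA hB => by
    rw [rep_mul_apply, hB, hA]
  refine SpecialLinearGroup.diagonal_transvection_induction' (fun g => ρ g v = v) g ?_ h hmul
  intro i j hij c hc
  have e : embSL (pairEmb hij) (SpecialLinearGroup.diag2n zero_ne_one c hc) =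
    SpecialLinearGroup.diag2n hij c hc := embSL_diag2n (F := F) (pairEmb hij) zero_ne_one hij hc
  rw [← e]
  refine SL2.transvection_induction (fun A => ρ (embSL (pairEmb hij) A) v = v) ?_ ?_ _
  · intro a b hab t
    rw [embSL_transvection _ hab ((pairEmb hij).injective.ne hab)]
    exact h _ _ _ _
  · intro A B hA hB
    rw [map_mul]
    exact hmul _ _ hA hB

lemma mem_fixed_of_row_col [Nontrivial ι] (i : ι) {v : V}
    (h : ∀ k (hk : i ≠ k), v ∈ fixed (ρ.comp (rootHom hk)) ⊓ fixed (ρ.comp (rootHom hk.symm))) :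
    v ∈ fixed ρ := by
  refine mem_fixed_of_root fun k l hkl t => ?_
  by_cases hk : i = k
  · subst hk; exact (h l hkl).1 _
  by_cases hl : i = l
  · subst hl; exact (h k hk).2 _
  have e := transvection_mul_transvection (Ne.symm hk) hl hkl t 1
  have h1 := congrArg (fun g => ρ g v) e
  simp only [rep_mul_apply, mul_one] at h1
  rw [mem_fixed_root.1 (h l hl).1, mem_fixed_root.1 (h k hk).2] at h1
  have h2 := congrArg (fun x => ρ (tv (Ne.symm hk) t)⁻¹ (ρ (tv hl 1)⁻¹ x)) h1
  simp only [rep_inv_apply_self] at h2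
  rw [← h2, SpecialLinearGroup.transvection_inv, SpecialLinearGroup.transvection_inv,
    mem_fixed_root.1 (h l hl).1, mem_fixed_root.1 (h k hk).2]

variable [Fintype F] [DecidableEq F] [FiniteDimensional ℂ V]

lemma card_mul_finrank_root_le (hρ : IsUnitary ρ) {i j : ι} (hij : i ≠ j) :
    Fintype.card F * finrank ℂ (fixed (ρ.comp (rootHom hij))) ≤
      Fintype.card F * finrank ℂ
        (fixed (ρ.comp (rootHom hij)) ⊓ fixed (ρ.comp (rootHom hij.symm)) : Submodule ℂ V) +
        2 * finrank ℂ V := by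
  have := card_mul_finrank_fixed_up_le (hρ.comp (embSL (pairEmb hij)))
  rwa [comp_embSL_comp, comp_embSL_comp'] at this

lemma card_mul_finrank_row_le (hρ : IsUnitary ρ) {i j k : ι} (hij : i ≠ j) (hjk : j ≠ k)
    (hik : i ≠ k) :
    Fintype.card F * finrank ℂ (fixed (ρ.comp (rootHom hij))) ≤
      Fintype.card F * finrank ℂ
        (fixed (ρ.comp (rootHom hij)) ⊓ fixed (ρ.comp (rootHom hik)) : Submodule ℂ V) +
        2 * finrank ℂ V := by
  set Y := fixed (ρ.comp (rootHom hij)) ⊓ fixed (ρ.comp (rootHom hik)) with hYdef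
  set X := Yᗮ ⊓ fixed (ρ.comp (rootHom hij)) with hX
  have hdim : finrank ℂ Y + finrank ℂ X = finrank ℂ (fixed (ρ.comp (rootHom hij))) :=
    Submodule.finrank_add_inf_finrank_orthogonal inf_le_left
  have hinj : ∀ g, Function.Injective (ρ g) := fun g =>
    Function.LeftInverse.injective (rep_inv_apply_self ρ g)
  have key := finrank_mul_card_le (fun b : F => X.map (ρ (tv hjk b))) (finrank ℂ X)
    (fun b => (Submodule.equivMapOfInjective _ (hinj _) X).finrank_eq.symm) (by
      rintro a b hab _ ⟨v, hv, rfl⟩ _ ⟨v', hv', rfl⟩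
      have hc : a - b ≠ 0 := sub_ne_zero.2 hab
      set c := a - b
      set w := ρ (tv hjk c) v with hw
      have e1 : (tv hjk b)⁻¹ * tv hjk a = tv hjk c := by
        rw [SpecialLinearGroup.transvection_inv, ← SpecialLinearGroup.transvection_add]
        congr 1; simp [c]; abel
      have e2 : ⟪ρ (tv hjk a) v, ρ (tv hjk b) v'⟫_ℂ = ⟪w, v'⟫_ℂ := by
        rw [hρ.inner_right, ← rep_mul_apply, e1]
      have e3 : avg (ρ.comp (rootHom hij)) w = avg (ρ.comp (rootHom hik)) w := by
        rw [avg_apply, avg_apply]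
        congr 1
        rw [← Equiv.sum_comp Multiplicative.ofAdd, ← Equiv.sum_comp Multiplicative.ofAdd]
        change ∑ t : F, ρ (tv hij t) w = ∑ t : F, ρ (tv hik t) w
        rw [← Equiv.sum_comp (Equiv.mulRight₀ c hc) (fun t => ρ (tv hik t) w)]
        refine Finset.sum_congr rfl fun t _ => ?_
        change _ = ρ (tv hik (t * c)) w
        rw [hw, ← rep_mul_apply, ← rep_mul_apply, transvection_mul_transvection hij hjk hik,
          mul_assoc, show tv hij t * tv hik (t * c) = tv hik (t * c) * tv hij t from ?_,
          ← mul_assoc, transvection_comm_of_col, rep_mul_apply, mem_fixed_root.1 hv.2]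
        apply Subtype.ext
        change (1 + single i j t) * (1 + single i k (t * c)) =
          (1 + single i k (t * c)) * (1 + single i j t)
        simp [mul_add, add_mul, hij.symm, hik.symm]
        abel
      have e4 : avg (ρ.comp (rootHom hij)) w ∈ Y :=
        ⟨avg_mem _ _, e3 ▸ avg_mem _ _⟩
      have e5 : ⟪w, v'⟫_ℂ = 0 := by
        rw [← inner_avg_of_mem (hρ.comp (rootHom hij)) hv'.2]
        exact (Submodule.mem_orthogonal _ _).1 hv'.1 _ e4
      rw [e2, e5]
      rw [norm_zero, zero_pow two_ne_zero, mul_zero]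
      positivity)
  rw [← hdim, mul_add]
  linarith [mul_comm (finrank ℂ X) (Fintype.card F)]

lemma finrank_add_finrank_le_of_le {X W Z : Submodule ℂ V} (hX : X ≤ Z) (hW : W ≤ Z) :
    finrank ℂ X + finrank ℂ W ≤ finrank ℂ (X ⊓ W : Submodule ℂ V) + finrank ℂ Z := by
  rw [← Submodule.finrank_sup_add_finrank_inf_eq, add_comm]
  exact Nat.add_le_add_left (Submodule.finrank_mono (sup_le hX hW)) _

theorem card_mul_finrank_root_le_fixed [Nontrivial ι] (hρ : IsUnitary ρ) {i j : ι} (hij : i ≠ j) :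
    Fintype.card F * finrank ℂ (fixed (ρ.comp (rootHom hij))) ≤
      Fintype.card F * finrank ℂ (fixed ρ) + Fintype.card ι * (4 * finrank ℂ V) := by
  set q := Fintype.card F
  set A := fixed (ρ.comp (rootHom hij)) with hA
  let W : {k // i ≠ k} → Submodule ℂ V := fun k =>
    fixed (ρ.comp (rootHom k.2)) ⊓ fixed (ρ.comp (rootHom k.2.symm))
  have hW : ∀ k, q * finrank ℂ A ≤ q * finrank ℂ (A ⊓ W k : Submodule ℂ V) + 4 * finrank ℂ V := by
    intro k
    by_cases hjk : j = k.1
    · have e : A ⊓ W k = A ⊓ fixed (ρ.comp (rootHom hij.symm)) := by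
        obtain ⟨k, hk⟩ := k
        subst hjk
        change A ⊓ (A ⊓ _) = _
        rw [← inf_assoc, inf_idem]
      rw [e]
      have := card_mul_finrank_root_le hρ hij
      change q * finrank ℂ A ≤ q * finrank ℂ (A ⊓ _ : Submodule ℂ V) + _ at this
      omega
    · have h1 := card_mul_finrank_row_le hρ hij hjk k.2
      have h2 := card_mul_finrank_root_le hρ k.2
      have h3 := finrank_add_finrank_le_of_le (X := A ⊓ fixed (ρ.comp (rootHom k.2))) (W := W k)
        (Z := fixed (ρ.comp (rootHom k.2))) inf_le_right inf_le_left
      have e : A ⊓ fixed (ρ.comp (rootHom k.2)) ⊓ W k = A ⊓ W k := by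
        rw [inf_assoc, ← inf_assoc (fixed (ρ.comp (rootHom k.2))), inf_idem]
      rw [e] at h3
      have h4 := Nat.mul_le_mul_left q h3
      simp only [mul_add] at h4
      change q * finrank ℂ A ≤ q * finrank ℂ (A ⊓ _ : Submodule ℂ V) + _ at h1
      change q * _ ≤ q * finrank ℂ (W k) + _ at h2
      omega
  have hT : ∀ T : Finset {k // i ≠ k}, q * finrank ℂ A ≤
      q * finrank ℂ (A ⊓ ⨅ k ∈ T, W k : Submodule ℂ V) + T.card * (4 * finrank ℂ V) := by
    intro T
    induction T using Finset.induction_on with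
    | empty => 
      have : (⨅ k ∈ (∅ : Finset {k // i ≠ k}), W k) = ⊤ := by
        refine le_antisymm le_top (le_iInf₂ fun k hk => ?_)
        exact absurd hk (Finset.notMem_empty k)
      rw [this, inf_top_eq]
      exact Nat.le_add_right _ _
    | insert k T hk ih =>
      rw [Finset.card_insert_of_notMem hk, Finset.iInf_insert]
      have h3 := finrank_add_finrank_le_of_le (X := A ⊓ W k) (W := A ⊓ ⨅ k ∈ T, W k)
        (Z := A) inf_le_left inf_le_left
      have e : A ⊓ W k ⊓ (A ⊓ ⨅ k ∈ T, W k) = A ⊓ (W k ⊓ ⨅ k ∈ T, W k) := by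
        rw [inf_inf_inf_comm, inf_idem]
      rw [e] at h3
      have h4 := Nat.mul_le_mul_left q h3
      simp only [mul_add, add_mul] at h4 ⊢
      have := hW k
      omega
  have h1 := hT Finset.univ
  have h2 : A ⊓ ⨅ k ∈ (Finset.univ : Finset {k // i ≠ k}), W k ≤ fixed ρ := by
    intro v hv
    refine mem_fixed_of_row_col i fun k hk => ?_
    have := hv.2
    simp only [Submodule.mem_iInf, Finset.mem_univ, forall_true_left, SetLike.mem_coe] at this
    exact this ⟨k, hk⟩
  have h3 := Nat.mul_le_mul_left q (Submodule.finrank_mono h2)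
  have h4 : (Finset.univ : Finset {k // i ≠ k}).card ≤ Fintype.card ι :=
    Fintype.card_subtype_le _
  have h5 := Nat.mul_le_mul_right (4 * finrank ℂ V) h4
  omega

end RootFixed

end SLWord

namespace SLWord

open scoped InnerProductSpace MatrixGroups
open Module Matrix

section Symmetric

variable {V : Type*} [NormedAddCommGroup V] [InnerProductSpace ℂ V] [FiniteDimensional ℂ V]

lemma re_inner_le_of_eigenvalue_le {M : End ℂ V} (hM : M.IsSymmetric) {c : ℝ}
    (h : ∀ μ : ℝ, End.HasEigenvalue M (μ : ℂ) → μ ≤ c) (v : V) :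
    (⟪M v, v⟫_ℂ).re ≤ c * ‖v‖ ^ 2 := by
  set b := hM.eigenvectorBasis rfl
  have h1 : ⟪M v, v⟫_ℂ = ((∑ i, hM.eigenvalues rfl i * ‖⟪b i, v⟫_ℂ‖ ^ 2 : ℝ) : ℂ) := by
    rw [← b.sum_inner_mul_inner (M v) v]
    push_cast
    refine Finset.sum_congr rfl fun i _ => ?_
    rw [hM, hM.apply_eigenvectorBasis, inner_smul_right, mul_assoc, ← inner_conj_symm v (b i),
      mul_comm (starRingEnd ℂ _), Complex.mul_conj, Complex.normSq_eq_norm_sq]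
    push_cast; rfl
  rw [h1, Complex.ofReal_re, ← b.sum_sq_norm_inner_right v, Finset.mul_sum]
  refine Finset.sum_le_sum fun i _ => ?_
  gcongr
  exact h _ (hM.hasEigenvalue_eigenvalues rfl i)

end Symmetric

section Mass

variable {V : Type*} [NormedAddCommGroup V] [InnerProductSpace ℂ V]
variable {G H : Type*} [Group G] [Group H]

/-- The restriction of a representation to an invariant subspace. -/
def subrep (ρ : G →* End ℂ V) (W : Submodule ℂ V) (hW : ∀ g, ∀ w ∈ W, ρ g w ∈ W) :
    G →* End ℂ W where
  toFun g := (ρ g).restrict (hW g)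
  map_one' := by ext; simp
  map_mul' a b := by ext; simp

lemma coe_subrep_apply (ρ : G →* End ℂ V) (W : Submodule ℂ V) (hW : ∀ g, ∀ w ∈ W, ρ g w ∈ W)
    (g : G) (w : W) : (subrep ρ W hW g w : V) = ρ g w := rfl

lemma IsUnitary.subrep {ρ : G →* End ℂ V} (hρ : IsUnitary ρ) (W : Submodule ℂ V)
    (hW : ∀ g, ∀ w ∈ W, ρ g w ∈ W) : IsUnitary (subrep ρ W hW) :=
  fun g v w => hρ g v w

lemma fixed_subrep_eq_bot {ρ : G →* End ℂ V} (h : fixed ρ = ⊥) (W : Submodule ℂ V)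
    (hW : ∀ g, ∀ w ∈ W, ρ g w ∈ W) : fixed (subrep ρ W hW) = ⊥ := by
  rw [eq_bot_iff]
  intro w hw
  have : (w : V) ∈ fixed ρ := fun g => congrArg Subtype.val (hw g)
  rw [h, Submodule.mem_bot] at this
  exact (Submodule.mem_bot ℂ).2 (Subtype.ext this)

variable [Fintype G] [Fintype H]

/-- The total squared length of the projections of the orbit of `v` to the fixed vectors of a
subgroup. -/
noncomputable def mass (ρ : G →* End ℂ V) (u : H →* G) (v : V) : ℝ :=
  ∑ x, ‖avg (ρ.comp u) (ρ x v)‖ ^ 2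

/-- The sum of the conjugates of an operator. -/
def conjSum (ρ : G →* End ℂ V) (P : End ℂ V) : End ℂ V := ∑ x, ρ x⁻¹ * P * ρ x

lemma conjSum_apply (ρ : G →* End ℂ V) (P : End ℂ V) (v : V) :
    conjSum ρ P v = ∑ x, ρ x⁻¹ (P (ρ x v)) := by
  simp [conjSum, LinearMap.sum_apply]

lemma conjSum_rep (ρ : G →* End ℂ V) (P : End ℂ V) (g : G) (v : V) :
    conjSum ρ P (ρ g v) = ρ g (conjSum ρ P v) := by
  rw [conjSum_apply, conjSum_apply, map_sum,
    ← Equiv.sum_comp (Equiv.mulRight g⁻¹)]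
  refine Finset.sum_congr rfl fun x _ => ?_
  simp only [Equiv.coe_mulRight, _root_.mul_inv_rev, inv_inv, ← rep_mul_apply, inv_mul_cancel_right]

lemma inner_conjSum_self {ρ : G →* End ℂ V} (hρ : IsUnitary ρ) (u : H →* G) (v : V) :
    ⟪conjSum ρ (avg (ρ.comp u)) v, v⟫_ℂ = (mass ρ u v : ℂ) := by
  rw [conjSum_apply, sum_inner, mass]
  push_cast
  refine Finset.sum_congr rfl fun x _ => ?_
  rw [hρ.inner_left, inv_inv, inner_avg_self (hρ.comp u)]

lemma conjSum_isSymmetric {ρ : G →* End ℂ V} (hρ : IsUnitary ρ) (u : H →* G) :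
    (conjSum ρ (avg (ρ.comp u))).IsSymmetric := by
  intro v w
  rw [conjSum_apply, conjSum_apply, sum_inner, inner_sum]
  refine Finset.sum_congr rfl fun x _ => ?_
  rw [hρ.inner_left, inv_inv, inner_avg_left (hρ.comp u), hρ.inner_right, inv_inv]

variable [FiniteDimensional ℂ V]

lemma trace_avg (σ : H →* End ℂ V) : LinearMap.trace ℂ V (avg σ) = finrank ℂ (fixed σ) := by
  have h : LinearMap.IsProj (fixed σ) (avg σ) := ⟨avg_mem σ, fun _ hx => avg_of_mem hx⟩
  exact h.trace

theorem mass_le {ρ : G →* End ℂ V} (hρ : IsUnitary ρ) (u : H →* G) {c : ℝ}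
    (h : ∀ (W : Submodule ℂ V) (hW : ∀ g, ∀ w ∈ W, ρ g w ∈ W),
      (finrank ℂ (fixed ((subrep ρ W hW).comp u)) : ℝ) ≤ c * finrank ℂ W) (v : V) :
    mass ρ u v ≤ c * Fintype.card G * ‖v‖ ^ 2 := by
  have h1 := inner_conjSum_self hρ u v
  have h2 : mass ρ u v = (⟪conjSum ρ (avg (ρ.comp u)) v, v⟫_ℂ).re := by
    rw [h1, Complex.ofReal_re]
  rw [h2]
  refine re_inner_le_of_eigenvalue_le (conjSum_isSymmetric hρ u) (fun μ hμ => ?_) v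
  set M := conjSum ρ (avg (ρ.comp u)) with hM
  set W := End.eigenspace M (μ : ℂ) with hWdef
  have hW : ∀ g, ∀ w ∈ W, ρ g w ∈ W := fun g w hw => by
    rw [hWdef, End.mem_eigenspace_iff] at hw ⊢
    rw [hM, conjSum_rep, ← hM, hw, map_smul]
  have hP : ∀ w : W, (avg ((subrep ρ W hW).comp u) w : V) = avg (ρ.comp u) w := fun w => by
    rw [avg_apply, avg_apply]
    push_cast
    rfl
  have hMW : conjSum (subrep ρ W hW) (avg ((subrep ρ W hW).comp u)) = (μ : ℂ) • 1 := by
    ext w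
    have := End.mem_eigenspace_iff.1 w.2
    rw [hM, conjSum_apply] at this
    rw [conjSum_apply]
    push_cast
    simp_rw [coe_subrep_apply, hP]
    exact this
  have ht := congrArg (LinearMap.trace ℂ W) hMW
  rw [conjSum, map_sum, map_smul, LinearMap.trace_one] at ht
  have ht2 : ∀ x, LinearMap.trace ℂ W (subrep ρ W hW x⁻¹ * avg ((subrep ρ W hW).comp u) *
      subrep ρ W hW x) = finrank ℂ (fixed ((subrep ρ W hW).comp u)) := fun x => by
    rw [LinearMap.trace_mul_cycle, ← map_mul, mul_inv_cancel, map_one, one_mul, trace_avg]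
  rw [Finset.sum_congr rfl fun x _ => ht2 x, Finset.sum_const, Finset.card_univ, nsmul_eq_mul,
    smul_eq_mul] at ht
  have ht3 : (Fintype.card G : ℝ) * finrank ℂ (fixed ((subrep ρ W hW).comp u)) =
      μ * finrank ℂ W := by exact_mod_cast ht
  have hpos : (0 : ℝ) < finrank ℂ W := by
    have : W ≠ ⊥ := hμ
    have : Nontrivial W := Submodule.nontrivial_iff_ne_bot.2 this
    exact_mod_cast finrank_pos
  have h4 := mul_le_mul_of_nonneg_left (h W hW) (Nat.cast_nonneg (α := ℝ) (Fintype.card G))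
  rw [ht3] at h4
  exact le_of_mul_le_mul_right (by linarith) hpos

end Mass

section RootMass

variable {ι F : Type*} [Fintype ι] [DecidableEq ι] [Field F]

/-- The root subgroup `t ↦ 1 + t y φ` attached to a vector and a functional vanishing on it. -/
def vecRoot (y φ : ι → F) (h : φ ⬝ᵥ y = 0) : Multiplicative F →* SpecialLinearGroup ι F where
  toFun t := ⟨1 + t.toAdd • vecMulVec y φ, by
    rw [← smul_vecMulVec, vecMulVec_eq Unit, det_one_add_replicateCol_mul_replicateRow]
    simp [h]⟩
  map_one' := by apply Subtype.ext; simp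
  map_mul' a b := by
    apply Subtype.ext
    have : vecMulVec y φ * vecMulVec y φ = 0 := by
      rw [vecMulVec_mul_vecMulVec, h, zero_smul, vecMulVec_zero]
    change 1 + (a.toAdd + b.toAdd) • vecMulVec y φ =
      (1 + a.toAdd • vecMulVec y φ) * (1 + b.toAdd • vecMulVec y φ)
    simp [mul_add, add_mul, this, add_smul]
    abel

lemma exists_conj_vecRoot {y φ : ι → F} (hy : y ≠ 0) (hφ : φ ≠ 0) (h : φ ⬝ᵥ y = 0) :
    ∃ (i k : ι) (hik : i ≠ k) (S : SpecialLinearGroup ι F) (c : F), c ≠ 0 ∧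
      ∀ t, S * SpecialLinearGroup.transvection hik t =
        vecRoot y φ h (Multiplicative.ofAdd (t * c)) * S := by
  obtain ⟨i, hi⟩ := Function.ne_iff.1 hy
  set A : Matrix ι ι F := (1 : Matrix ι ι F).updateCol i y with hA
  have hAdet : A.det = y i := by rw [hA, ← cramer_apply, cramer_one]; rfl
  have hAi : A *ᵥ Pi.single i 1 = y := by
    ext x; simp [hA]
  set φ' := φ ᵥ* A with hφ'
  have hφ'i : φ' i = 0 := by
    have : φ' ⬝ᵥ Pi.single i 1 = φ ⬝ᵥ y := by rw [hφ', ← dotProduct_mulVec, hAi]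
    rw [h] at this; simpa using this
  have hφ'0 : φ' ≠ 0 := by
    intro h0
    refine hφ ?_
    have hu : IsUnit A.det := by rw [hAdet]; exact hi.isUnit
    have : φ' ᵥ* A⁻¹ = φ := by rw [hφ', vecMul_vecMul, mul_nonsing_inv _ hu, vecMul_one]
    rw [← this, h0, zero_vecMul]
  obtain ⟨k, hk⟩ := Function.ne_iff.1 hφ'0
  have hik : i ≠ k := by rintro rfl; exact hk hφ'i
  set B : Matrix ι ι F := (1 : Matrix ι ι F).updateRow k φ' with hB
  have hBdet : B.det = φ' k := by
    rw [hB, ← det_transpose, ← updateCol_transpose, transpose_one, ← cramer_apply, cramer_one]; rfl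
  have hBu : IsUnit B.det := by rw [hBdet]; exact (show φ' k ≠ 0 from hk).isUnit
  have hBi : B *ᵥ Pi.single i 1 = Pi.single i 1 := by
    ext x
    by_cases hx : x = k
    · subst hx; simp [hB, hφ'i, hik.symm]
    · simp [hB, hx, one_apply, Pi.single_apply]
  have hBi' : B⁻¹ *ᵥ Pi.single i 1 = Pi.single i 1 := by
    conv_lhs => rw [← hBi, mulVec_mulVec, nonsing_inv_mul _ hBu, one_mulVec]
  have hBk : Pi.single k 1 ᵥ* B = φ' := by
    ext x; simp [hB]
  have hBk' : φ' ᵥ* B⁻¹ = Pi.single k 1 := by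
    rw [← hBk, vecMul_vecMul, mul_nonsing_inv _ hBu, vecMul_one]
  set δ := (A * B⁻¹).det with hδ
  have hδ0 : δ ≠ 0 := by
    rw [hδ, det_mul, det_nonsing_inv, hAdet, Ring.inverse_eq_inv', hBdet]
    exact mul_ne_zero hi (inv_ne_zero hk)
  set D : Matrix ι ι F := diagonal (Function.update 1 i δ⁻¹) with hD
  have hDi : D *ᵥ Pi.single i 1 = δ⁻¹ • Pi.single i 1 := by
    ext x; by_cases hx : x = i
    · subst hx; simp [hD]
    · simp [hD, hx]
  have hDk : Pi.single k 1 ᵥ* D = Pi.single k 1 := by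
    ext x; by_cases hx : x = k
    · subst hx; simp [hD, hik.symm, vecMul_diagonal]
    · simp [hD, hx, vecMul_diagonal]
  have hDdet : D.det = δ⁻¹ := by
    rw [hD, det_diagonal, Finset.prod_update_of_mem (Finset.mem_univ i)]; simp
  refine ⟨i, k, hik, ⟨A * B⁻¹ * D, by rw [det_mul, ← hδ, hDdet, mul_inv_cancel₀ hδ0]⟩, δ⁻¹,
    inv_ne_zero hδ0, fun t => ?_⟩
  have hS1 : (A * B⁻¹ * D) *ᵥ Pi.single i 1 = δ⁻¹ • y := by
    rw [← mulVec_mulVec, hDi, mulVec_smul, ← mulVec_mulVec, hBi', hAi]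
  have hS2 : φ ᵥ* (A * B⁻¹ * D) = Pi.single k 1 := by
    rw [← vecMul_vecMul, ← vecMul_vecMul, ← hφ', hBk', hDk]
  apply Subtype.ext
  change (A * B⁻¹ * D) * (1 + single i k t) = (1 + (t * δ⁻¹) • vecMulVec y φ) * (A * B⁻¹ * D)
  rw [mul_add, add_mul, mul_one, one_mul]
  congr 1
  have e : single i k t = t • vecMulVec (Pi.single i (1 : F)) (Pi.single k 1) := by
    rw [← single_eq_single_vecMulVec_single]
    simp
  rw [e, Matrix.mul_smul, mul_vecMulVec, hS1, smul_mul, vecMulVec_mul, hS2, smul_vecMulVec,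
    smul_smul]

variable {V : Type*} [NormedAddCommGroup V] [InnerProductSpace ℂ V] [FiniteDimensional ℂ V]
variable {ρ : SpecialLinearGroup ι F →* End ℂ V}
variable [Fintype F] [DecidableEq F] 

theorem mass_rootHom_le [Nontrivial ι] (hρ : IsUnitary ρ) (h0 : fixed ρ = ⊥) {i k : ι}
    (hik : i ≠ k) (v : V) :
    mass ρ (rootHom hik) v ≤ (4 * Fintype.card ι / Fintype.card F) *
      Fintype.card (SpecialLinearGroup ι F) * ‖v‖ ^ 2 := by
  refine mass_le hρ _ (fun W hW => ?_) v
  have h1 := card_mul_finrank_root_le_fixed (hρ.subrep W hW) hik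
  rw [fixed_subrep_eq_bot h0, finrank_bot, mul_zero, zero_add] at h1
  have hc : (0 : ℝ) < Fintype.card F := Nat.cast_pos.2 Fintype.card_pos
  rw [div_mul_eq_mul_div, le_div_iff₀ hc]
  have h2 : (Fintype.card F * finrank ℂ (fixed ((subrep ρ W hW).comp (rootHom hik))) : ℝ) ≤
    Fintype.card ι * (4 * finrank ℂ W) := by exact_mod_cast h1
  linarith

theorem mass_vecRoot_le [Nontrivial ι] (hρ : IsUnitary ρ) (h0 : fixed ρ = ⊥) {y φ : ι → F}
    (hy : y ≠ 0) (hφ : φ ≠ 0) (h : φ ⬝ᵥ y = 0) (v : V) :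
    mass ρ (vecRoot y φ h) v ≤ (4 * Fintype.card ι / Fintype.card F) *
      Fintype.card (SpecialLinearGroup ι F) * ‖v‖ ^ 2 := by
  obtain ⟨i, k, hik, S, c, hc, hS⟩ := exists_conj_vecRoot hy hφ h
  refine le_trans (le_of_eq ?_) (mass_rootHom_le hρ h0 hik v)
  unfold mass
  rw [← Equiv.sum_comp (Equiv.mulLeft S)]
  refine Finset.sum_congr rfl fun x _ => ?_
  congr 1
  rw [← hρ.norm S (avg (ρ.comp (rootHom hik)) (ρ x v)), avg_apply, avg_apply, map_smul, map_sum]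
  congr 2
  rw [← Equiv.sum_comp Multiplicative.ofAdd, ← Equiv.sum_comp Multiplicative.ofAdd,
    ← Equiv.sum_comp (Equiv.mulRight₀ c hc)]
  refine Finset.sum_congr rfl fun t _ => ?_
  change ρ (vecRoot y φ h (Multiplicative.ofAdd (t * c))) (ρ (S * x) v) =
    ρ S (ρ (SpecialLinearGroup.transvection hik t) (ρ x v))
  rw [rep_mul_apply, ← rep_mul_apply, ← rep_mul_apply ρ S, hS]

end RootMass

end SLWord

namespace SLWord

open scoped InnerProductSpace MatrixGroups
open Module Matrix

section ClassSum

variable {V : Type*} [NormedAddCommGroup V] [InnerProductSpace ℂ V]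
variable {G : Type*} [Group G] [Fintype G]

/-- The matrix coefficient of the sum of all conjugates of `g`. -/
noncomputable def cls (ρ : G →* End ℂ V) (g : G) (v w : V) : ℂ :=
  ∑ x, ⟪ρ (x * g * x⁻¹) v, w⟫_ℂ

lemma cls_conj (ρ : G →* End ℂ V) (g h : G) (v w : V) :
    cls ρ (h * g * h⁻¹) v w = cls ρ g v w := by
  unfold cls
  rw [← Equiv.sum_comp (Equiv.mulRight h) (fun x => ⟪ρ (x * g * x⁻¹) v, w⟫_ℂ)]
  refine Finset.sum_congr rfl fun x _ => ?_
  simp [mul_assoc]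

lemma cls_eq_sum {ρ : G →* End ℂ V} (hρ : IsUnitary ρ) (g : G) (v w : V) :
    cls ρ g v w = ∑ x, ⟪ρ g (ρ x v), ρ x w⟫_ℂ := by
  unfold cls
  rw [← Equiv.sum_comp (Equiv.inv G)]
  refine Finset.sum_congr rfl fun x _ => ?_
  simp only [Equiv.inv_apply, inv_inv, rep_mul_apply]
  rw [hρ.inner_left, inv_inv]

lemma norm_cls_le {ρ : G →* End ℂ V} (hρ : IsUnitary ρ) (g : G) (v w : V) :
    ‖cls ρ g v w‖ ≤ Fintype.card G * (‖v‖ * ‖w‖) := by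
  unfold cls
  refine (norm_sum_le _ _).trans ?_
  calc _ ≤ ∑ x : G, ‖v‖ * ‖w‖ := by
        refine Finset.sum_le_sum fun x _ => ?_
        simpa [hρ.norm] using norm_inner_le_norm (𝕜 := ℂ) (ρ (x * g * x⁻¹) v) w
    _ = _ := by simp

lemma card_mul_cls {τ : Type*} [Fintype τ] {ρ : G →* End ℂ V} (hρ : IsUnitary ρ) {g : G}
    {h k : τ → G} (hk : ∀ t, h t * g = k t * g * h t) (v w : V) :
    Fintype.card τ * cls ρ g v w =
      ∑ x, ⟪∑ t, ρ (k t) (ρ (g * x) v), ρ x w⟫_ℂ := by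
  have h1 : ∀ t, cls ρ g v w = ∑ x, ⟪ρ (k t) (ρ (g * x) v), ρ x w⟫_ℂ := fun t => by
    rw [← cls_conj ρ g (h t), hk, cls_eq_sum hρ]
    refine Finset.sum_congr rfl fun x _ => ?_
    rw [mul_inv_cancel_right, rep_mul_apply, ← rep_mul_apply ρ g]
  calc _ = ∑ t : τ, cls ρ g v w := by simp
    _ = _ := by
      rw [Finset.sum_congr rfl fun t _ => h1 t, Finset.sum_comm]
      simp_rw [sum_inner]

lemma sum_norm_mul_le {f : G → ℝ} {B b : ℝ} (hb : 0 ≤ b)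
    (h : ∑ x, f x ^ 2 ≤ Fintype.card G * B ^ 2) (hB : 0 ≤ B) :
    ∑ x, f x * b ≤ Fintype.card G * B * b := by
  rw [← Finset.sum_mul]
  refine mul_le_mul_of_nonneg_right ?_ hb
  refine le_of_sq_le_sq ?_ (by positivity)
  refine (sq_sum_le_card_mul_sum_sq).trans ?_
  rw [Finset.card_univ]
  nlinarith [Nat.cast_nonneg (α := ℝ) (Fintype.card G)]

lemma norm_cls_le_of_sum_sq {τ : Type*} [Fintype τ] [Nonempty τ] {ρ : G →* End ℂ V}
    (hρ : IsUnitary ρ) {g : G} {h k : τ → G} (hk : ∀ t, h t * g = k t * g * h t) (v w : V) {B : ℝ}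
    (hB : 0 ≤ B)
    (hs : ∑ x, ‖∑ t, ρ (k t) (ρ x v)‖ ^ 2 ≤ Fintype.card G * B ^ 2) :
    Fintype.card τ * ‖cls ρ g v w‖ ≤ Fintype.card G * B * ‖w‖ := by
  have h1 := congrArg norm (card_mul_cls hρ hk v w)
  rw [norm_mul, Complex.norm_natCast] at h1
  rw [h1]
  refine (norm_sum_le _ _).trans ((Finset.sum_le_sum fun x _ => norm_inner_le_norm _ _).trans ?_)
  simp_rw [hρ.norm]
  refine sum_norm_mul_le (norm_nonneg w) ?_ hB
  refine le_trans (le_of_eq ?_) hs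
  exact Equiv.sum_comp (Equiv.mulLeft g) (fun x => ‖∑ t, ρ (k t) (ρ x v)‖ ^ 2)

lemma norm_cls_le_of_mass {H : Type*} [Group H] [Fintype H] {ρ : G →* End ℂ V}
    (hρ : IsUnitary ρ) {g : G} {u : H →* G} {h : H → G} (hk : ∀ t, h t * g = u t * g * h t)
    {c : ℝ} (hm : ∀ v, mass ρ u v ≤ c * Fintype.card G * ‖v‖ ^ 2) (v w : V) :
    ‖cls ρ g v w‖ ≤ c * Fintype.card G * (‖v‖ * ‖w‖) := by
  have hH : (Fintype.card H : ℂ) ≠ 0 := card_ne_zero_complex H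
  have h1 : cls ρ g v w = ∑ x, ⟪avg (ρ.comp u) (ρ (g * x) v), avg (ρ.comp u) (ρ x w)⟫_ℂ := by
    refine mul_left_cancel₀ hH ?_
    rw [card_mul_cls hρ hk v w, Finset.mul_sum]
    refine Finset.sum_congr rfl fun x _ => ?_
    rw [← inner_avg_left (hρ.comp u), avg_of_mem (avg_mem _ _), avg_apply, inner_smul_left,
      map_inv₀, map_natCast, mul_inv_cancel_left₀ hH]
    rfl
  rw [h1]
  refine (norm_sum_le _ _).trans ((Finset.sum_le_sum fun x _ => norm_inner_le_norm _ _).trans ?_)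
  have hnn : ∀ v, 0 ≤ c * Fintype.card G * ‖v‖ ^ 2 := fun v =>
    (Finset.sum_nonneg fun x _ => by positivity).trans (hm v)
  refine le_of_sq_le_sq ?_ ?_
  · refine (Finset.sum_mul_sq_le_sq_mul_sq _ _ _).trans ?_
    have e : ∑ x, ‖avg (ρ.comp u) (ρ (g * x) v)‖ ^ 2 = mass ρ u v :=
      Equiv.sum_comp (Equiv.mulLeft g) (fun x => ‖avg (ρ.comp u) (ρ x v)‖ ^ 2)
    rw [e]
    calc _ ≤ (c * Fintype.card G * ‖v‖ ^ 2) * (c * Fintype.card G * ‖w‖ ^ 2) :=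
          mul_le_mul (hm v) (hm w) (Finset.sum_nonneg fun x _ => by positivity) (hnn v)
      _ = _ := by ring
  · by_cases hv : ‖v‖ = 0
    · simp [hv]
    · have := hnn v
      have h2 : 0 ≤ c * Fintype.card G := nonneg_of_mul_nonneg_left this (by positivity)
      positivity

lemma norm_sum_sq_le_of_twisted {F : Type*} [Field F] [Fintype F] {ρ : G →* End ℂ V}
    (hρ : IsUnitary ρ) {k : F → G} {z : Multiplicative F →* G}
    (hk : ∀ s r, k (s + r) = k s * (k r * z (Multiplicative.ofAdd (s * r))))
    (hz : ∀ r t, k r * z t = z t * k r) (v : V) :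
    ‖∑ t, ρ (k t) v‖ ^ 2 ≤ Fintype.card F * ‖v‖ ^ 2 +
      Fintype.card F ^ 2 * ‖avg (ρ.comp z) v‖ ^ 2 := by
  classical
  set p := avg (ρ.comp z) v with hp
  have hq : (Fintype.card F : ℂ) ≠ 0 := Nat.cast_ne_zero.2 Fintype.card_ne_zero
  have hsum : ∀ r : F, r ≠ 0 → ∑ s, ρ (z (Multiplicative.ofAdd (s * r))) v =
      (Fintype.card F : ℂ) • p := fun r hr => by
    rw [hp, avg_apply, Fintype.card_multiplicative, smul_smul, mul_inv_cancel₀ hq, one_smul,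
      ← Equiv.sum_comp Multiplicative.ofAdd]
    exact Equiv.sum_comp (Equiv.mulRight₀ r hr)
      (fun s => ρ (z (Multiplicative.ofAdd s)) v)
  have hmem : ∀ r, ρ (k r) p ∈ fixed (ρ.comp z) := fun r => by
    rw [mem_fixed]
    intro t
    have := (mem_fixed.1 (avg_mem (ρ.comp z) v)) t
    rw [← hp] at this
    change ρ (z t) (ρ (k r) p) = ρ (k r) p
    rw [← rep_mul_apply, ← hz, rep_mul_apply]
    congr 1
  have hk0 : k 0 = 1 := by
    have := hk 0 0
    simp only [add_zero, mul_zero, ofAdd_zero, map_one, mul_one] at this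
    exact (mul_eq_left).1 this.symm
  have h1 : ((‖∑ t, ρ (k t) v‖ ^ 2 : ℝ) : ℂ) =
      ∑ r, ∑ s, ⟪ρ (k r) (ρ (z (Multiplicative.ofAdd (s * r))) v), v⟫_ℂ := by
    have e : ∀ x : V, ((‖x‖ ^ 2 : ℝ) : ℂ) = ⟪x, x⟫_ℂ := fun x => by
      rw [inner_self_eq_norm_sq_to_K]; push_cast; rfl
    rw [e, sum_inner]
    simp_rw [inner_sum]
    rw [Finset.sum_comm, Finset.sum_comm (s := Finset.univ) (t := Finset.univ)
      (f := fun r s => ⟪ρ (k r) (ρ (z (Multiplicative.ofAdd (s * r))) v), v⟫_ℂ)]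
    refine Finset.sum_congr rfl fun s _ => ?_
    rw [← Equiv.sum_comp (Equiv.addLeft s)]
    refine Finset.sum_congr rfl fun r _ => ?_
    rw [Equiv.coe_addLeft, hk, rep_mul_apply, hρ, rep_mul_apply]
  have h2 : ∀ r, r ≠ 0 → ‖∑ s, ⟪ρ (k r) (ρ (z (Multiplicative.ofAdd (s * r))) v), v⟫_ℂ‖ ≤
      Fintype.card F * ‖p‖ ^ 2 := fun r hr => by
    rw [← sum_inner, ← map_sum, hsum r hr, map_smul, inner_smul_left, norm_mul,
      norm_inner_symm, ← inner_avg_of_mem (hρ.comp z) (hmem r)]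
    simp only [map_natCast, Complex.norm_natCast]
    gcongr
    refine (norm_inner_le_norm _ _).trans ?_
    rw [hρ.norm, ← hp, sq]
  have h3 : ‖∑ s : F, ⟪ρ (k 0) (ρ (z (Multiplicative.ofAdd (s * 0))) v), v⟫_ℂ‖ ≤
      Fintype.card F * ‖v‖ ^ 2 := by
    simp only [hk0, mul_zero, ofAdd_zero, map_one, End.one_apply, Finset.sum_const,
      Finset.card_univ, nsmul_eq_mul, norm_mul, Complex.norm_natCast]
    gcongr
    exact (norm_inner_le_norm _ _).trans (by rw [sq])
  have h4 : ‖∑ t, ρ (k t) v‖ ^ 2 = ‖((‖∑ t, ρ (k t) v‖ ^ 2 : ℝ) : ℂ)‖ := by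
    rw [Complex.norm_real, Real.norm_of_nonneg (by positivity)]
  rw [h4, h1, ← Finset.add_sum_erase _ _ (Finset.mem_univ (0 : F))]
  refine (norm_add_le _ _).trans (add_le_add h3 ((norm_sum_le _ _).trans ?_))
  refine (Finset.sum_le_sum fun r hr => h2 r (Finset.ne_of_mem_erase hr)).trans ?_
  rw [Finset.sum_const, nsmul_eq_mul, sq (Fintype.card F : ℝ), mul_assoc]
  gcongr
  exact Finset.card_le_univ _

end ClassSum

end SLWord

namespace SLWord

open scoped InnerProductSpace MatrixGroups
open Module Matrix

section HighRank

variable {ι F : Type*} [Fintype ι] [DecidableEq ι] [Field F]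

lemma sl_ext {A B : SpecialLinearGroup ι F} (h : (A : Matrix ι ι F) = (B : Matrix ι ι F)) :
    A = B := Subtype.ext h

lemma vecMulVec_smul_right (c : F) (a b : ι → F) :
    vecMulVec a (c • b) = c • vecMulVec a b := by
  ext i j; simp [vecMulVec_apply, mul_left_comm]

lemma exists_dotProduct_eq_zero (h : 2 < Fintype.card ι) (a b : ι → F) :
    ∃ φ : ι → F, φ ≠ 0 ∧ φ ⬝ᵥ a = 0 ∧ φ ⬝ᵥ b = 0 := by
  have h1 := LinearMap.ker_ne_bot_of_finrank_lt (f := (Matrix.of ![a, b]).mulVecLin)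
    (by simpa using h)
  obtain ⟨φ, hφ, h0⟩ := (Submodule.ne_bot_iff _).1 h1
  refine ⟨φ, h0, ?_, ?_⟩
  · simpa [dotProduct_comm] using congrFun hφ 0
  · simpa [dotProduct_comm] using congrFun hφ 1

lemma exists_moved_vector (h : 2 < Fintype.card ι) {g : Matrix ι ι F}
    (hg : ∀ c : F, g ≠ c • 1) {φ : ι → F} {c : F} (hφ : φ ≠ 0) (hc : φ ᵥ* g = c • φ) :
    ∃ φ v : ι → F, φ ≠ 0 ∧ φ ᵥ* g = c • φ ∧ φ ⬝ᵥ v = 0 ∧ g *ᵥ v ≠ c • v := by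
  by_contra! H
  obtain ⟨i, hi⟩ := Function.ne_iff.1 hφ
  set z : ι → F := Pi.single i (φ i)⁻¹ with hz
  have hφz : φ ⬝ᵥ z = 1 := by rw [hz, dotProduct_single]; exact mul_inv_cancel₀ hi
  set x := g *ᵥ z - c • z with hx
  have hgu : ∀ u, g *ᵥ u = c • u + (φ ⬝ᵥ u) • x := fun u => by
    have h1 := H φ (u - (φ ⬝ᵥ u) • z) hφ hc
      (by rw [dotProduct_sub, dotProduct_smul, hφz, smul_eq_mul, mul_one, sub_self])
    rw [mulVec_sub, mulVec_smul, sub_eq_iff_eq_add] at h1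
    rw [h1, hx]; module
  have hgx : g = c • (1 : Matrix ι ι F) + vecMulVec x φ := by
    refine ext_of_mulVec_single fun k => ?_
    rw [hgu, add_mulVec, smul_mulVec, one_mulVec, vecMulVec_mulVec]
    simp
  obtain ⟨χ, hχ, hχx, hχz⟩ := exists_dotProduct_eq_zero h x z
  have hχg : χ ᵥ* g = c • χ := by
    rw [hgx, vecMul_add, vecMul_smul, vecMul_one, vecMul_vecMulVec, hχx, zero_smul, add_zero]
  have h2 := H χ z hχ hχg hχz
  have hx0 : x = 0 := by rw [hx, h2, sub_self]
  exact hg c (by rw [hgx, hx0, zero_vecMulVec, add_zero])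

variable {V : Type*} [NormedAddCommGroup V] [InnerProductSpace ℂ V] [FiniteDimensional ℂ V]
variable {ρ : SpecialLinearGroup ι F →* End ℂ V}
variable [Fintype F] [DecidableEq F]

theorem norm_cls_le_of_eigenvector (h : 2 < Fintype.card ι) (hρ : IsUnitary ρ)
    (h0 : fixed ρ = ⊥) {g : SpecialLinearGroup ι F} (hg : ∀ c : F, (g : Matrix ι ι F) ≠ c • 1)
    {φ : ι → F} {c : F} (hφ : φ ≠ 0) (hc : φ ᵥ* (g : Matrix ι ι F) = c • φ) (v w : V) :
    ‖cls ρ g v w‖ ≤ (4 * Fintype.card ι / Fintype.card F) *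
      Fintype.card (SpecialLinearGroup ι F) * (‖v‖ * ‖w‖) := by
  have : Nontrivial ι := Fintype.one_lt_card_iff_nontrivial.1 (by omega)
  obtain ⟨φ, a, hφ, hc, hφa, hga⟩ := exists_moved_vector h hg hφ hc
  have hc0 : c ≠ 0 := by
    rintro rfl
    rw [zero_smul] at hc
    refine hφ ?_
    have hgg : (g : Matrix ι ι F) * (g⁻¹ : SpecialLinearGroup ι F).1 = 1 :=
      congrArg Subtype.val (mul_inv_cancel g)
    rw [← vecMul_one φ, ← hgg, ← vecMul_vecMul, hc, zero_vecMul]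
  set y := a - c⁻¹ • ((g : Matrix ι ι F) *ᵥ a) with hy
  have hφga : φ ⬝ᵥ ((g : Matrix ι ι F) *ᵥ a) = 0 := by
    rw [dotProduct_mulVec, hc, smul_dotProduct, hφa, smul_zero]
  have hφy : φ ⬝ᵥ y = 0 := by
    rw [hy, dotProduct_sub, dotProduct_smul, hφa, hφga, smul_zero, sub_zero]
  have hy0 : y ≠ 0 := fun h => by
    rw [hy, sub_eq_zero] at h
    refine hga ?_
    conv_rhs => rw [h, smul_smul, mul_inv_cancel₀ hc0, one_smul]
  refine norm_cls_le_of_mass hρ (u := vecRoot y φ hφy) (h := vecRoot a φ hφa) (fun t => ?_)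
    (mass_vecRoot_le hρ h0 hy0 hφ hφy) v w
  refine sl_ext ?_
  change (1 + t.toAdd • vecMulVec a φ) * (g : Matrix ι ι F) =
    (1 + t.toAdd • vecMulVec y φ) * g * (1 + t.toAdd • vecMulVec a φ)
  have e1 : vecMulVec a φ * (g : Matrix ι ι F) = c • vecMulVec a φ := by
    rw [vecMulVec_mul, hc, vecMulVec_smul_right]
  have e2 : vecMulVec y φ * (g : Matrix ι ι F) = c • vecMulVec y φ := by
    rw [vecMulVec_mul, hc, vecMulVec_smul_right]
  have e3 : vecMulVec y φ * vecMulVec a φ = 0 := by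
    rw [vecMulVec_mul_vecMulVec, hφa, zero_smul, vecMulVec_zero]
  have e4 : vecMulVec y φ = vecMulVec a φ - c⁻¹ • ((g : Matrix ι ι F) * vecMulVec a φ) := by
    rw [hy, sub_vecMulVec, smul_vecMulVec, mul_vecMulVec]
  rw [add_mul, one_mul, smul_mul, e1, add_mul 1, one_mul, smul_mul, e2, mul_add, mul_one, add_mul,
    smul_mul, smul_mul, Matrix.mul_smul, Matrix.mul_smul, e3, e4, smul_sub, smul_smul c c⁻¹,
    mul_inv_cancel₀ hc0, one_smul]
  simp only [smul_zero, add_zero, smul_sub]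
  abel

lemma mass_eq_sum_cls {G H V : Type*} [NormedAddCommGroup V] [InnerProductSpace ℂ V] [Group G]
    [Fintype G] [Group H] [Fintype H]
    {ρ : G →* End ℂ V} (hρ : IsUnitary ρ) (u : H →* G) (v : V) :
    (Fintype.card H : ℂ) * mass ρ u v = ∑ t, cls ρ (u t) v v := by
  simp_rw [cls_eq_sum hρ]
  rw [Finset.sum_comm, mass]
  push_cast
  rw [Finset.mul_sum]
  refine Finset.sum_congr rfl fun x _ => ?_
  rw [← inner_avg_self (hρ.comp u), avg_apply, inner_smul_left, map_inv₀, map_natCast,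
    mul_inv_cancel_left₀ (card_ne_zero_complex H), sum_inner]
  rfl

lemma card_mul_mass_le {G H V : Type*} [NormedAddCommGroup V] [InnerProductSpace ℂ V] [Group G]
    [Fintype G] [Group H] [Fintype H]
    {ρ : G →* End ℂ V} (hρ : IsUnitary ρ) (u : H →* G) (v : V) {c : ℝ}
    (hc : ∀ t, t ≠ 1 → ‖cls ρ (u t) v v‖ ≤ c * Fintype.card G * (‖v‖ * ‖v‖)) (hc0 : 0 ≤ c) :
    Fintype.card H * mass ρ u v ≤ (1 + Fintype.card H * c) * Fintype.card G * ‖v‖ ^ 2 := by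
  classical
  have h1 := congrArg norm (mass_eq_sum_cls hρ u v)
  have hm : 0 ≤ mass ρ u v := Finset.sum_nonneg fun x _ => by positivity
  rw [norm_mul, Complex.norm_natCast, Complex.norm_real, Real.norm_of_nonneg hm] at h1
  rw [h1, ← Finset.add_sum_erase _ _ (Finset.mem_univ (1 : H)), map_one]
  refine (norm_add_le _ _).trans ?_
  have h2 := norm_cls_le hρ 1 v v
  have h3 : ‖∑ t ∈ Finset.univ.erase (1 : H), cls ρ (u t) v v‖ ≤
      Fintype.card H * (c * Fintype.card G * (‖v‖ * ‖v‖)) := by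
    refine (norm_sum_le _ _).trans ?_
    refine (Finset.sum_le_sum fun t ht => hc t (Finset.ne_of_mem_erase ht)).trans ?_
    rw [Finset.sum_const, nsmul_eq_mul]
    gcongr
    exact Finset.card_le_univ _
  nlinarith

theorem norm_cls_le_of_card_gt_two (h : 2 < Fintype.card ι) (hρ : IsUnitary ρ)
    (h0 : fixed ρ = ⊥) {g : SpecialLinearGroup ι F} (hg : ∀ c : F, (g : Matrix ι ι F) ≠ c • 1)
    (v w : V) :
    ‖cls ρ g v w‖ ≤ ((4 * Fintype.card ι + 1) / √(Fintype.card F)) *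
      Fintype.card (SpecialLinearGroup ι F) * (‖v‖ * ‖w‖) := by
  have hnt : Nontrivial ι := Fintype.one_lt_card_iff_nontrivial.1 (by omega)
  have hq1 : (1 : ℝ) ≤ Fintype.card F := by exact_mod_cast Fintype.card_pos
  have hqs : 1 ≤ √(Fintype.card F : ℝ) := Real.one_le_sqrt.2 hq1
  have hq2 : √(Fintype.card F : ℝ) * √(Fintype.card F : ℝ) = Fintype.card F :=
    Real.mul_self_sqrt (by positivity)
  obtain ⟨N, hN⟩ : ∃ N : ℝ, N = Fintype.card ι := ⟨_, rfl⟩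
  obtain ⟨q, hq⟩ : ∃ q : ℝ, q = Fintype.card F := ⟨_, rfl⟩
  obtain ⟨γ, hγ⟩ : ∃ γ : ℝ, γ = Fintype.card (SpecialLinearGroup ι F) := ⟨_, rfl⟩
  have hN0 : 0 ≤ N := hN ▸ Nat.cast_nonneg _
  have hγ0 : 0 ≤ γ := hγ ▸ Nat.cast_nonneg _
  by_cases hE : ∃ (φ : ι → F) (c : F), φ ≠ 0 ∧ φ ᵥ* (g : Matrix ι ι F) = c • φ
  · obtain ⟨φ, c, hφ, hc⟩ := hE
    refine (norm_cls_le_of_eigenvector h hρ h0 hg hφ hc v w).trans ?_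
    rw [← hN, ← hγ]
    gcongr
    · linarith
    · exact Real.sqrt_le_iff.2 ⟨by positivity, by nlinarith⟩
  push Not at hE
  obtain ⟨a, ha⟩ : ∃ a : ι → F, a ≠ 0 := exists_ne 0
  obtain ⟨φ, hφ, hφa, hφb⟩ := exists_dotProduct_eq_zero h a ((g : Matrix ι ι F) *ᵥ a)
  obtain ⟨b, hb⟩ : ∃ b, b = (g : Matrix ι ι F) *ᵥ a := ⟨_, rfl⟩
  rw [← hb] at hφb
  obtain ⟨ψ, hψ⟩ : ∃ ψ, ψ = φ ᵥ* (g⁻¹ : SpecialLinearGroup ι F).1 := ⟨_, rfl⟩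
  have hgg : (g⁻¹ : SpecialLinearGroup ι F).1 * g.1 = 1 :=
    congrArg Subtype.val (inv_mul_cancel g)
  have hψg : ψ ᵥ* (g : Matrix ι ι F) = φ := by
    rw [hψ, vecMul_vecMul, hgg, vecMul_one]
  have hψb : ψ ⬝ᵥ b = 0 := by rw [hb, dotProduct_mulVec, hψg, hφa]
  obtain ⟨N', hN'⟩ : ∃ N', N' = vecMulVec a φ - vecMulVec b ψ := ⟨_, rfl⟩
  obtain ⟨κ, hκ⟩ : ∃ κ, κ = ψ ⬝ᵥ a := ⟨_, rfl⟩
  have hNN : N' * N' = (-κ) • vecMulVec b φ := by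
    rw [hN', sub_mul, mul_sub, mul_sub]
    simp only [vecMulVec_mul_vecMulVec, hφa, hφb, hψb, ← hκ, zero_smul, vecMulVec_zero]
    rw [vecMulVec_smul_right, neg_smul]; abel
  have hNne : N' ≠ 0 := by
    intro hN0
    rw [hN', sub_eq_zero] at hN0
    obtain ⟨i, hi⟩ := Function.ne_iff.1 ha
    have h1 : φ = (a i)⁻¹ • b i • ψ := by
      ext j
      have := congrFun (congrFun hN0 i) j
      simp only [vecMulVec_apply] at this
      simp only [Pi.smul_apply, smul_eq_mul, ← this]
      exact (inv_mul_cancel_left₀ hi _).symm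
    refine hE ψ ((a i)⁻¹ * b i) ?_ ?_
    · rintro rfl; simp [h1] at hφ
    · rw [hψg, mul_smul, ← h1]
  have hNb : N' * vecMulVec b φ = 0 := by
    rw [hN', sub_mul]
    simp only [vecMulVec_mul_vecMulVec, hφb, hψb, zero_smul, vecMulVec_zero, sub_zero]
  have hbN : vecMulVec b φ * N' = 0 := by
    rw [hN', mul_sub]
    simp only [vecMulVec_mul_vecMulVec, hφb, hφa, zero_smul, vecMulVec_zero, sub_zero]
  have hb0 : b ≠ 0 := fun hb0 => ha (by
    have : (g⁻¹ : SpecialLinearGroup ι F).1 *ᵥ b = a := by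
      rw [hb, mulVec_mulVec, hgg, one_mulVec]
    rw [← this, hb0, mulVec_zero])
  obtain ⟨k, hkdef⟩ : ∃ k : F → SpecialLinearGroup ι F, ∀ t, k t =
      vecRoot a φ hφa (Multiplicative.ofAdd t) * g *
        (vecRoot a φ hφa (Multiplicative.ofAdd t))⁻¹ * g⁻¹ := ⟨_, fun t => rfl⟩
  have hk1 : ∀ t, vecRoot a φ hφa (Multiplicative.ofAdd t) * g =
      k t * g * vecRoot a φ hφa (Multiplicative.ofAdd t) := fun t => by
    rw [hkdef]; group
  have hk2 : ∀ t, (k t : Matrix ι ι F) = 1 + t • N' := fun t => by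
    have h2 : (1 + t • vecMulVec a φ) * (g : Matrix ι ι F) =
        (1 + t • N') * g * (1 + t • vecMulVec a φ) := by
      have e1 : N' * (g : Matrix ι ι F) = vecMulVec a φ * g - vecMulVec b φ := by
        rw [hN', sub_mul, vecMulVec_mul b, hψg]
      have e2 : (g : Matrix ι ι F) * vecMulVec a φ = vecMulVec b φ := by
        rw [mul_vecMulVec, ← hb]
      rw [add_mul, one_mul, smul_mul, mul_add, mul_one, add_mul 1, one_mul, smul_mul,
        Matrix.mul_smul, add_mul, smul_mul, mul_assoc, e2, hNb, e1]
      simp only [smul_zero, add_zero, smul_sub]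
      abel
    have h3 := congrArg Subtype.val (hk1 t)
    change (1 + t • vecMulVec a φ) * (g : Matrix ι ι F) =
      (k t).1 * g.1 * (1 + t • vecMulVec a φ) at h3
    rw [h2] at h3
    have hu : IsUnit ((g : Matrix ι ι F) * (1 + t • vecMulVec a φ)) := by
      rw [isUnit_iff_isUnit_det]
      have : ((g : Matrix ι ι F) * (1 + t • vecMulVec a φ)).det = 1 :=
        (g * vecRoot a φ hφa (Multiplicative.ofAdd t) : SpecialLinearGroup ι F).2
      rw [this]; exact isUnit_one
    rw [mul_assoc, mul_assoc] at h3
    exact (hu.mul_left_injective h3).symm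
  have key : ∑ x, ‖∑ t, ρ (k t) (ρ x v)‖ ^ 2 ≤ γ * (√q * (4 * N + 1) * ‖v‖) ^ 2 := by
    have hfin : q * (1 + 4 * N) * γ * ‖v‖ ^ 2 ≤ γ * (√q * (4 * N + 1) * ‖v‖) ^ 2 := by
      have : γ * (√q * (4 * N + 1) * ‖v‖) ^ 2 = γ * ((√q * √q) * (4 * N + 1) ^ 2 * ‖v‖ ^ 2) := by
        ring
      rw [this, hq, hq2, ← hq]
      have : q * (1 + 4 * N) * γ * ‖v‖ ^ 2 = γ * (q * (1 + 4 * N) * ‖v‖ ^ 2) := by ring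
      rw [this]
      gcongr
      · rw [hq]; positivity
      · nlinarith
    refine le_trans ?_ hfin
    by_cases hκ0 : κ = 0
    · have hNN0 : N' * N' = 0 := by rw [hNN, hκ0, neg_zero, zero_smul]
      have hkadd : ∀ s t, k (s + t) = k s * k t := fun s t => by
        refine sl_ext ?_
        change (k (s + t)).1 = (k s).1 * (k t).1
        rw [hk2, hk2, hk2]
        simp only [add_mul, mul_add, one_mul, mul_one, smul_mul, Matrix.mul_smul, hNN0, smul_zero,
          add_zero, add_smul]
        abel
      let u : Multiplicative F →* SpecialLinearGroup ι F := MonoidHom.mk' (fun t => k t.toAdd)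
        (fun s t => hkadd _ _)
      obtain ⟨χ, hχ, hχa, hχb⟩ := exists_dotProduct_eq_zero h a b
      have hm := card_mul_mass_le hρ u v (c := 4 * N / q) (fun t ht => by
        rw [hN, hq]
        refine norm_cls_le_of_eigenvector h hρ h0 (c := 1) (fun c hc => ?_) hχ ?_ v v
        · have hc' : 1 + t.toAdd • N' = c • (1 : Matrix ι ι F) := by rw [← hk2]; exact hc
          have ht0 : t.toAdd ≠ 0 := ht
          have h4 : t.toAdd • N' = (c - 1) • (1 : Matrix ι ι F) := by
            rw [sub_smul, one_smul, ← hc']; abel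
          have h5 : ((c - 1) * (c - 1)) • (1 : Matrix ι ι F) = 0 := by
            have : (t.toAdd • N') * (t.toAdd • N') = 0 := by
              rw [smul_mul, Matrix.mul_smul, hNN0, smul_zero, smul_zero]
            rw [h4, smul_mul, one_mul, smul_smul] at this
            exact this
          have h6 : c - 1 = 0 := by
            rcases smul_eq_zero.1 h5 with h | h
            · exact mul_self_eq_zero.1 h
            · exact absurd h one_ne_zero
          rw [h6, zero_smul] at h4
          exact (smul_ne_zero ht0 hNne) h4
        · change χ ᵥ* (k t.toAdd).1 = _
          rw [hk2, hN', vecMul_add, vecMul_one, vecMul_smul, vecMul_sub, vecMul_vecMulVec,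
            vecMul_vecMulVec, hχa, hχb]
          simp) (by rw [hq]; positivity)
      have hs : ∑ x, ‖∑ t, ρ (k t) (ρ x v)‖ ^ 2 = q ^ 2 * mass ρ u v := by
        unfold mass
        rw [Finset.mul_sum]
        refine Finset.sum_congr rfl fun x _ => ?_
        rw [avg_apply, norm_smul, mul_pow, Fintype.card_multiplicative, norm_inv,
          Complex.norm_natCast, ← hq, inv_pow, mul_inv_cancel_left₀
            (pow_ne_zero 2 (by rw [hq]; positivity)), ← Equiv.sum_comp Multiplicative.ofAdd]
        rfl
      rw [hs, sq, mul_assoc]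
      rw [Fintype.card_multiplicative, ← hq, ← hγ, mul_div_cancel₀ _ (by rw [hq]; positivity)] at hm
      have hq0 : 0 ≤ q := by rw [hq]; positivity
      calc q * (q * mass ρ u v) ≤ q * ((1 + 4 * N) * γ * ‖v‖ ^ 2) := by gcongr
        _ = _ := by ring
    · have hφκ : (φ) ⬝ᵥ (κ • b) = 0 := by rw [dotProduct_smul, hφb, smul_zero]
      have hNN' : N' * N' = - vecMulVec (κ • b) φ := by rw [hNN, smul_vecMulVec, neg_smul]
      have hs : ∀ x, ‖∑ t, ρ (k t) (ρ x v)‖ ^ 2 ≤ q * ‖ρ x v‖ ^ 2 +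
          q ^ 2 * ‖avg (ρ.comp (vecRoot (κ • b) φ hφκ)) (ρ x v)‖ ^ 2 := fun x => by
        rw [hq]
        refine norm_sum_sq_le_of_twisted hρ (fun s r => ?_) (fun r t => ?_) _
        · refine sl_ext ?_
          change (k (s + r)).1 = (k s).1 * ((k r).1 * (1 + (s * r) • vecMulVec (κ • b) φ))
          rw [hk2, hk2, hk2]
          have e : N' * vecMulVec (κ • b) φ = 0 := by
            rw [smul_vecMulVec, Matrix.mul_smul, hNb, smul_zero]
          have e1 : (1 + r • N') * (1 + (s * r) • vecMulVec (κ • b) φ) =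
              1 + r • N' + (s * r) • vecMulVec (κ • b) φ := by
            simp only [mul_add, add_mul, mul_one, one_mul, smul_mul, Matrix.mul_smul, e, smul_zero,
              add_zero]
          rw [e1]
          simp only [add_mul, one_mul, smul_mul, mul_add, mul_one, Matrix.mul_smul, e, hNN',
            smul_zero, add_zero, smul_neg, smul_smul, add_smul, mul_comm r s]
          abel
        · refine sl_ext ?_
          have e : N' * vecMulVec (κ • b) φ = 0 := by
            rw [smul_vecMulVec, Matrix.mul_smul, hNb, smul_zero]
          have e' : vecMulVec (κ • b) φ * N' = 0 := by
            rw [smul_vecMulVec, smul_mul, hbN, smul_zero]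
          change (k r).1 * (1 + t.toAdd • vecMulVec (κ • b) φ) =
            (1 + t.toAdd • vecMulVec (κ • b) φ) * (k r).1
          rw [hk2]
          simp only [mul_add, add_mul, mul_one, one_mul, smul_mul, Matrix.mul_smul, e, e',
            smul_zero, add_zero]
          abel
      refine (Finset.sum_le_sum fun x _ => hs x).trans ?_
      have hm := mass_vecRoot_le hρ h0 (smul_ne_zero hκ0 hb0) hφ hφκ v
      rw [Finset.sum_add_distrib, ← Finset.mul_sum, ← Finset.mul_sum]
      simp_rw [hρ.norm]
      rw [Finset.sum_const, Finset.card_univ, nsmul_eq_mul, ← hγ]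
      change q * (γ * ‖v‖ ^ 2) + q ^ 2 * mass ρ _ v ≤ _
      rw [← hq, ← hγ, ← hN] at hm
      have hq0 : q ≠ 0 := by rw [hq]; positivity
      calc _ ≤ q * (γ * ‖v‖ ^ 2) + q ^ 2 * (4 * N / q * γ * ‖v‖ ^ 2) := by gcongr
        _ = _ := by field_simp
  have hq0 : 0 < q := by rw [hq]; positivity
  have hsq0 : 0 < √q := Real.sqrt_pos.2 hq0
  have fin := norm_cls_le_of_sum_sq hρ hk1 v w (B := √q * (4 * N + 1) * ‖v‖) (by positivity)
    (by rw [← hγ]; exact key)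
  rw [← hq, ← hγ] at fin
  rw [← hq, ← hγ, ← hN]
  rw [← hq] at hq2
  have e : ‖cls ρ g v w‖ = (√q * √q)⁻¹ * (q * ‖cls ρ g v w‖) := by
    rw [hq2, inv_mul_cancel_left₀ hq0.ne']
  rw [e]
  calc _ ≤ (√q * √q)⁻¹ * (γ * (√q * (4 * N + 1) * ‖v‖) * ‖w‖) := by gcongr
    _ = _ := by field_simp

end HighRank

end SLWord

namespace SLWord

open scoped InnerProductSpace MatrixGroups
open Module Matrix

section UnipotentCharacters

variable {F : Type*} [Field F]
variable {V : Type*} [NormedAddCommGroup V] [InnerProductSpace ℂ V]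

/-- The vectors on which the upper unipotent group acts through the character
`t ↦ ψ (b t)`. -/
def IsWeight (ψ : AddChar F ℂ) (ρ : SL(2, F) →* End ℂ V) (b : F) (v : V) : Prop :=
  ∀ t, ρ (up t) v = ψ (b * t) • v

lemma IsWeight.tor {ψ : AddChar F ℂ} {ρ : SL(2, F) →* End ℂ V} {b : F} {v : V}
    (h : IsWeight ψ ρ b v) (s : Fˣ) : IsWeight ψ ρ (b * (s : F)⁻¹ ^ 2) (ρ (tor s) v) := fun t => by
  rw [← rep_mul_apply, up_mul_tor, rep_mul_apply, h, map_smul]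
  congr 2
  ring

lemma IsWeight.inner_eq_zero [Fintype F] {ψ : AddChar F ℂ} (hψ : ψ ≠ 1)
    {ρ : SL(2, F) →* End ℂ V} (hρ : IsUnitary ρ) {b c : F} {v w : V} (hv : IsWeight ψ ρ b v)
    (hw : IsWeight ψ ρ c w) (hbc : b ≠ c) : ⟪v, w⟫_ℂ = 0 := by
  obtain ⟨t, ht⟩ := AddChar.ne_one_iff.1 hψ
  have h := hρ (up (t / (c - b))) v w
  rw [hv, hw, inner_smul_left, inner_smul_right, ← AddChar.map_neg_eq_conj, ← mul_assoc,
    ← AddChar.map_add_eq_mul] at h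
  have e : -(b * (t / (c - b))) + c * (t / (c - b)) = t := by
    have : c - b ≠ 0 := sub_ne_zero.2 hbc.symm
    field_simp; ring
  rw [e] at h
  by_contra h0
  exact ht (mul_right_cancel₀ h0 (h.trans (one_mul _).symm))

variable [Fintype F]

/-- The projection to the vectors of a given weight. -/
noncomputable def weightProj (ψ : AddChar F ℂ) (ρ : SL(2, F) →* End ℂ V) (b : F) : End ℂ V :=
  (Fintype.card F : ℂ)⁻¹ • ∑ x, ψ (-(b * x)) • ρ (up x)

lemma weightProj_apply (ψ : AddChar F ℂ) (ρ : SL(2, F) →* End ℂ V) (b : F) (v : V) :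
    weightProj ψ ρ b v = (Fintype.card F : ℂ)⁻¹ • ∑ x, ψ (-(b * x)) • ρ (up x) v := by
  simp [weightProj, LinearMap.sum_apply]

lemma isWeight_weightProj (ψ : AddChar F ℂ) (ρ : SL(2, F) →* End ℂ V) (b : F) (v : V) :
    IsWeight ψ ρ b (weightProj ψ ρ b v) := fun t => by
  rw [weightProj_apply, map_smul, smul_comm (ψ (b * t))]
  congr 1
  rw [map_sum, Finset.smul_sum,
    ← Equiv.sum_comp (Equiv.addLeft t) fun x => ψ (b * t) • ψ (-(b * x)) • ρ (up x) v]
  refine Finset.sum_congr rfl fun x _ => ?_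
  rw [map_smul, ← rep_mul_apply, up_add, smul_smul, ← AddChar.map_add_eq_mul,
    Equiv.coe_addLeft]
  congr 2
  ring

lemma sum_weightProj [DecidableEq F] {ψ : AddChar F ℂ} (hψ : ψ ≠ 1) (ρ : SL(2, F) →* End ℂ V)
    (v : V) : ∑ b, weightProj ψ ρ b v = v := by
  have hq : (Fintype.card F : ℂ) ≠ 0 := Nat.cast_ne_zero.2 Fintype.card_ne_zero
  simp_rw [weightProj_apply]
  rw [← Finset.smul_sum, Finset.sum_comm]
  simp_rw [← Finset.sum_smul, ← mul_neg]
  simp_rw [AddChar.sum_mulShift _ (AddChar.IsPrimitive.of_ne_one hψ)]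
  simp only [neg_eq_zero, Nat.cast_ite, Nat.cast_zero, ite_smul, zero_smul,
    Finset.sum_ite_eq', Finset.mem_univ, if_true]
  rw [smul_smul, inv_mul_cancel₀ hq, one_smul]
  have : up (0 : F) = 1 := SpecialLinearGroup.transvection_coeff_zero _
  rw [this, map_one]; rfl

lemma weightProj_zero (ψ : AddChar F ℂ) (ρ : SL(2, F) →* End ℂ V) (v : V) :
    weightProj ψ ρ 0 v = avg (ρ.comp upHom) v := by
  rw [weightProj_apply, avg_apply, ← Equiv.sum_comp Multiplicative.ofAdd]
  simp only [zero_mul, neg_zero, AddChar.map_zero_eq_one, one_smul, Fintype.card_multiplicative]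
  rfl

lemma exists_weightProj_ne_zero [DecidableEq F] {ψ : AddChar F ℂ} (hψ : ψ ≠ 1)
    {ρ : SL(2, F) →* End ℂ V} {v : V} (hv : v ≠ 0) (h0 : avg (ρ.comp upHom) v = 0) :
    ∃ b, b ≠ 0 ∧ weightProj ψ ρ b v ≠ 0 := by
  by_contra! H
  refine hv ?_
  rw [← sum_weightProj hψ ρ v]
  refine Finset.sum_eq_zero fun b _ => ?_
  by_cases hb : b = 0
  · rw [hb, weightProj_zero, h0]
  · exact H b hb

lemma weightProj_commute {σ ρ : SL(2, F) →* End ℂ V} (hc : ∀ g h v, σ g (ρ h v) = ρ h (σ g v))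
    (ψ : AddChar F ℂ) (b : F) (g : SL(2, F)) (v : V) :
    σ g (weightProj ψ ρ b v) = weightProj ψ ρ b (σ g v) := by
  rw [weightProj_apply, weightProj_apply, map_smul, map_sum]
  simp_rw [map_smul, hc]

lemma avg_commute {H : Type*} [Group H] [Fintype H] {σ : H →* End ℂ V}
    {P : End ℂ V} (hc : ∀ g v, σ g (P v) = P (σ g v)) (v : V) :
    avg σ (P v) = P (avg σ v) := by
  rw [avg_apply, avg_apply, map_smul, map_sum]
  simp_rw [hc]

theorem sq_le_finrank_of_commute [DecidableEq F] [FiniteDimensional ℂ V] [Nontrivial V]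
    {σ ρ : SL(2, F) →* End ℂ V}
    (hσ : IsUnitary σ) (hρ : IsUnitary ρ) (hc : ∀ g h v, σ g (ρ h v) = ρ h (σ g v))
    (hσ0 : fixed σ = ⊥) (hρ0 : fixed ρ = ⊥) (hq : 16 < Fintype.card F) :
    (Fintype.card F - 1) ^ 2 ≤ 4 * finrank ℂ V := by
  obtain ⟨ψ, hψ1⟩ : ∃ ψ : AddChar F ℂ, ψ ≠ 1 := by
    obtain ⟨ψ, hψ⟩ := (AddChar.exists_apply_ne_zero (a := (1 : F))).2 one_ne_zero
    exact ⟨ψ, AddChar.ne_one_iff.2 ⟨1, hψ⟩⟩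
  set P := avg (σ.comp upHom) with hP
  set Q := avg (ρ.comp upHom) with hQ
  have hPQ : ∀ v, P (Q v) = Q (P v) := fun v => by
    refine avg_commute (fun g v => ?_) v
    rw [hQ, avg_apply, avg_apply, map_smul, map_sum]
    congr 1
    exact Finset.sum_congr rfl fun x _ => hc _ _ _
  have hPP : ∀ v, P (P v) = P v := fun v => avg_of_mem (avg_mem _ v)
  have hQQ : ∀ v, Q (Q v) = Q v := fun v => avg_of_mem (avg_mem _ v)
  obtain ⟨w, hw⟩ : ∃ w, w - P w - Q w + P (Q w) ≠ 0 := by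
    by_contra! H
    have hsup : fixed (σ.comp upHom) ⊔ fixed (ρ.comp upHom) = ⊤ := by
      rw [eq_top_iff]
      intro w _
      have : w = P (w - Q w) + Q w := by
        rw [map_sub]
        have := H w
        rw [← sub_eq_zero, ← this]; abel
      rw [this]
      exact Submodule.add_mem_sup (avg_mem _ _) (avg_mem _ _)
    have h1 := Submodule.finrank_add_le_finrank_add_finrank (fixed (σ.comp upHom))
      (fixed (ρ.comp upHom))
    rw [hsup, finrank_top] at h1
    have h2 := card_mul_finrank_root_le_fixed hσ (zero_ne_one (α := Fin 2))
    have h3 := card_mul_finrank_root_le_fixed hρ (zero_ne_one (α := Fin 2))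
    rw [hσ0, finrank_bot, mul_zero, zero_add, Fintype.card_fin] at h2
    rw [hρ0, finrank_bot, mul_zero, zero_add, Fintype.card_fin] at h3
    have h4 : 0 < finrank ℂ V := finrank_pos
    have h5 := Nat.mul_le_mul_left (Fintype.card F) h1
    rw [mul_add] at h5
    have h6 : Fintype.card F * finrank ℂ V ≤ 16 * finrank ℂ V := by
      refine h5.trans ((add_le_add h2 h3).trans (le_of_eq ?_)); ring
    have := Nat.le_of_mul_le_mul_right h6 h4
    omega
  set w0 := w - P w - Q w + P (Q w) with hw0
  have hPw : P w0 = 0 := by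
    rw [hw0]; simp only [map_add, map_sub, hPP]; abel
  have hQw : Q w0 = 0 := by
    rw [hw0]; simp only [map_add, map_sub, ← hPQ, hQQ]; abel
  obtain ⟨b, hb, hw1⟩ := exists_weightProj_ne_zero hψ1 hw hPw
  have hQw1 : Q (weightProj ψ σ b w0) = 0 := by
    rw [hQ, avg_commute (σ := ρ.comp upHom)
      (fun g v => weightProj_commute (fun g h v => (hc h g v).symm) ψ b _ v),
      ← hQ, hQw, map_zero]
  obtain ⟨c, hcc, hw2⟩ := exists_weightProj_ne_zero hψ1 hw1 hQw1
  obtain ⟨z, hz⟩ : ∃ z, z = weightProj ψ ρ c (weightProj ψ σ b w0) := ⟨_, rfl⟩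
  rw [← hz] at hw2
  have hzρ : IsWeight ψ ρ c z := hz ▸ isWeight_weightProj ψ ρ c _
  have hzσ : IsWeight ψ σ b z := fun t => by
    rw [hz, weightProj_commute hc, isWeight_weightProj ψ σ b w0, map_smul]
  let S : Finset F := Finset.univ.image fun s : Fˣ => (s : F)⁻¹ ^ 2
  have hS : Fintype.card F - 1 ≤ 2 * S.card := by
    rw [← Fintype.card_units, ← Finset.card_univ]
    refine Finset.card_le_mul_card_image _ 2 fun a ha => ?_
    obtain ⟨s, -, rfl⟩ := Finset.mem_image.1 ha
    refine (Finset.card_le_card (t := {s, -s}) fun r hr => ?_).trans Finset.card_le_two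
    have := (Finset.mem_filter.1 hr).2
    rw [sq_eq_sq_iff_eq_or_eq_neg, _root_.inv_inj, ← inv_neg,
      _root_.inv_inj] at this
    simpa [Units.ext_iff] using this
  have hch : ∀ x : S, ∃ s : Fˣ, (s : F)⁻¹ ^ 2 = x := fun x => by
    obtain ⟨s, -, hs⟩ := Finset.mem_image.1 x.2
    exact ⟨s, hs⟩
  choose r hr using hch
  have hinj : ∀ (τ : SL(2, F) →* End ℂ V) g v, τ g v = 0 → v = 0 := fun τ g v h => by
    rw [← rep_inv_apply_self τ g v, h, map_zero]
  have hli : LinearIndependent ℂ fun p : S × S => σ (tor (r p.1)) (ρ (tor (r p.2)) z) := by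
    refine linearIndependent_of_ne_zero_of_inner_eq_zero (fun p h0 => hw2 ?_) fun p p' hpp' => ?_
    · exact hinj ρ _ _ (hinj σ _ _ h0)
    · change ⟪σ (tor (r p.1)) (ρ (tor (r p.2)) z), σ (tor (r p'.1)) (ρ (tor (r p'.2)) z)⟫_ℂ = 0
      by_cases h1 : p.1 = p'.1
      · have h2 : p.2 ≠ p'.2 := fun h2 => hpp' (Prod.ext h1 h2)
        rw [h1, hσ]
        refine IsWeight.inner_eq_zero hψ1 hρ (hzρ.tor _) (hzρ.tor _) ?_
        rw [hr, hr]
        exact fun h => h2 (Subtype.ext (mul_left_cancel₀ hcc h))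
      · have hW : ∀ g, IsWeight ψ σ b (ρ g z) := fun g t => by rw [hc, hzσ, map_smul]
        refine IsWeight.inner_eq_zero hψ1 hσ ((hW _).tor _) ((hW _).tor _) ?_
        rw [hr, hr]
        exact fun h => h1 (Subtype.ext (mul_left_cancel₀ hb h))
  have h1 := hli.fintype_card_le_finrank
  rw [Fintype.card_prod, Fintype.card_coe] at h1
  calc _ ≤ (2 * S.card) ^ 2 := Nat.pow_le_pow_left hS 2
    _ = 4 * (S.card * S.card) := by ring
    _ ≤ _ := by gcongr

end UnipotentCharacters

end SLWord

namespace SLWord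

open scoped InnerProductSpace MatrixGroups
open Module Matrix

section ClassOperator

variable {V : Type*} [NormedAddCommGroup V] [InnerProductSpace ℂ V]
variable {G : Type*} [Group G] [Fintype G]

/-- The sum of the operators of all conjugates of `g`. -/
def clsOp (ρ : G →* End ℂ V) (g : G) : End ℂ V := ∑ x, ρ (x * g * x⁻¹)

lemma clsOp_apply (ρ : G →* End ℂ V) (g : G) (v : V) :
    clsOp ρ g v = ∑ x, ρ (x * g * x⁻¹) v := by
  simp [clsOp, LinearMap.sum_apply]

lemma cls_eq_inner (ρ : G →* End ℂ V) (g : G) (v w : V) :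
    cls ρ g v w = ⟪clsOp ρ g v, w⟫_ℂ := by
  rw [clsOp_apply, sum_inner]; rfl

lemma clsOp_rep (ρ : G →* End ℂ V) (g h : G) (v : V) :
    clsOp ρ g (ρ h v) = ρ h (clsOp ρ g v) := by
  rw [clsOp_apply, clsOp_apply, map_sum, ← Equiv.sum_comp (Equiv.mulLeft h)]
  refine Finset.sum_congr rfl fun x _ => ?_
  rw [← rep_mul_apply, ← rep_mul_apply, Equiv.coe_mulLeft]
  congr 2
  group

lemma clsOp_commute {ρ σ : G →* End ℂ V} (hc : ∀ g h v, σ g (ρ h v) = ρ h (σ g v)) (g h : G)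
    (v : V) : clsOp ρ g (σ h v) = σ h (clsOp ρ g v) := by
  rw [clsOp_apply, clsOp_apply, map_sum]
  simp_rw [hc]

lemma inner_clsOp {ρ : G →* End ℂ V} (hρ : IsUnitary ρ) (g : G) (v w : V) :
    ⟪clsOp ρ g v, w⟫_ℂ = ⟪v, clsOp ρ g⁻¹ w⟫_ℂ := by
  rw [clsOp_apply, clsOp_apply, sum_inner, inner_sum]
  refine Finset.sum_congr rfl fun x _ => ?_
  rw [hρ.inner_left]
  congr 3
  group

/-- If every subspace invariant under two commuting representations is large, then the class
operators of the first have small norm. -/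
theorem mul_norm_clsOp_sq_le [FiniteDimensional ℂ V] {ρ σ : G →* End ℂ V} (hρ : IsUnitary ρ)
    (hc : ∀ g h v, σ g (ρ h v) = ρ h (σ g v)) {m K : ℝ} (hm : 0 < m)
    (hW : ∀ W : Submodule ℂ V, W ≠ ⊥ → (∀ g, ∀ w ∈ W, ρ g w ∈ W) → (∀ g, ∀ w ∈ W, σ g w ∈ W) →
      m ≤ finrank ℂ W)
    (g : G)
    (hK : ∀ (k : ℕ) (e : Fin k → V), Orthonormal ℂ e → ∑ i, ‖clsOp ρ g (e i)‖ ^ 2 ≤ K) (v : V) :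
    m * ‖clsOp ρ g v‖ ^ 2 ≤ K * ‖v‖ ^ 2 := by
  set M : End ℂ V := clsOp ρ g⁻¹ * clsOp ρ g with hM
  have hin : ∀ v w, ⟪M v, w⟫_ℂ = ⟪clsOp ρ g v, clsOp ρ g w⟫_ℂ := fun v w => by
    rw [hM, End.mul_apply, inner_clsOp hρ, inv_inv]
  have hsymm : M.IsSymmetric := fun v w => by
    rw [hin, ← inner_conj_symm v, hin, inner_conj_symm]
  have hsq : ∀ v, ((‖clsOp ρ g v‖ ^ 2 : ℝ) : ℂ) = ⟪M v, v⟫_ℂ := fun v => by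
    rw [hin, inner_self_eq_norm_sq_to_K]; push_cast; rfl
  have key := re_inner_le_of_eigenvalue_le (M := M) hsymm (c := K / m) (fun μ hμ => ?_) v
  · rw [← hsq, Complex.ofReal_re, div_mul_eq_mul_div, le_div_iff₀ hm] at key
    linarith
  obtain ⟨W, hWdef⟩ : ∃ W, W = End.eigenspace M (μ : ℂ) := ⟨_, rfl⟩
  have hmem : ∀ w, w ∈ W ↔ M w = (μ : ℂ) • w := fun w => by rw [hWdef, End.mem_eigenspace_iff]
  have hdim := hW W (hWdef ▸ hμ) (fun h w hw => by
      rw [hmem] at hw ⊢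
      rw [hM, End.mul_apply, clsOp_rep, clsOp_rep, ← map_smul, ← hw]; rfl) (fun h w hw => by
      rw [hmem] at hw ⊢
      rw [hM, End.mul_apply, clsOp_commute hc, clsOp_commute hc, ← map_smul, ← hw]; rfl)
  set b := stdOrthonormalBasis ℂ W
  have hb := hK _ (fun i => (b i : V)) (b.orthonormal.comp_linearIsometry W.subtypeₗᵢ)
  have hval : ∀ i, ‖clsOp ρ g (b i)‖ ^ 2 = μ := fun i => by
    have := hsq (b i)
    rw [(hmem _).1 (b i).2, inner_smul_left, Complex.conj_ofReal] at this
    have hn : ⟪(b i : V), (b i : V)⟫_ℂ = 1 := by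
      rw [inner_self_eq_norm_sq_to_K]
      have : ‖(b i : V)‖ = 1 := b.orthonormal.1 i
      rw [this]; simp
    rw [hn, mul_one] at this
    exact_mod_cast this
  rw [Finset.sum_congr rfl fun i _ => hval i, Finset.sum_const, Finset.card_univ, Fintype.card_fin,
    nsmul_eq_mul] at hb
  by_cases hμ0 : 0 ≤ μ
  · rw [le_div_iff₀ hm]
    nlinarith
  · have hK0 : 0 ≤ K := by
      have := hK 0 Fin.elim0 ⟨fun i => i.elim0, fun i => i.elim0⟩
      simpa using this
    exact (not_le.1 hμ0).le.trans (by positivity)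

end ClassOperator

section Regular

variable {G : Type*} [Group G] [Fintype G]

variable (G) in
/-- The left regular representation. -/
noncomputable def lreg : G →* End ℂ (EuclideanSpace ℂ G) where
  toFun h :=
    { toFun := fun f => WithLp.toLp 2 fun x => f (h⁻¹ * x)
      map_add' := fun _ _ => rfl
      map_smul' := fun _ _ => rfl }
  map_one' := by ext; simp
  map_mul' a b := by
    ext f x
    change f ((a * b)⁻¹ * x) = f (b⁻¹ * (a⁻¹ * x))
    rw [_root_.mul_inv_rev, mul_assoc]

variable (G) in
/-- The right regular representation. -/
noncomputable def rreg : G →* End ℂ (EuclideanSpace ℂ G) where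
  toFun h :=
    { toFun := fun f => WithLp.toLp 2 fun x => f (x * h)
      map_add' := fun _ _ => rfl
      map_smul' := fun _ _ => rfl }
  map_one' := by ext; simp
  map_mul' a b := by
    ext f x
    change f (x * (a * b)) = f (x * a * b)
    rw [mul_assoc]

lemma lreg_apply (h : G) (f : EuclideanSpace ℂ G) (x : G) : lreg G h f x = f (h⁻¹ * x) := rfl

lemma rreg_apply (h : G) (f : EuclideanSpace ℂ G) (x : G) : rreg G h f x = f (x * h) := rfl

lemma inner_eq_sum (v w : EuclideanSpace ℂ G) :
    ⟪v, w⟫_ℂ = ∑ x, ⟪v x, w x⟫_ℂ := PiLp.inner_apply _ _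

lemma isUnitary_lreg : IsUnitary (lreg G) := fun h v w => by
  rw [inner_eq_sum, inner_eq_sum, ← Equiv.sum_comp (Equiv.mulLeft h⁻¹) fun x => ⟪v x, w x⟫_ℂ]
  rfl

lemma isUnitary_rreg : IsUnitary (rreg G) := fun h v w => by
  rw [inner_eq_sum, inner_eq_sum, ← Equiv.sum_comp (Equiv.mulRight h) fun x => ⟪v x, w x⟫_ℂ]
  rfl

lemma rreg_lreg (g h : G) (v : EuclideanSpace ℂ G) :
    rreg G g (lreg G h v) = lreg G h (rreg G g v) := by
  ext x
  simp only [lreg_apply, rreg_apply, mul_assoc]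

variable (G) in
/-- The functions of mean zero. -/
def meanZero : Submodule ℂ (EuclideanSpace ℂ G) where
  carrier := {f | ∑ x, f x = 0}
  add_mem' {a b} ha hb := by
    change ∑ x, (a x + b x) = 0
    rw [Finset.sum_add_distrib, ha, hb, add_zero]
  zero_mem' := by simp
  smul_mem' c f hf := by
    change ∑ x, c * f x = 0
    rw [← Finset.mul_sum, hf, mul_zero]

lemma mem_meanZero {f : EuclideanSpace ℂ G} : f ∈ meanZero G ↔ ∑ x, f x = 0 := Iff.rfl

lemma lreg_mem_meanZero (g : G) (f) (hf : f ∈ meanZero G) : lreg G g f ∈ meanZero G :=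
  (Equiv.sum_comp (Equiv.mulLeft g⁻¹) fun x => f x).trans hf

lemma rreg_mem_meanZero (g : G) (f) (hf : f ∈ meanZero G) : rreg G g f ∈ meanZero G :=
  (Equiv.sum_comp (Equiv.mulRight g) fun x => f x).trans hf

variable (G) in
/-- The left regular representation on functions of mean zero. -/
noncomputable abbrev lreg₀ : G →* End ℂ (meanZero G) := subrep (lreg G) _ lreg_mem_meanZero

variable (G) in
/-- The right regular representation on functions of mean zero. -/
noncomputable abbrev rreg₀ : G →* End ℂ (meanZero G) := subrep (rreg G) _ rreg_mem_meanZero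

lemma eq_zero_of_const {f : meanZero G} (hf : ∀ x, f.1 x = f.1 1) : f = 0 := by
  have h : ∑ x, f.1 x = 0 := f.2
  rw [Finset.sum_congr rfl fun x _ => hf x, Finset.sum_const, Finset.card_univ,
    ← Nat.cast_smul_eq_nsmul ℂ, smul_eq_zero] at h
  have h1 := h.resolve_left (card_ne_zero_complex G)
  ext x
  rw [hf, h1]; rfl

lemma fixed_lreg₀ : fixed (V := meanZero G) (lreg₀ G) = ⊥ := by
  rw [eq_bot_iff]
  refine fun f hf => eq_zero_of_const fun x => ?_
  have h := congrArg (fun f : meanZero G => f.1 1) (hf x⁻¹)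
  change f.1 (x⁻¹⁻¹ * 1) = f.1 1 at h
  rwa [mul_one, inv_inv] at h

lemma fixed_rreg₀ : fixed (V := meanZero G) (rreg₀ G) = ⊥ := by
  rw [eq_bot_iff]
  refine fun f hf => eq_zero_of_const fun x => ?_
  have h := congrArg (fun f : meanZero G => f.1 1) (hf x)
  change f.1 (1 * x) = f.1 1 at h
  rwa [one_mul] at h

lemma lreg_single [DecidableEq G] (h a : G) :
    lreg G h (EuclideanSpace.single a 1) = EuclideanSpace.single (h * a) 1 := by
  ext x
  rw [lreg_apply]
  simp only [PiLp.single_apply, inv_mul_eq_iff_eq_mul]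

lemma norm_clsOp_single_sq [DecidableEq G] (g a : G) :
    ‖clsOp (lreg G) g (EuclideanSpace.single a 1)‖ ^ 2 =
      Fintype.card G * Fintype.card {x // x * g = g * x} := by
  have hC : ((‖clsOp (lreg G) g (EuclideanSpace.single a 1)‖ ^ 2 : ℝ) : ℂ) =
      ∑ x : G, ∑ y : G, if x * g * x⁻¹ = y * g * y⁻¹ then 1 else 0 := by
    have : ((‖clsOp (lreg G) g (EuclideanSpace.single a 1)‖ ^ 2 : ℝ) : ℂ) =
      ⟪clsOp (lreg G) g (EuclideanSpace.single a 1),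
        clsOp (lreg G) g (EuclideanSpace.single a 1)⟫_ℂ := by
      rw [inner_self_eq_norm_sq_to_K]; push_cast; rfl
    rw [this, clsOp_apply, sum_inner]
    refine Finset.sum_congr rfl fun x _ => ?_
    rw [inner_sum]
    refine Finset.sum_congr rfl fun y _ => ?_
    rw [lreg_single, lreg_single, EuclideanSpace.inner_single_left]
    simp only [map_one, one_mul, PiLp.single_apply, mul_left_inj]
  have h2 : ∀ x : G, (∑ y : G, if x * g * x⁻¹ = y * g * y⁻¹ then (1 : ℂ) else 0) =
      Fintype.card {x // x * g = g * x} := fun x => by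
    rw [Finset.sum_boole, Fintype.card_subtype]
    congr 1
    refine Finset.card_bij (fun y _ => x⁻¹ * y) (fun y hy => ?_)
      (fun _ _ _ _ h => mul_left_cancel h)
      fun z hz => ⟨x * z, ?_, by group⟩
    · have := (Finset.mem_filter.1 hy).2
      refine Finset.mem_filter.2 ⟨Finset.mem_univ _, ?_⟩
      have h3 : x⁻¹ * (y * g * y⁻¹) * y = x⁻¹ * y * g := by group
      rw [← h3, ← this]; group
    · have := (Finset.mem_filter.1 hz).2
      refine Finset.mem_filter.2 ⟨Finset.mem_univ _, ?_⟩
      have h3 : x * z * g * (x * z)⁻¹ = x * (z * g) * z⁻¹ * x⁻¹ := by group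
      rw [h3, this]; group
  rw [Finset.sum_congr rfl fun x _ => h2 x, Finset.sum_const, Finset.card_univ, nsmul_eq_mul] at hC
  exact_mod_cast hC

lemma sum_norm_clsOp_sq_le [DecidableEq G] (g : G) {k : ℕ} (e : Fin k → meanZero G)
    (he : Orthonormal ℂ e) :
    ∑ i, ‖clsOp (lreg₀ G) g (e i)‖ ^ 2 ≤
      (Fintype.card G : ℝ) ^ 2 * Fintype.card {x // x * g = g * x} := by
  have he' : Orthonormal ℂ fun i => (e i : EuclideanSpace ℂ G) :=
    he.comp_linearIsometry (meanZero G).subtypeₗᵢ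
  have h1 : ∀ i, ‖clsOp (lreg₀ G) g (e i)‖ ^ 2 =
      ∑ a, ‖⟪(e i : EuclideanSpace ℂ G),
        clsOp (lreg G) g⁻¹ (EuclideanSpace.single a 1)⟫_ℂ‖ ^ 2 := fun i => by
    have : ‖clsOp (lreg₀ G) g (e i)‖ = ‖clsOp (lreg G) g (e i)‖ := by
      rw [← Submodule.norm_coe, clsOp_apply, clsOp_apply]
      congr 1
      exact Submodule.coe_sum _ _ _
    rw [this, EuclideanSpace.norm_sq_eq]
    refine Finset.sum_congr rfl fun a _ => ?_
    rw [← inner_clsOp isUnitary_lreg, EuclideanSpace.inner_single_right]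
    simp
  simp_rw [h1]
  rw [Finset.sum_comm]
  have h2 : ∀ a : G, ∑ i, ‖⟪(e i : EuclideanSpace ℂ G),
      clsOp (lreg G) g⁻¹ (EuclideanSpace.single a 1)⟫_ℂ‖ ^ 2
      ≤ Fintype.card G * Fintype.card {x // x * g = g * x} := fun a => by
    refine (he'.sum_inner_products_le _ (s := Finset.univ)).trans ?_
    rw [norm_clsOp_single_sq]
    have : Fintype.card {x // x * g⁻¹ = g⁻¹ * x} = Fintype.card {x // x * g = g * x} :=
      Fintype.card_congr (Equiv.subtypeEquivRight fun x => by
        rw [eq_inv_mul_iff_mul_eq, ← mul_assoc, mul_inv_eq_iff_eq_mul, eq_comm])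
    rw [this]
  refine (Finset.sum_le_sum fun a _ => h2 a).trans ?_
  rw [Finset.sum_const, Finset.card_univ, nsmul_eq_mul]
  exact le_of_eq (by ring)

end Regular

end SLWord

namespace SLWord

open scoped InnerProductSpace MatrixGroups
open Module Matrix

section Centralizer

variable {F : Type*} [Field F] [Fintype F] [DecidableEq F]

lemma card_le_two_mul_of_quadratic {X : Type*} [Fintype X] (r p : X → F) (e : F)
    (hinj : ∀ x y, r x = r y → p x = p y → x = y)
    (hsum : ∀ x y, r x = r y → p x ≠ p y → p x + p y = r x * e) :
    Fintype.card X ≤ 2 * Fintype.card F := by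
  classical
  have h := Finset.card_le_mul_card_image (f := r) (Finset.univ : Finset X) 2 fun a _ => by
    by_contra! h
    obtain ⟨x, y, z, hx, hy, hz, hxy, hxz, hyz⟩ := Finset.two_lt_card_iff.1 h
    simp only [Finset.mem_filter, Finset.mem_univ, true_and] at hx hy hz
    have h1 := hsum x y (hx.trans hy.symm) fun h => hxy (hinj _ _ (hx.trans hy.symm) h)
    have h2 := hsum x z (hx.trans hz.symm) fun h => hxz (hinj _ _ (hx.trans hz.symm) h)
    exact hyz (hinj _ _ (hy.trans hz.symm) (add_left_cancel (h1.trans h2.symm)))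
  exact h.trans (Nat.mul_le_mul_left 2 (Finset.card_le_univ _))

lemma card_centralizer_le {g : SL(2, F)} (hg : ∀ c : F, (g : Matrix (Fin 2) (Fin 2) F) ≠ c • 1) :
    Fintype.card {x // x * g = g * x} ≤ 2 * Fintype.card F := by
  have hcomm : ∀ x : {x // x * g = g * x}, ∀ i j,
      ((x.1.1 * g.1 : Matrix (Fin 2) (Fin 2) F)) i j = (g.1 * x.1.1) i j := fun x i j =>
    congrArg (fun y : SL(2, F) => y.1 i j) x.2
  have hdet : ∀ x : {x // x * g = g * x}, x.1.1 0 0 * x.1.1 1 1 - x.1.1 0 1 * x.1.1 1 0 = 1 :=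
    fun x => by rw [← det_fin_two]; exact x.1.2
  have hext : ∀ x y : {x // x * g = g * x}, x.1.1 0 0 = y.1.1 0 0 → x.1.1 0 1 = y.1.1 0 1 →
      x.1.1 1 0 = y.1.1 1 0 → x.1.1 1 1 = y.1.1 1 1 → x = y := fun x y h1 h2 h3 h4 => by
    apply Subtype.ext; apply Subtype.ext; ext i j; fin_cases i <;> fin_cases j <;> assumption
  simp only [Matrix.mul_apply, Fin.sum_univ_two] at hcomm
  have h00 := fun x => hcomm x 0 0
  have h01 := fun x => hcomm x 0 1
  have h10 := fun x => hcomm x 1 0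
  clear hcomm
  have hne : g.1 0 1 = 0 → g.1 1 0 = 0 → g.1 0 0 ≠ g.1 1 1 := fun h1 h2 h3 => hg (g.1 0 0) (by
    ext i j; fin_cases i <;> fin_cases j <;> simp [h1, h2, h3])
  clear hg
  generalize g.1 0 0 = a, g.1 0 1 = b, g.1 1 0 = c, g.1 1 1 = d at h00 h01 h10 hne
  by_cases hb : b = 0
  · by_cases hc : c = 0
    · have had := sub_ne_zero.2 (hne hb hc)
      subst hb hc
      have hr : ∀ x : {x // x * g = g * x}, x.1.1 0 1 = 0 := fun x =>
        (mul_eq_zero.1 (show (a - d) * x.1.1 0 1 = 0 by linear_combination -h01 x)).resolve_left had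
      have hs : ∀ x : {x // x * g = g * x}, x.1.1 1 0 = 0 := fun x =>
        (mul_eq_zero.1 (show (a - d) * x.1.1 1 0 = 0 by linear_combination h10 x)).resolve_left had
      refine card_le_two_mul_of_quadratic (fun x => x.1.1 0 0) (fun _ => 0) 0 (fun x y h _ => ?_)
        fun x y _ h => absurd rfl h
      have hx := hdet x
      have hy := hdet y
      rw [hr] at hx hy
      rw [← h] at hy
      refine hext x y h ((hr x).trans (hr y).symm) ((hs x).trans (hs y).symm) ?_
      have : x.1.1 0 0 ≠ 0 := fun h0 => by rw [h0] at hx; simp at hx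
      exact mul_left_cancel₀ this (by linear_combination hx - hy)
    · subst hb
      have hr : ∀ x : {x // x * g = g * x}, x.1.1 0 1 = 0 := fun x =>
        (mul_eq_zero.1 (show c * x.1.1 0 1 = 0 by linear_combination h00 x)).resolve_left hc
      have ht : ∀ x : {x // x * g = g * x},
          x.1.1 1 1 = x.1.1 0 0 + x.1.1 1 0 * ((d - a) / c) := fun x => by
        field_simp
        linear_combination h10 x
      refine card_le_two_mul_of_quadratic (fun x => x.1.1 1 0) (fun x => x.1.1 0 0)
        (-((d - a) / c)) (fun x y h h' => ?_) fun x y h h' => ?_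
      · exact hext x y h' ((hr x).trans (hr y).symm) h (by rw [ht, ht, h, h'])
      · have hx := hdet x
        have hy := hdet y
        rw [hr, ht] at hx hy
        rw [← h] at hy
        exact mul_left_cancel₀ (sub_ne_zero.2 h') (by linear_combination hx - hy)
  · have hs : ∀ x : {x // x * g = g * x}, x.1.1 1 0 = x.1.1 0 1 * (c / b) := fun x => by
      field_simp
      linear_combination -h00 x
    have ht : ∀ x : {x // x * g = g * x},
        x.1.1 1 1 = x.1.1 0 0 + x.1.1 0 1 * ((d - a) / b) := fun x => by
      field_simp
      linear_combination -h01 x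
    refine card_le_two_mul_of_quadratic (fun x => x.1.1 0 1) (fun x => x.1.1 0 0)
      (-((d - a) / b)) (fun x y h h' => ?_) fun x y h h' => ?_
    · exact hext x y h' h (by rw [hs, hs, h]) (by rw [ht, ht, h, h'])
    · have hx := hdet x
      have hy := hdet y
      rw [hs, ht] at hx hy
      rw [← h] at hy
      exact mul_left_cancel₀ (sub_ne_zero.2 h') (by linear_combination hx - hy)

end Centralizer

section SpectralGap

lemma sq_le_finrank_of_invariant {V : Type*} [NormedAddCommGroup V] [InnerProductSpace ℂ V]
    [FiniteDimensional ℂ V] {F : Type*} [Field F] [Fintype F] [DecidableEq F]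
    {σ ρ : SL(2, F) →* End ℂ V} (hσ : IsUnitary σ) (hρ : IsUnitary ρ)
    (hc : ∀ g h v, σ g (ρ h v) = ρ h (σ g v)) (hσ0 : fixed σ = ⊥) (hρ0 : fixed ρ = ⊥)
    (hq : 16 < Fintype.card F) (W : Submodule ℂ V) (hW : W ≠ ⊥) (h1 : ∀ g, ∀ w ∈ W, ρ g w ∈ W)
    (h2 : ∀ g, ∀ w ∈ W, σ g w ∈ W) : (Fintype.card F - 1) ^ 2 ≤ 4 * finrank ℂ W := by
  have : Nontrivial W := Submodule.nontrivial_iff_ne_bot.2 hW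
  exact sq_le_finrank_of_commute (hσ.subrep W h2) (hρ.subrep W h1)
    (fun g h v => Subtype.ext (hc g h v)) (fixed_subrep_eq_bot hσ0 _ _)
    (fixed_subrep_eq_bot hρ0 _ _) hq

lemma norm_clsOp_le_of_fin_two {F : Type*} [Field F] [Fintype F] [DecidableEq F] {g : SL(2, F)}
    (hg : ∀ c : F, (g : Matrix (Fin 2) (Fin 2) F) ≠ c • 1) (hq : 16 < Fintype.card F)
    (v : meanZero SL(2, F)) :
    ‖clsOp (V := meanZero SL(2, F)) (lreg₀ SL(2, F)) g v‖ ≤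
      9 / √(Fintype.card F) * Fintype.card SL(2, F) * ‖v‖ := by
  obtain ⟨q, hqdef⟩ : ∃ q : ℝ, q = Fintype.card F := ⟨_, rfl⟩
  have hq' : 16 < q := by rw [hqdef]; exact_mod_cast hq
  have hρ : IsUnitary (V := meanZero SL(2, F)) (lreg₀ SL(2, F)) := isUnitary_lreg.subrep _ _
  have hσ : IsUnitary (V := meanZero SL(2, F)) (rreg₀ SL(2, F)) := isUnitary_rreg.subrep _ _
  have hc : ∀ g h v, rreg₀ SL(2, F) g (lreg₀ SL(2, F) h v) =
      lreg₀ SL(2, F) h (rreg₀ SL(2, F) g v) :=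
    fun g h v => Subtype.ext (rreg_lreg g h v)
  have key := mul_norm_clsOp_sq_le (V := meanZero SL(2, F)) (m := q ^ 2 / 16)
    (K := (Fintype.card SL(2, F) : ℝ) ^ 2 * (2 * q)) hρ hc (by positivity)
    (fun W hW h1 h2 => ?_) g (fun k e he => ?_) v
  · have hs : √q ^ 2 = q := Real.sq_sqrt (by linarith)
    have hs0 : 0 < √q := Real.sqrt_pos.2 (by linarith)
    rw [← hqdef]
    refine abs_le_of_sq_le_sq' ?_ (by positivity) |>.2
    rw [mul_pow, mul_pow, div_pow, hs, div_mul_eq_mul_div, div_mul_eq_mul_div,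
      le_div_iff₀ (by linarith)]
    obtain ⟨X, hX⟩ : ∃ X, X = ‖clsOp (V := meanZero SL(2, F)) (lreg₀ SL(2, F)) g v‖ ^ 2 := ⟨_, rfl⟩
    obtain ⟨Y, hY⟩ : ∃ Y, Y = (Fintype.card SL(2, F) : ℝ) ^ 2 * ‖v‖ ^ 2 := ⟨_, rfl⟩
    rw [← hX] at key ⊢
    have hY0 : 0 ≤ Y := by rw [hY]; positivity
    have h1 : q * (X * q) ≤ q * (32 * Y) := by rw [hY]; linarith
    have := le_of_mul_le_mul_left h1 (by linarith)
    rw [mul_assoc, ← hY]; linarith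
  · have h := sq_le_finrank_of_invariant (V := meanZero SL(2, F)) hσ hρ hc fixed_rreg₀ fixed_lreg₀
      hq W hW h1 h2
    have h' : (q - 1) ^ 2 ≤ 4 * finrank ℂ W := by
      rw [hqdef, ← Nat.cast_one, ← Nat.cast_sub (by omega)]
      exact_mod_cast h
    nlinarith
  · refine (sum_norm_clsOp_sq_le g e he).trans ?_
    gcongr
    rw [hqdef]
    exact_mod_cast card_centralizer_le hg

/-- The spectral gap of the conjugacy class of a noncentral element of the special linear
group. -/
theorem norm_cls_lreg₀_le {n : ℕ} (hn : 2 ≤ n) {F : Type*} [Field F] [Fintype F] [DecidableEq F]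
    {g : SL(n, F)} (hg : ∀ c : F, (g : Matrix (Fin n) (Fin n) F) ≠ c • 1)
    (v w : meanZero SL(n, F)) :
    ‖cls (V := meanZero SL(n, F)) (lreg₀ SL(n, F)) g v w‖ ≤
      (4 * n + 1) / √(Fintype.card F) * Fintype.card SL(n, F) * (‖v‖ * ‖w‖) := by
  have hρ : IsUnitary (V := meanZero SL(n, F)) (lreg₀ SL(n, F)) := isUnitary_lreg.subrep _ _
  rcases hn.eq_or_lt with rfl | hn
  · have hq0 : 0 < √(Fintype.card F : ℝ) := Real.sqrt_pos.2 (Nat.cast_pos.2 Fintype.card_pos)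
    by_cases hq : 16 < Fintype.card F
    · rw [cls_eq_inner]
      refine (norm_inner_le_norm (𝕜 := ℂ) (E := meanZero SL(2, F)) _ _).trans ?_
      rw [← mul_assoc]
      gcongr
      refine (norm_clsOp_le_of_fin_two hg hq v).trans (le_of_eq ?_)
      norm_num
    · refine (norm_cls_le hρ g v w).trans ?_
      gcongr
      refine le_mul_of_one_le_left (by positivity) ?_
      rw [le_div_iff₀ hq0, one_mul, Real.sqrt_le_left (by positivity)]
      have : (Fintype.card F : ℝ) ≤ 16 := by exact_mod_cast not_lt.1 hq
      norm_num
      linarith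
  · have := norm_cls_le_of_card_gt_two (V := meanZero SL(n, F)) (by simpa using hn) hρ
      fixed_lreg₀ hg v w
    simpa using this

end SpectralGap

end SLWord

namespace SLWord

open scoped InnerProductSpace MatrixGroups
open Module Matrix

section Convolution

variable {G : Type*} [Group G] [Fintype G] [DecidableEq G]

/-- The indicator function of a finite set, minus its mean. -/
noncomputable def centred (A : Finset G) : meanZero G :=
  ⟨WithLp.toLp 2 fun x => (if x ∈ A then 1 else 0) - (A.card / Fintype.card G : ℂ), by
    rw [mem_meanZero]
    change ∑ x, ((if x ∈ A then 1 else 0) - (A.card / Fintype.card G : ℂ)) = 0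
    have := card_ne_zero_complex G
    rw [Finset.sum_sub_distrib, Finset.sum_boole, Finset.sum_const, Finset.card_univ]
    simp [mul_div_cancel₀, this]⟩

lemma centred_apply (A : Finset G) (x : G) :
    (centred A).1 x = ((if x ∈ A then 1 else 0) - (A.card / Fintype.card G : ℝ) : ℝ) := by
  change (if x ∈ A then (1 : ℂ) else 0) - (A.card / Fintype.card G : ℂ) = _
  split_ifs <;> push_cast <;> rfl

lemma sum_centred_mul (A B : Finset G) (e : Equiv.Perm G) :
    ∑ x, ((if e x ∈ A then 1 else 0) - (A.card / Fintype.card G : ℝ)) *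
        ((if x ∈ B then 1 else 0) - (B.card / Fintype.card G : ℝ)) =
      (Finset.univ.filter fun x => e x ∈ A ∧ x ∈ B).card -
        (A.card * B.card / Fintype.card G : ℝ) := by
  have hG : (Fintype.card G : ℝ) ≠ 0 := Nat.cast_ne_zero.2 Fintype.card_ne_zero
  simp only [sub_mul, mul_sub, Finset.sum_sub_distrib, ← Finset.sum_mul, ← Finset.mul_sum,
    Finset.sum_const, Finset.card_univ, nsmul_eq_mul]
  rw [Equiv.sum_comp e fun x => if x ∈ A then (1 : ℝ) else 0]
  simp only [Finset.sum_boole, ite_mul, one_mul, zero_mul, ← ite_and]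
  simp only [Finset.filter_mem_eq_inter, Finset.univ_inter]
  field_simp
  ring

lemma norm_centred_le (A : Finset G) : ‖centred A‖ ≤ √A.card := by
  refine Real.le_sqrt_of_sq_le ?_
  rw [← Submodule.norm_coe, EuclideanSpace.norm_sq_eq]
  have := sum_centred_mul A A (Equiv.refl G)
  simp only [Equiv.refl_apply, and_self, Finset.filter_mem_eq_inter, Finset.univ_inter] at this
  have h2 : ∀ x, ‖(centred A).1 x‖ ^ 2 =
      ((if x ∈ A then 1 else 0) - (A.card / Fintype.card G : ℝ)) *
      ((if x ∈ A then 1 else 0) - (A.card / Fintype.card G : ℝ)) := fun x => by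
    rw [centred_apply, Complex.norm_real, Real.norm_eq_abs, sq_abs, sq]
  rw [Finset.sum_congr rfl fun x _ => h2 x]
  refine (le_of_eq this).trans ?_
  linarith [show (0 : ℝ) ≤ A.card * A.card / Fintype.card G by positivity]

lemma inner_lreg₀_centred (A B : Finset G) (h : G) :
    ⟪lreg₀ G h (centred (B.map (Equiv.inv G).toEmbedding)), centred A⟫_ℂ =
      (((Finset.univ.filter fun x => x⁻¹ * h ∈ B ∧ x ∈ A).card -
        (A.card * B.card / Fintype.card G : ℝ) : ℝ) : ℂ) := by
  have := sum_centred_mul (B.map (Equiv.inv G).toEmbedding) A (Equiv.mulLeft h⁻¹)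
  have h1 : ∀ x, (Equiv.mulLeft h⁻¹) x ∈ B.map (Equiv.inv G).toEmbedding ↔
      x⁻¹ * h ∈ B := fun x => by
    rw [Finset.mem_map_equiv]; simp
  simp only [h1] at this
  rw [Finset.card_map, mul_comm (B.card : ℝ)] at this
  rw [← this, Submodule.coe_inner, inner_eq_sum]
  push_cast
  refine Finset.sum_congr rfl fun x _ => ?_
  rw [coe_subrep_apply, lreg_apply, centred_apply, centred_apply]
  have h2 := h1 x
  rw [Equiv.coe_mulLeft] at h2
  rw [RCLike.inner_apply, Complex.conj_ofReal, mul_comm, Finset.card_map, if_congr h2 rfl rfl]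
  push_cast
  rfl

theorem abs_card_mul_sub_le {A B : Finset G} (hA : ∀ x, ∀ a ∈ A, x * a * x⁻¹ ∈ A)
    (hB : ∀ x, ∀ a ∈ B, x * a * x⁻¹ ∈ B) {g : G} {κ : ℝ}
    (hκ : ∀ v w : meanZero G, ‖cls (V := meanZero G) (lreg₀ G) g v w‖ ≤
      κ * Fintype.card G * (‖v‖ * ‖w‖)) (hκ0 : 0 ≤ κ) :
    |(Fintype.card G : ℝ) * (Finset.univ.filter fun x => x⁻¹ * g ∈ B ∧ x ∈ A).card -
        A.card * B.card| ≤ κ * Fintype.card G * (√A.card * √B.card) := by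
  have hG : (Fintype.card G : ℝ) ≠ 0 := Nat.cast_ne_zero.2 Fintype.card_ne_zero
  have key := hκ (centred (B.map (Equiv.inv G).toEmbedding)) (centred A)
  have hA' : ∀ x a, x * a * x⁻¹ ∈ A ↔ a ∈ A := fun x a =>
    ⟨fun h => by simpa [mul_assoc] using hA x⁻¹ _ h, hA x a⟩
  have hB' : ∀ x a, x * a * x⁻¹ ∈ B ↔ a ∈ B := fun x a =>
    ⟨fun h => by simpa [mul_assoc] using hB x⁻¹ _ h, hB x a⟩
  have hN : ∀ y : G, (Finset.univ.filter fun x => x⁻¹ * (y * g * y⁻¹) ∈ B ∧ x ∈ A).card =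
      (Finset.univ.filter fun x => x⁻¹ * g ∈ B ∧ x ∈ A).card := fun y => by
    symm
    refine Finset.card_equiv (MulAut.conj y).toEquiv fun x => ?_
    simp only [Finset.mem_filter, Finset.mem_univ, true_and]
    change _ ↔ (y * x * y⁻¹)⁻¹ * (y * g * y⁻¹) ∈ B ∧ y * x * y⁻¹ ∈ A
    rw [hA', show (y * x * y⁻¹)⁻¹ * (y * g * y⁻¹) = y * (x⁻¹ * g) * y⁻¹ by group, hB']
  unfold cls at key
  simp only [inner_lreg₀_centred, hN, Finset.sum_const, Finset.card_univ, nsmul_eq_mul] at key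
  rw [← Complex.ofReal_natCast, ← Complex.ofReal_mul, Complex.norm_real, Real.norm_eq_abs,
    mul_sub, mul_div_cancel₀ _ hG] at key
  refine key.trans ?_
  rw [mul_comm √(A.card : ℝ)]
  have h1 := norm_centred_le (B.map (Equiv.inv G).toEmbedding)
  rw [Finset.card_map] at h1
  gcongr
  exact norm_centred_le A

end Convolution

section Quotient

variable {G : Type*} [Group G] [Fintype G] (Z : Subgroup G) [Z.Normal]

lemma ncard_preimage_mk (S : Set (G ⧸ Z)) :
    ((QuotientGroup.mk : G → G ⧸ Z) ⁻¹' S).ncard = Nat.card Z * S.ncard := by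
  rw [← Nat.card_coe_set_eq, ← Nat.card_coe_set_eq,
    Nat.card_congr (QuotientGroup.preimageMkEquivSubgroupProdSet Z S), Nat.card_prod]

lemma ncard_mul_eq {H : Type*} [Group H] (A B : Set H) (g : H) :
    {p : H × H | p.1 ∈ A ∧ p.2 ∈ B ∧ p.1 * p.2 = g}.ncard = {x | x⁻¹ * g ∈ B ∧ x ∈ A}.ncard := by
  refine Set.ncard_congr (fun p _ => p.1) (fun p hp => ?_) (fun p p' hp hp' h => ?_) fun x hx => ?_
  · obtain ⟨h1, h2, rfl⟩ := hp
    exact ⟨by simpa using h2, h1⟩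
  · obtain ⟨-, -, h1⟩ := hp
    obtain ⟨-, -, h2⟩ := hp'
    refine Prod.ext h (mul_left_cancel (a := p.1) ?_)
    rw [h1, ← h2, h]
  · exact ⟨(x, x⁻¹ * g), ⟨hx.2, hx.1, by simp⟩, rfl⟩

theorem abs_Pab_sub_le {A B : Set (G ⧸ Z)} (hA : ∀ x, ∀ a ∈ A, x * a * x⁻¹ ∈ A)
    (hB : ∀ x, ∀ a ∈ B, x * a * x⁻¹ ∈ B) {g : G} {κ c : ℝ} (hκ0 : 0 ≤ κ) (hc : 0 < c)
    (hκ : ∀ v w : meanZero G, ‖cls (V := meanZero G) (lreg₀ G) g v w‖ ≤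
      κ * Fintype.card G * (‖v‖ * ‖w‖))
    (hcA : c * Fintype.card G ≤ ((QuotientGroup.mk : G → G ⧸ Z) ⁻¹' A).ncard)
    (hcB : c * Fintype.card G ≤ ((QuotientGroup.mk : G → G ⧸ Z) ⁻¹' B).ncard) :
    |Pab A B (g : G ⧸ Z) - 1 / (Nat.card (G ⧸ Z) : ℝ)| ≤
      κ / c * (1 / (Nat.card (G ⧸ Z) : ℝ)) := by
  classical
  set A' := (QuotientGroup.mk : G → G ⧸ Z) ⁻¹' A with hA'
  set B' := (QuotientGroup.mk : G → G ⧸ Z) ⁻¹' B with hB'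
  have key := abs_card_mul_sub_le (A := A'.toFinset) (B := B'.toFinset) (g := g)
    (fun x a ha => by
      rw [Set.mem_toFinset] at ha ⊢
      exact hA x a ha) (fun x a ha => by
      rw [Set.mem_toFinset] at ha ⊢
      exact hB x a ha) hκ hκ0
  have hN : (Finset.univ.filter fun x => x⁻¹ * g ∈ B'.toFinset ∧ x ∈ A'.toFinset).card =
      Nat.card Z * {p : (G ⧸ Z) × (G ⧸ Z) | p.1 ∈ A ∧ p.2 ∈ B ∧ p.1 * p.2 = g}.ncard := by
    rw [ncard_mul_eq, ← ncard_preimage_mk, ← Set.ncard_coe_finset]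
    congr 1
    ext x
    simp [hA', hB']
  rw [hN] at key
  unfold Pab
  rw [← Set.ncard_eq_toFinset_card', ← Set.ncard_eq_toFinset_card'] at key
  have hZ : (0 : ℝ) < Nat.card Z := Nat.cast_pos.2 Nat.card_pos
  have hG : (Fintype.card G : ℝ) = Nat.card Z * Nat.card (G ⧸ Z) := by
    rw [← Nat.card_eq_fintype_card, Subgroup.card_eq_card_quotient_mul_card_subgroup Z]
    push_cast; ring
  have hQ : (0 : ℝ) < Nat.card (G ⧸ Z) := Nat.cast_pos.2 Nat.card_pos
  have hcG : 0 < c * Fintype.card G := by rw [hG]; positivity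
  have hAB : c * Fintype.card G ≤ √A'.ncard * √B'.ncard := by
    rw [← Real.sqrt_mul (Nat.cast_nonneg _)]
    refine Real.le_sqrt_of_sq_le ?_
    rw [sq]
    exact mul_le_mul hcA hcB hcG.le (Nat.cast_nonneg _)
  have hsA : √(A'.ncard : ℝ) ^ 2 = A'.ncard := Real.sq_sqrt (Nat.cast_nonneg _)
  have hsB : √(B'.ncard : ℝ) ^ 2 = B'.ncard := Real.sq_sqrt (Nat.cast_nonneg _)
  have eA : (A'.ncard : ℝ) = Nat.card Z * A.ncard := by rw [hA', ncard_preimage_mk]; push_cast; rfl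
  have eB : (B'.ncard : ℝ) = Nat.card Z * B.ncard := by rw [hB', ncard_preimage_mk]; push_cast; rfl
  have hA0 : (0 : ℝ) < A.ncard := by
    have : 0 < (Nat.card Z : ℝ) * A.ncard := eA ▸ hcG.trans_le hcA
    exact pos_of_mul_pos_right this hZ.le
  have hB0 : (0 : ℝ) < B.ncard := by
    have : 0 < (Nat.card Z : ℝ) * B.ncard := eB ▸ hcG.trans_le hcB
    exact pos_of_mul_pos_right this hZ.le
  obtain ⟨N, hNN⟩ : ∃ N : ℝ, N =
    {p : (G ⧸ Z) × (G ⧸ Z) | p.1 ∈ A ∧ p.2 ∈ B ∧ p.1 * p.2 = g}.ncard := ⟨_, rfl⟩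
  push_cast at key
  rw [← hNN] at key ⊢
  obtain ⟨s, hs⟩ : ∃ s, s = √(A'.ncard : ℝ) * √(B'.ncard : ℝ) := ⟨_, rfl⟩
  have hs2 : s ^ 2 = Nat.card Z * A.ncard * (Nat.card Z * B.ncard) := by
    rw [hs, mul_pow, hsA, hsB, eA, eB]
  rw [← hs] at key hAB
  rw [eA, eB, hG] at key
  rw [hG] at hAB
  generalize (Nat.card Z : ℝ) = z, (Nat.card (G ⧸ Z) : ℝ) = Q, (A.ncard : ℝ) = a,
    (B.ncard : ℝ) = b at *
  have e1 : N / (a * b) - 1 / Q = (z * Q * (z * N) - z * a * (z * b)) / (z ^ 2 * (a * b * Q)) := by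
    field_simp
  rw [e1, abs_div, abs_of_pos (show 0 < z ^ 2 * (a * b * Q) by positivity),
    div_le_iff₀ (by positivity)]
  refine key.trans ?_
  have e2 : κ / c * (1 / Q) * (z ^ 2 * (a * b * Q)) = κ * (s * (s / c)) := by
    have : z ^ 2 * (a * b) = s * s := by rw [← sq, hs2]; ring
    calc _ = κ / c * (z ^ 2 * (a * b)) := by field_simp
      _ = _ := by rw [this]; ring
  have hs0 : 0 < s := lt_of_lt_of_le (by positivity) hAB
  have e3 : z * Q ≤ s / c := by rw [le_div_iff₀ hc]; linarith
  rw [e2, mul_assoc, mul_comm (z * Q)]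
  gcongr

end Quotient

end SLWord

namespace SLWord

open scoped InnerProductSpace MatrixGroups
open Module Matrix

lemma conj_mem_wordImage {d : ℕ} (w : FreeGroup (Fin d)) {G : Type*} [Group G] (x a : G)
    (ha : a ∈ wordImage w G) : x * a * x⁻¹ ∈ wordImage w G := by
  obtain ⟨f, rfl⟩ := ha
  refine ⟨fun i => x * f i * x⁻¹, ?_⟩
  have : FreeGroup.lift (fun i => x * f i * x⁻¹) =
      (MulAut.conj x).toMonoidHom.comp (FreeGroup.lift f) := by
    ext i; simp
  exact DFunLike.congr_fun this w

lemma map_mem_wordImage {d : ℕ} (w : FreeGroup (Fin d)) {G H : Type*} [Group G] [Group H]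
    (φ : G →* H) (a : G) (ha : a ∈ wordImage w G) : φ a ∈ wordImage w H := by
  obtain ⟨f, rfl⟩ := ha
  refine ⟨fun i => φ (f i), ?_⟩
  have : FreeGroup.lift (fun i => φ (f i)) = φ.comp (FreeGroup.lift f) := by
    ext i; simp
  exact DFunLike.congr_fun this w

lemma abs_Pab_wordImage_sub_le {n : ℕ} (hn : 2 ≤ n) {d : ℕ} (w₁ w₂ : FreeGroup (Fin d))
    {F : Type*} [Field F] [Fintype F] [DecidableEq F] {c : ℝ} (hc : 0 < c)
    (h₁ : c * Fintype.card SL(n, F) ≤ (wordImage w₁ SL(n, F)).ncard)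
    (h₂ : c * Fintype.card SL(n, F) ≤ (wordImage w₂ SL(n, F)).ncard)
    {g : ProjectiveSpecialLinearGroup (Fin n) F} (hg : g ≠ 1) :
    |Pab (wordImage w₁ (ProjectiveSpecialLinearGroup (Fin n) F))
        (wordImage w₂ (ProjectiveSpecialLinearGroup (Fin n) F)) g -
        1 / (Nat.card (ProjectiveSpecialLinearGroup (Fin n) F) : ℝ)| ≤
      (4 * n + 1) / c / √(Fintype.card F) *
        (1 / (Nat.card (ProjectiveSpecialLinearGroup (Fin n) F) : ℝ)) := by
  obtain ⟨g, rfl⟩ := QuotientGroup.mk_surjective g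
  have hg' : ∀ c : F, (g : Matrix (Fin n) (Fin n) F) ≠ c • 1 := fun c h => by
    refine hg ((QuotientGroup.eq_one_iff g).2
      (Matrix.SpecialLinearGroup.mem_center_iff.2 ⟨c, ?_, ?_⟩))
    · have := g.2
      rw [h, det_smul, det_one, mul_one] at this
      exact this
    · rw [h, scalar_apply, smul_one_eq_diagonal]
  have hpre : ∀ w : FreeGroup (Fin d), wordImage w SL(n, F) ⊆
      (QuotientGroup.mk : SL(n, F) → SL(n, F) ⧸ Subgroup.center SL(n, F)) ⁻¹'
        wordImage w (ProjectiveSpecialLinearGroup (Fin n) F) := fun w a ha =>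
    map_mem_wordImage w (QuotientGroup.mk' (Subgroup.center SL(n, F))) a ha
  have hle : ∀ w : FreeGroup (Fin d), c * Fintype.card SL(n, F) ≤ (wordImage w SL(n, F)).ncard →
      c * Fintype.card SL(n, F) ≤
      ((QuotientGroup.mk : SL(n, F) → SL(n, F) ⧸ Subgroup.center SL(n, F)) ⁻¹'
        wordImage w (ProjectiveSpecialLinearGroup (Fin n) F)).ncard := fun w h =>
    h.trans (Nat.cast_le.2 (Set.ncard_le_ncard (hpre w) (Set.toFinite _)))
  have key := abs_Pab_sub_le (Subgroup.center SL(n, F)) (conj_mem_wordImage w₁)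
    (conj_mem_wordImage w₂) (κ := (4 * n + 1) / √(Fintype.card F)) (by positivity) hc
    (norm_cls_lreg₀_le hn hg') (hle w₁ h₁) (hle w₂ h₂)
  rwa [div_right_comm] at key

end SLWord

namespace SLWord

open scoped MatrixGroups
open Module Matrix

section WordNumerator

variable {ι κ R S : Type*} [Fintype κ] [DecidableEq κ] [CommRing R] [CommRing S]

/-- The value of a word at matrices, with inverses replaced by adjugates. -/
def wnum (L : List (ι × Bool)) (Y : ι → Matrix κ κ R) : Matrix κ κ R :=
  (L.map fun x => cond x.2 (Y x.1) (Y x.1).adjugate).prod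

/-- The product of the determinants of the matrices that are inverted in a word. -/
def wden (L : List (ι × Bool)) (Y : ι → Matrix κ κ R) : R :=
  (L.map fun x => cond x.2 1 (Y x.1).det).prod

lemma wnum_cons (x : ι × Bool) (L : List (ι × Bool)) (Y : ι → Matrix κ κ R) :
    wnum (x :: L) Y = cond x.2 (Y x.1) (Y x.1).adjugate * wnum L Y := by
  simp [wnum]

lemma wden_cons (x : ι × Bool) (L : List (ι × Bool)) (Y : ι → Matrix κ κ R) :
    wden (x :: L) Y = cond x.2 1 (Y x.1).det * wden L Y := by
  simp [wden]

lemma wnum_map (f : R →+* S) (L : List (ι × Bool)) (Y : ι → Matrix κ κ R) :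
    wnum L (fun i => f.mapMatrix (Y i)) = f.mapMatrix (wnum L Y) := by
  rw [wnum, wnum, map_list_prod, List.map_map]
  congr 2
  funext ⟨i, b⟩
  cases b
  · exact (f.map_adjugate _).symm
  · rfl

lemma wden_map (f : R →+* S) (L : List (ι × Bool)) (Y : ι → Matrix κ κ R) :
    wden L (fun i => f.mapMatrix (Y i)) = f (wden L Y) := by
  rw [wden, wden, map_list_prod, List.map_map]
  congr 2
  funext ⟨i, b⟩
  cases b
  · exact (f.map_det _).symm
  · exact (map_one f).symm

lemma wnum_coe (L : List (ι × Bool)) (y : ι → GL κ R) :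
    wnum L (fun i => (y i : Matrix κ κ R)) =
      wden L (fun i => (y i : Matrix κ κ R)) •
        (FreeGroup.lift y (FreeGroup.mk L) : Matrix κ κ R) := by
  induction L with
  | nil => simp [wnum, wden]
  | cons x L ih =>
    have h : FreeGroup.lift y (FreeGroup.mk (x :: L)) =
        cond x.2 (y x.1) (y x.1)⁻¹ * FreeGroup.lift y (FreeGroup.mk L) := by
      rw [FreeGroup.lift_mk, FreeGroup.lift_mk, List.map_cons, List.prod_cons]
    rw [wnum_cons, wden_cons, ih, h, Units.val_mul]
    obtain ⟨i, b⟩ := x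
    cases b
    · simp only [cond_false]
      have : (y i : Matrix κ κ R).adjugate = (y i : Matrix κ κ R).det • ((y i)⁻¹ : GL κ R).1 := by
        have h1 := congrArg (· * ((y i)⁻¹ : GL κ R).1) (adjugate_mul (y i : Matrix κ κ R))
        simpa [mul_assoc] using h1
      rw [this, Matrix.smul_mul, Matrix.mul_smul, smul_smul]
    · simp

lemma isUnit_wden (L : List (ι × Bool)) (y : ι → GL κ R) :
    IsUnit (wden L (fun i => (y i : Matrix κ κ R))) := by
  induction L with
  | nil => simp [wden]
  | cons x L ih =>
    rw [wden_cons]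
    refine IsUnit.mul ?_ ih
    obtain ⟨i, b⟩ := x
    cases b
    · exact (isUnit_iff_isUnit_det _).1 (y i).isUnit
    · exact isUnit_one

end WordNumerator

end SLWord

namespace SLWord

open scoped MatrixGroups
open Module Matrix

section Twisted

open Polynomial

variable {n : ℕ} {B : Type*} [CommRing B]

/-- All exponents occurring in the polynomial are congruent to `a`. -/
def HasDeg (a : ZMod n) (p : B[X]) : Prop := ∀ k, p.coeff k ≠ 0 → (k : ZMod n) = a

namespace HasDeg

lemma zero (a : ZMod n) : HasDeg a (0 : B[X]) := fun k h => absurd (coeff_zero k) h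

lemma one : HasDeg (0 : ZMod n) (1 : B[X]) := fun k h => by
  rw [coeff_one] at h
  obtain rfl : k = 0 := by by_contra h0; simp [h0] at h
  exact Nat.cast_zero

lemma add {a : ZMod n} {p r : B[X]} (hp : HasDeg a p) (hr : HasDeg a r) : HasDeg a (p + r) :=
  fun k h => by
  rw [coeff_add] at h
  by_cases h0 : p.coeff k = 0
  · exact hr k fun h1 => h (by rw [h0, h1, add_zero])
  · exact hp k h0

lemma neg {a : ZMod n} {p : B[X]} (hp : HasDeg a p) : HasDeg a (-p) := fun k h =>
  hp k fun h1 => h (by rw [coeff_neg, h1, neg_zero])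

lemma sub {a : ZMod n} {p r : B[X]} (hp : HasDeg a p) (hr : HasDeg a r) : HasDeg a (p - r) := by
  rw [sub_eq_add_neg]; exact hp.add hr.neg

lemma mul {a b : ZMod n} {p r : B[X]} (hp : HasDeg a p) (hr : HasDeg b r) :
    HasDeg (a + b) (p * r) := fun k h => by
  rw [coeff_mul] at h
  obtain ⟨⟨i, j⟩, hij, h⟩ := Finset.exists_ne_zero_of_sum_ne_zero h
  rw [← Finset.HasAntidiagonal.mem_antidiagonal.1 hij, Nat.cast_add, hp i (left_ne_zero_of_mul h),
    hr j (right_ne_zero_of_mul h)]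

lemma sum {a : ZMod n} {κ : Type*} (s : Finset κ) (f : κ → B[X]) (h : ∀ i ∈ s, HasDeg a (f i)) :
    HasDeg a (∑ i ∈ s, f i) :=
  Finset.sum_induction f (HasDeg a) (fun _ _ => add) (zero a) h

lemma prod {κ : Type*} (s : Finset κ) (d : κ → ZMod n) (f : κ → B[X])
    (h : ∀ i, HasDeg (d i) (f i)) : HasDeg (∑ i ∈ s, d i) (∏ i ∈ s, f i) := by
  classical
  induction s using Finset.induction_on with
  | empty => simpa using one
  | insert i s hi ih => rw [Finset.sum_insert hi, Finset.prod_insert hi]; exact (h i).mul ih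

lemma det {κ : Type*} [Fintype κ] [DecidableEq κ] {M : Matrix κ κ B[X]} {r c : κ → ZMod n}
    (h : ∀ i j, HasDeg (r i - c j) (M i j)) : HasDeg (∑ i, r i - ∑ i, c i) M.det := by
  rw [det_apply]
  refine sum _ _ fun σ _ => ?_
  have : HasDeg (∑ i, r i - ∑ i, c i) (∏ i, M (σ i) i) := by
    have := prod Finset.univ (fun i => r (σ i) - c i) (fun i => M (σ i) i) fun i => h _ _
    rwa [Finset.sum_sub_distrib, Equiv.sum_comp σ r] at this
  rcases Int.units_eq_one_or (Equiv.Perm.sign σ) with h | h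
  · rwa [h, one_smul]
  · rw [h, Units.neg_smul, one_smul]; exact this.neg

end HasDeg

variable [NeZero n]

/-- Matrices over a polynomial ring representing the elements of a cyclic algebra. -/
structure IsTwisted (τ : B →+* B) (N : Matrix (ZMod n) (ZMod n) B[X]) : Prop where
  shift : N.submatrix (Equiv.addRight 1) (Equiv.addRight 1) = (mapRingHom τ).mapMatrix N
  hasDeg : ∀ i j, HasDeg (i - j) (N i j)

namespace IsTwisted

variable {τ : B →+* B} {M N : Matrix (ZMod n) (ZMod n) B[X]}

lemma sub (hM : IsTwisted τ M) (hN : IsTwisted τ N) : IsTwisted τ (M - N) where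
  shift := by rw [map_sub, ← hM.shift, ← hN.shift]; rfl
  hasDeg i j := (hM.hasDeg i j).sub (hN.hasDeg i j)

lemma mul (hM : IsTwisted τ M) (hN : IsTwisted τ N) : IsTwisted τ (M * N) where
  shift := by
    rw [map_mul, ← hM.shift, ← hN.shift, submatrix_mul_equiv]
  hasDeg i j := by
    rw [mul_apply]
    refine HasDeg.sum _ _ fun k _ => ?_
    rw [← sub_add_sub_cancel i k j]
    exact (hM.hasDeg i k).mul (hN.hasDeg k j)

lemma smul_one {s : B[X]} (hs : s.map τ = s) (hs0 : HasDeg (0 : ZMod n) s) :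
    IsTwisted τ (s • (1 : Matrix (ZMod n) (ZMod n) B[X])) where
  shift := by
    rw [smul_one_eq_diagonal, submatrix_diagonal_equiv]
    ext1 i j
    rw [RingHom.mapMatrix_apply, map_apply, diagonal_apply, diagonal_apply]
    split_ifs
    · exact hs.symm
    · simp
  hasDeg i j := by
    rw [smul_one_eq_diagonal, diagonal_apply]
    split_ifs with h
    · rw [h, sub_self]; exact hs0
    · exact HasDeg.zero _

lemma one : IsTwisted τ (1 : Matrix (ZMod n) (ZMod n) B[X]) := by
  have := smul_one (n := n) (τ := τ) (s := 1) (by simp) HasDeg.one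
  rwa [one_smul] at this

lemma map_det (hM : IsTwisted τ M) : M.det.map τ = M.det := by
  have := (mapRingHom τ).map_det M
  rw [← hM.shift, det_submatrix_equiv_self] at this
  exact this

lemma hasDeg_det (hM : IsTwisted τ M) : HasDeg (0 : ZMod n) M.det := by
  have := HasDeg.det (r := id) (c := id) hM.hasDeg
  rwa [sub_self] at this

lemma adjugate (hM : IsTwisted τ M) : IsTwisted τ M.adjugate where
  shift := by
    rw [← adjugate_submatrix_equiv_self, hM.shift, RingHom.map_adjugate]
  hasDeg i j := by
    rw [adjugate_apply]
    have h := HasDeg.det (M := M.updateRow j (Pi.single i 1)) (r := Function.update id j i)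
      (c := id) fun r c => by
        by_cases hr : r = j
        · subst hr
          rw [updateRow_self, Function.update_self, Pi.single_apply]
          split_ifs with h
          · rw [h]; simpa using HasDeg.one
          · exact HasDeg.zero _
        · rw [updateRow_ne hr, Function.update_of_ne hr]
          exact hM.hasDeg r c
    have : ∑ k, Function.update id j i k - ∑ k, id k = i - j := by
      rw [← Finset.sum_sub_distrib, Finset.sum_eq_single j]
      · simp
      · intro b _ hb; simp [hb]
      · simp
    rwa [this] at h

lemma wnum {ι : Type*} (L : List (ι × Bool)) {Y : ι → Matrix (ZMod n) (ZMod n) B[X]}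
    (hY : ∀ i, IsTwisted τ (Y i)) : IsTwisted τ (wnum L Y) := by
  induction L with
  | nil => exact one
  | cons x L ih =>
    rw [wnum_cons]
    refine mul ?_ ih
    obtain ⟨i, b⟩ := x
    cases b
    · exact (hY i).adjugate
    · exact hY i

lemma map_wden {ι : Type*} (L : List (ι × Bool)) {Y : ι → Matrix (ZMod n) (ZMod n) B[X]}
    (hY : ∀ i, IsTwisted τ (Y i)) :
    (wden L Y).map τ = wden L Y ∧ HasDeg (0 : ZMod n) (wden L Y) := by
  induction L with
  | nil => exact ⟨by simp [wden], HasDeg.one⟩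
  | cons x L ih =>
    rw [wden_cons]
    obtain ⟨i, b⟩ := x
    cases b
    · refine ⟨by rw [Polynomial.map_mul, ih.1]; exact congrArg (· * _) (hY i).map_det, ?_⟩
      have := (hY i).hasDeg_det.mul ih.2
      rwa [add_zero] at this
    · simpa using ih

theorem det_ne_zero [IsDomain B] (hτ : Function.Injective τ) (hM : IsTwisted τ M) (h0 : M ≠ 0) :
    M.det ≠ 0 := by
  have hex : ∃ k, ∃ i j, (M i j).coeff k ≠ 0 := by
    by_contra! H
    exact h0 (by ext i j k; simp [H])
  classical
  obtain ⟨k, ⟨i0, j0, hk⟩, hmin⟩ : ∃ k, (∃ i j, (M i j).coeff k ≠ 0) ∧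
      ∀ l < k, ∀ i j, (M i j).coeff l = 0 :=
    ⟨Nat.find hex, Nat.find_spec hex, fun l hl i j => by
      by_contra h; exact Nat.find_min hex hl ⟨i, j, h⟩⟩
  have hdvd : ∀ i j, ∃ r, M i j = X ^ k * r := fun i j =>
    X_pow_dvd_iff.2 fun d hd => hmin d hd i j
  choose M' hM' using hdvd
  have e1 : M = (X ^ k : B[X]) • (Matrix.of M') := by
    ext1 i j
    rw [Matrix.smul_apply, of_apply, smul_eq_mul, hM']
  have hc : ∀ i j, (M' i j).coeff 0 = (M i j).coeff k := fun i j => by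
    rw [hM', coeff_X_pow_mul', if_pos le_rfl, Nat.sub_self]
  have hshift : ∀ i j, (M (i + 1) (j + 1)).coeff k = τ ((M i j).coeff k) := fun i j => by
    have := congrFun (congrFun hM.shift i) j
    rw [submatrix_apply, RingHom.mapMatrix_apply, map_apply] at this
    rw [← coeff_map]
    exact congrArg (fun p => coeff p k) this
  have hzero : ∀ i j : ZMod n, i - j ≠ (k : ZMod n) → (M i j).coeff k = 0 := fun i j hij => by
    by_contra h; exact hij (hM.hasDeg i j k h).symm
  rw [e1, det_smul]
  refine mul_ne_zero (pow_ne_zero _ (pow_ne_zero _ X_ne_zero)) fun hdet => ?_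
  have h1 := congrArg (constantCoeff (R := B)) hdet
  rw [map_zero, RingHom.map_det] at h1
  have h2 : ((constantCoeff (R := B)).mapMatrix (Matrix.of M')).submatrix
      (Equiv.addRight (k : ZMod n)) id = diagonal fun j => (M (j + k) j).coeff k := by
    ext i j
    rw [submatrix_apply, RingHom.mapMatrix_apply, map_apply, of_apply, constantCoeff_apply, hc,
      diagonal_apply]
    split_ifs with h
    · subst h; rfl
    · refine hzero _ _ fun h' => h ?_
      rw [Equiv.coe_addRight, id] at h'
      linear_combination h'
  have h3 := det_permute (Equiv.addRight (k : ZMod n))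
      ((constantCoeff (R := B)).mapMatrix (Matrix.of M'))
  rw [h1, mul_zero, h2, det_diagonal, Finset.prod_eq_zero_iff] at h3
  obtain ⟨j, -, hj⟩ := h3
  have hall : ∀ t : ℕ, (M (j0 + t + k) (j0 + t)).coeff k ≠ 0 := fun t => by
    induction t with
    | zero =>
      have : i0 = j0 + k := by
        by_contra h
        exact hk (hzero _ _ fun h' => h (by linear_combination h'))
      simpa [this] using hk
    | succ t ih =>
      rw [Nat.cast_succ, show j0 + ((t : ZMod n) + 1) + k = j0 + t + k + 1 by ring, ← add_assoc,
        hshift]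
      exact fun h => ih (hτ (h.trans (map_zero τ).symm))
  refine hall (j - j0).val ?_
  rw [ZMod.natCast_zmod_val, add_sub_cancel]
  exact hj

end IsTwisted

end Twisted

section NoEigenvalueOne

open Polynomial

/-- A word which is nontrivial on `GL n` takes values without eigenvalue one. -/
theorem exists_det_sub_one_ne_zero_zmod {n : ℕ} [NeZero n] {ι : Type} (L : List (ι × Bool))
    {F : Type} [Field F] {E : Type} [Field E] [Algebra F E] (y : ι → GL (ZMod n) E)
    (hy : FreeGroup.lift y (FreeGroup.mk L) ≠ 1) :
    ∃ (E' : Type) (_ : Field E') (_ : Algebra F E') (y' : ι → GL (ZMod n) E'),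
      ((FreeGroup.lift y' (FreeGroup.mk L) : Matrix (ZMod n) (ZMod n) E') - 1).det ≠ 0 := by
  let B := MvPolynomial (ι × ZMod n × ZMod n) F
  let s : ι × ZMod n × ZMod n → ι × ZMod n × ZMod n := fun x => (x.1, x.2.1 + 1, x.2.2 + 1)
  have hs : Function.Injective s := fun x x' h => by
    simpa [s, Prod.ext_iff] using h
  let τ : B →+* B := (MvPolynomial.rename s).toRingHom
  have hτ : Function.Injective τ := MvPolynomial.rename_injective s hs
  let Y : ι → Matrix (ZMod n) (ZMod n) B[X] := fun i => Matrix.of fun r c =>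
    C (MvPolynomial.X (i, r, c)) * X ^ (r - c).val
  have hY : ∀ i, IsTwisted τ (Y i) := fun i =>
    { shift := by
        ext1 r c
        change C (MvPolynomial.X (i, r + 1, c + 1)) * X ^ (r + 1 - (c + 1)).val =
          (C (MvPolynomial.X (i, r, c)) * X ^ (r - c).val : B[X]).map τ
        rw [Polynomial.map_mul, Polynomial.map_pow, map_X, map_C, add_sub_add_right_eq_sub]
        congr 2
        exact (MvPolynomial.rename_X (R := F) s (i, r, c)).symm
      hasDeg := fun r c k hk => by
        change coeff (C (MvPolynomial.X (i, r, c)) * X ^ (r - c).val : B[X]) k ≠ 0 at hk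
        rw [coeff_C_mul_X_pow] at hk
        obtain rfl : k = (r - c).val := by by_contra h; simp [h] at hk
        exact ZMod.natCast_zmod_val _ }
  let φ : B[X] →+* E := eval₂RingHom
    (MvPolynomial.aeval fun x : ι × ZMod n × ZMod n =>
      (y x.1 : Matrix _ _ E) x.2.1 x.2.2 : B →ₐ[F] E).toRingHom 1
  have hφ : ∀ i, φ.mapMatrix (Y i) = (y i : Matrix _ _ E) := fun i => by
    ext r c
    change φ (C (MvPolynomial.X (i, r, c)) * X ^ (r - c).val) = _
    simp only [φ, coe_eval₂RingHom, eval₂_mul, eval₂_C, eval₂_pow, eval₂_X, one_pow, mul_one]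
    exact MvPolynomial.aeval_X _ _
  have hYd : ∀ i, (Y i).det ≠ 0 := fun i =>
    (hY i).det_ne_zero hτ fun h => by
      have := hφ i
      rw [h, map_zero] at this
      exact (y i).isUnit.ne_zero this.symm
  have hW : (wnum L Y - wden L Y • 1).det ≠ 0 := by
    refine IsTwisted.det_ne_zero hτ ((IsTwisted.wnum L hY).sub
      (IsTwisted.smul_one (IsTwisted.map_wden L hY).1 (IsTwisted.map_wden L hY).2)) fun h => hy ?_
    have h1 := congrArg φ.mapMatrix h
    have h2 : φ.mapMatrix (wden L Y • 1) = φ (wden L Y) • (1 : Matrix (ZMod n) (ZMod n) E) := by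
      ext i j
      simp [Matrix.one_apply, apply_ite φ]
    rw [map_sub, h2, ← wnum_map, ← wden_map, map_zero] at h1
    simp only [hφ] at h1
    rw [wnum_coe, ← smul_sub] at h1
    exact Units.ext (sub_eq_zero.1 ((smul_eq_zero.1 h1).resolve_left (isUnit_wden L y).ne_zero))
  let ψ : B[X] →+* FractionRing B[X] := algebraMap _ _
  have hψ : Function.Injective ψ := IsFractionRing.injective _ _
  let y' : ι → GL (ZMod n) (FractionRing B[X]) := fun i =>
    Matrix.GeneralLinearGroup.mkOfDetNeZero (ψ.mapMatrix (Y i)) (by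
      rw [← RingHom.map_det]
      exact fun h => hYd i (hψ (h.trans (map_zero ψ).symm)))
  have hy' : (fun i => (y' i : Matrix _ _ (FractionRing B[X]))) = fun i => ψ.mapMatrix (Y i) := rfl
  refine ⟨FractionRing B[X], inferInstance, inferInstance, y', fun h => hW (hψ ?_)⟩
  have h3 : ψ.mapMatrix (wden L Y • 1) = ψ (wden L Y) • (1 : Matrix (ZMod n) (ZMod n) _) := by
    ext i j
    simp [Matrix.one_apply, apply_ite ψ]
  have h4 : ψ.mapMatrix (wnum L Y) = ψ (wden L Y) •
      (FreeGroup.lift y' (FreeGroup.mk L) : Matrix _ _ (FractionRing B[X])) := by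
    rw [← wnum_map, ← wden_map, ← hy', wnum_coe]
  rw [map_zero, RingHom.map_det, map_sub, h3, h4, ← smul_sub, det_smul, h, mul_zero]

end NoEigenvalueOne

end SLWord

namespace SLWord

open scoped MatrixGroups commutatorElement
open Module Matrix

section PingPong

variable {ι S : Type*} [CommRing S]

/-- A multiple of a matrix with eigenlines spanned by `(1, α x)` and `(1, α x')`, where `x'` is the
letter inverse to `x`. -/
def ppMat (α : ι × Bool → S) (s : S) (x : ι × Bool) : Matrix (Fin 2) (Fin 2) S :=
  !![s ^ 2 * α x - α (x.1, !x.2), 1 - s ^ 2;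
    (s ^ 2 - 1) * (α x * α (x.1, !x.2)), α x - s ^ 2 * α (x.1, !x.2)]

lemma ppMat_map {S' : Type*} [CommRing S'] (f : S →+* S') (α : ι × Bool → S) (s : S)
    (x : ι × Bool) : f.mapMatrix (ppMat α s x) = ppMat (f ∘ α) (f s) x := by
  ext i j
  fin_cases i <;> fin_cases j <;> simp [ppMat]

lemma prod_ppMat_zero [IsDomain S] {α : ι × Bool → S} (hα : Function.Injective α)
    (L : List (ι × Bool)) (x : ι × Bool) (hL : FreeGroup.IsReduced (x :: L)) :
    ∃ c r : S, c ≠ 0 ∧ ((x :: L).map (ppMat α 0)).prod = !![c * r, c; α x * (c * r), α x * c] := by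
  induction L generalizing x with
  | nil =>
    refine ⟨1, -α (x.1, !x.2), one_ne_zero, ?_⟩
    ext i j
    fin_cases i <;> fin_cases j <;> simp [ppMat]
  | cons x' L ih =>
    obtain ⟨c, r, hc, h⟩ := ih x' hL.tail
    refine ⟨(α x' - α (x.1, !x.2)) * c, r, mul_ne_zero (fun h0 => ?_) hc, ?_⟩
    · have h1 := hα (sub_eq_zero.1 h0)
      have h2 := (FreeGroup.isReduced_cons_cons.1 hL).1 (by rw [h1])
      rw [h1] at h2
      simp at h2
    · rw [List.map_cons, List.prod_cons, h]
      ext i j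
      fin_cases i <;> fin_cases j <;> simp [ppMat, Matrix.mul_apply, Fin.sum_univ_two] <;> ring

lemma exists_commutator_ppMat {E : Type*} [Field E] (α : ι × Bool → E) (hα : Function.Injective α)
    {s : E} (hs : s ≠ 0) (i : ι) : ∃ a b : GL (Fin 2) E, ∀ c : Bool,
      ppMat α s (i, c) = ((α (i, c) - α (i, !c)) * s) •
        (cond c ⁅a, b⁆ ⁅a, b⁆⁻¹ : GL (Fin 2) E).1 := by
  have hne : α (i, false) - α (i, true) ≠ 0 := fun h => by
    simpa using hα (sub_eq_zero.1 h)
  let P : GL (Fin 2) E := GeneralLinearGroup.mkOfDetNeZero !![1, 1; α (i, true), α (i, false)]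
    (by rw [det_fin_two_of]; simpa using hne)
  let a : GL (Fin 2) E := GeneralLinearGroup.mkOfDetNeZero !![s⁻¹, 0; 0, 1]
    (by rw [det_fin_two_of]; simpa using hs)
  let b : GL (Fin 2) E := GeneralLinearGroup.mkOfDetNeZero !![0, 1; 1, 0]
    (by rw [det_fin_two_of]; simp)
  let D : GL (Fin 2) E := GeneralLinearGroup.mkOfDetNeZero !![s⁻¹, 0; 0, s]
    (by rw [det_fin_two_of]; simpa using hs)
  have hD : ⁅a, b⁆ = D := by
    rw [commutatorElement_def, mul_inv_eq_iff_eq_mul, mul_inv_eq_iff_eq_mul]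
    ext i j
    fin_cases i <;> fin_cases j <;>
      simp [a, b, D, GeneralLinearGroup.mkOfDetNeZero, Matrix.mul_apply, Fin.sum_univ_two, hs]
  have hc : ⁅P * a * P⁻¹, P * b * P⁻¹⁆ = P * D * P⁻¹ := by
    rw [← hD, conjugate_commutatorElement]
  refine ⟨P * a * P⁻¹, P * b * P⁻¹, fun c => ?_⟩
  rw [hc]
  have key : ∀ (T : Matrix (Fin 2) (Fin 2) E) (k : E) (A : GL (Fin 2) E),
      T * P.1 = k • (P * A).1 → T = k • (P * A * P⁻¹).1 := fun T k A h => by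
    rw [Units.val_mul (P * A), ← Matrix.smul_mul, ← h, Matrix.mul_assoc, ← Units.val_mul,
      mul_inv_cancel, Units.val_one, Matrix.mul_one]
  have key' : ∀ (T : Matrix (Fin 2) (Fin 2) E) (k : E) (A : GL (Fin 2) E),
      T * (P * A).1 = k • P.1 → T = k • (P * A * P⁻¹)⁻¹.1 := fun T k A h => by
    rw [_root_.mul_inv_rev, _root_.inv_inv, Units.val_mul P, ← Matrix.smul_mul, ← h,
      Matrix.mul_assoc,
      ← Units.val_mul, mul_inv_cancel, Units.val_one, Matrix.mul_one]
  cases c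
  · refine key' _ _ _ ?_
    ext i j
    fin_cases i <;> fin_cases j <;>
      simp [ppMat, P, D, GeneralLinearGroup.mkOfDetNeZero, Matrix.mul_apply, Fin.sum_univ_two] <;>
      field_simp <;> ring
  · refine key _ _ _ ?_
    ext i j
    fin_cases i <;> fin_cases j <;>
      simp [ppMat, P, D, GeneralLinearGroup.mkOfDetNeZero, Matrix.mul_apply, Fin.sum_univ_two] <;>
      field_simp <;> ring

/-- A nontrivial word in commutators takes values in `GL 2` with a nonzero off-diagonal entry. -/
theorem exists_lift_commutator_apply_ne_zero {ι : Type} {w : FreeGroup ι} (hw : w ≠ 1) (F : Type)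
    [Field F] : ∃ (E : Type) (_ : Field E) (_ : Algebra F E) (a b : ι → GL (Fin 2) E),
      (FreeGroup.lift (fun i => ⁅a i, b i⁆) w : Matrix (Fin 2) (Fin 2) E) 0 1 ≠ 0 := by
  classical
  let B := MvPolynomial (ι × Bool) F
  let R := Polynomial B
  let E := FractionRing R
  let α : ι × Bool → R := fun x => Polynomial.C (MvPolynomial.X x)
  let ψ : R →+* E := algebraMap _ _
  have hψ : Function.Injective ψ := IsFractionRing.injective _ _
  have hα : Function.Injective (ψ ∘ α) :=
    hψ.comp (Polynomial.C_injective.comp (MvPolynomial.X_injective))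
  choose a b hab using exists_commutator_ppMat (ψ ∘ α) hα (s := ψ Polynomial.X)
    (fun h => Polynomial.X_ne_zero (hψ (h.trans (map_zero ψ).symm)))
  refine ⟨E, inferInstance, inferInstance, a, b, fun h => ?_⟩
  have hprod : ∀ L : List (ι × Bool), ∃ c : E, (L.map (ppMat (ψ ∘ α) (ψ Polynomial.X))).prod =
      c • (FreeGroup.lift (fun i => ⁅a i, b i⁆) (FreeGroup.mk L) : Matrix (Fin 2) (Fin 2) E) :=
    fun L => by
    induction L with
    | nil => exact ⟨1, by rw [one_smul, ← FreeGroup.one_eq_mk, map_one]; rfl⟩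
    | cons x L ih =>
      obtain ⟨c, hc⟩ := ih
      refine ⟨((ψ ∘ α) (x.1, x.2) - (ψ ∘ α) (x.1, !x.2)) * ψ Polynomial.X * c, ?_⟩
      rw [List.map_cons, List.prod_cons, hc, hab x.1 x.2, Matrix.smul_mul, Matrix.mul_smul,
        smul_smul, ← Units.val_mul, FreeGroup.lift_mk, FreeGroup.lift_mk, List.map_cons,
        List.prod_cons]
  obtain ⟨c, hc⟩ := hprod w.toWord
  rw [FreeGroup.mk_toWord] at hc
  have h1 : ((w.toWord.map (ppMat α Polynomial.X)).prod) 0 1 = 0 := by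
    refine hψ ?_
    have h2 : ψ.mapMatrix (w.toWord.map (ppMat α Polynomial.X)).prod =
        (w.toWord.map (ppMat (ψ ∘ α) (ψ Polynomial.X))).prod := by
      rw [map_list_prod, List.map_map]
      congr 2
      funext x
      exact ppMat_map _ _ _ _
    have h3 := congrFun (congrFun (h2.trans hc) 0) 1
    rw [Matrix.smul_apply, h, smul_zero] at h3
    rw [map_zero]
    exact h3
  obtain ⟨x, L, hL⟩ := List.exists_cons_of_ne_nil (fun h0 => hw (FreeGroup.toWord_eq_nil_iff.1 h0))
  obtain ⟨c', r, hc', hp⟩ := prod_ppMat_zero (S := B) (α := MvPolynomial.X)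
    MvPolynomial.X_injective L x (hL ▸ FreeGroup.isReduced_toWord)
  let ε : R →+* B := Polynomial.evalRingHom 0
  have h4 : ε.mapMatrix (w.toWord.map (ppMat α Polynomial.X)).prod =
      (w.toWord.map (ppMat (S := B) MvPolynomial.X 0)).prod := by
    rw [map_list_prod, List.map_map]
    congr 2
    funext x
    refine (ppMat_map _ _ _ _).trans ?_
    congr 1
    · funext y; exact Polynomial.eval_C
    · exact Polynomial.eval_X
  rw [hL, hp, ← hL] at h4
  have h5 := congrFun (congrFun h4 0) 1
  rw [RingHom.mapMatrix_apply, Matrix.map_apply, h1, map_zero] at h5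
  exact hc' h5.symm

end PingPong

end SLWord

namespace SLWord

open scoped MatrixGroups
open Module Matrix

lemma pow_mul_coeff_charpoly_smul {κ R : Type*} [Fintype κ] [DecidableEq κ] [CommRing R] (c : R)
    (A : Matrix κ κ R) (k : ℕ) :
    c ^ k * (c • A).charpoly.coeff k = c ^ Fintype.card κ * A.charpoly.coeff k := by
  have h : (Polynomial.compRingHom (Polynomial.C c * Polynomial.X)).mapMatrix (c • A).charmatrix =
      Polynomial.C c • A.charmatrix := by
    ext1 i j
    rw [RingHom.mapMatrix_apply, Matrix.map_apply, Matrix.smul_apply, charmatrix_apply,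
      charmatrix_apply, Polynomial.coe_compRingHom_apply, diagonal_apply]
    split_ifs
    · simp [mul_sub]
    · simp
  have h2 := congrArg (fun p => Polynomial.coeff (det p) k) h
  rw [← RingHom.map_det, det_smul, ← Polynomial.C_pow, Polynomial.coeff_C_mul,
    Polynomial.coe_compRingHom_apply, Polynomial.comp_C_mul_X_coeff] at h2
  rw [mul_comm]
  exact h2

section Points

variable {κ R S : Type*} {n : ℕ} [CommRing R] [CommRing S]

/-- The coordinates on tuples of matrices together with a vector. -/
abbrev Coord (κ : Type*) (n : ℕ) : Type _ := (κ × Fin n × Fin n) ⊕ Fin n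

/-- The tuple of matrices of a point. -/
def ptMat (z : Coord κ n → R) (i : κ) : Matrix (Fin n) (Fin n) R :=
  Matrix.of fun r c => z (Sum.inl (i, r, c))

/-- The vector of a point. -/
def ptVec (z : Coord κ n → R) (r : Fin n) : R := z (Sum.inr r)

/-- The point given by invertible matrices and a vector. -/
def mkPt (y : κ → GL (Fin n) R) (v : Fin n → R) : Coord κ n → R :=
  Sum.elim (fun x => (y x.1 : Matrix (Fin n) (Fin n) R) x.2.1 x.2.2) v

lemma ptMat_mkPt (y : κ → GL (Fin n) R) (v : Fin n → R) :
    ptMat (mkPt y v) = fun i => (y i : Matrix (Fin n) (Fin n) R) := rfl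

lemma ptMat_comp (f : R →+* S) (z : Coord κ n → R) :
    ptMat (f ∘ z) = fun i => f.mapMatrix (ptMat z i) := rfl

/-- The matrix whose rows are the images of a vector under the powers of a matrix. -/
def krylov (A : Matrix (Fin n) (Fin n) R) (v : Fin n → R) : Matrix (Fin n) (Fin n) R :=
  Matrix.of fun k => (A ^ (k : ℕ)) *ᵥ v

lemma krylov_map (f : R →+* S) (A : Matrix (Fin n) (Fin n) R) (v : Fin n → R) :
    f.mapMatrix (krylov A v) = krylov (f.mapMatrix A) (f ∘ v) := by
  ext1 i j
  rw [krylov, krylov, RingHom.mapMatrix_apply, Matrix.map_apply, of_apply, of_apply,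
    RingHom.map_mulVec, ← map_pow]
  rfl

lemma det_krylov_smul (c : R) (A : Matrix (Fin n) (Fin n) R) (v : Fin n → R) :
    (krylov (c • A) v).det = (∏ k : Fin n, c ^ (k : ℕ)) * (krylov A v).det := by
  rw [← det_mul_column]
  congr 1
  ext1 i j
  simp [krylov, smul_pow, smul_mulVec]

variable (L : List (κ × Bool))

/-- The denominator of the characteristic polynomial of a word. -/
def charDen (z : Coord κ n → R) : R := wden L (ptMat z) ^ n

/-- The numerators of the characteristic polynomial of a word minus one. -/
noncomputable def charNum (k : ℕ) (z : Coord κ n → R) : R :=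
  wden L (ptMat z) ^ k * (wnum L (ptMat z) - wden L (ptMat z) • 1).charpoly.coeff k

/-- A function which vanishes unless all matrices are invertible and the vector is cyclic for the
value of the word. -/
def regDet [Fintype κ] (z : Coord κ n → R) : R :=
  (∏ i, (ptMat z i).det) * (krylov (wnum L (ptMat z)) (ptVec z)).det

lemma map_charDen (f : R →+* S) (z : Coord κ n → R) : charDen L (f ∘ z) = f (charDen L z) := by
  rw [charDen, charDen, ptMat_comp, wden_map, map_pow]

lemma map_charNum (f : R →+* S) (k : ℕ) (z : Coord κ n → R) :
    charNum L k (f ∘ z) = f (charNum L k z) := by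
  have h : f.mapMatrix (wden L (ptMat z) • (1 : Matrix (Fin n) (Fin n) R)) =
      f (wden L (ptMat z)) • 1 := by
    ext i j
    simp [Matrix.one_apply, apply_ite f]
  rw [charNum, charNum, ptMat_comp, wden_map, wnum_map, ← h, ← map_sub, RingHom.mapMatrix_apply,
    charpoly_map, Polynomial.coeff_map, map_mul, map_pow]

lemma map_regDet [Fintype κ] (f : R →+* S) (z : Coord κ n → R) :
    regDet L (f ∘ z) = f (regDet L z) := by
  rw [regDet, regDet, ptMat_comp, wnum_map, map_mul, map_prod, RingHom.map_det, krylov_map]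
  congr 1
  exact Finset.prod_congr rfl fun i _ => (f.map_det _).symm

lemma charNum_mkPt (k : ℕ) (y : κ → GL (Fin n) R) (v : Fin n → R) :
    charNum L k (mkPt y v) = charDen L (mkPt y v) *
      ((FreeGroup.lift y (FreeGroup.mk L) : Matrix (Fin n) (Fin n) R) - 1).charpoly.coeff k := by
  rw [charNum, charDen, ptMat_mkPt, wnum_coe, ← smul_sub, pow_mul_coeff_charpoly_smul,
    Fintype.card_fin]

lemma isUnit_charDen_mkPt (y : κ → GL (Fin n) R) (v : Fin n → R) :
    IsUnit (charDen L (mkPt y v)) := (isUnit_wden L y).pow n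

lemma regDet_mkPt [Fintype κ] (y : κ → GL (Fin n) R) (v : Fin n → R) :
    ∃ c, IsUnit c ∧ regDet L (mkPt y v) =
      c * (krylov (FreeGroup.lift y (FreeGroup.mk L)).1 v).det := by
  rw [regDet, ptMat_mkPt, wnum_coe, det_krylov_smul, ← mul_assoc]
  refine ⟨_, IsUnit.mul ?_ ?_, rfl⟩
  · exact IsUnit.prod_univ_iff.2 fun i => (isUnit_iff_isUnit_det _).1 (y i).isUnit
  · exact IsUnit.prod_univ_iff.2 fun i => (isUnit_wden L y).pow _

lemma exists_eq_mkPt {F : Type*} [Field F] [Fintype κ] {z : Coord κ n → F} (h : regDet L z ≠ 0) :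
    ∃ y : κ → GL (Fin n) F, z = mkPt y (ptVec z) := by
  have h1 := fun i => Finset.prod_ne_zero_iff.1 (left_ne_zero_of_mul h) i (Finset.mem_univ i)
  refine ⟨fun i => GeneralLinearGroup.mkOfDetNeZero (ptMat z i) (h1 i), ?_⟩
  funext x
  rcases x with x | x <;> rfl

/-- Clearing denominators in the value of a polynomial at a tuple of fractions. -/
noncomputable def clear {F : Type*} [CommRing F] [Algebra F R] {m : ℕ} (e : ℕ)
    (H : MvPolynomial (Fin m) F) (N : Fin m → R) (D : R) : R :=
  ∑ s ∈ H.support, algebraMap F R (H.coeff s) * ∏ k, (N k ^ s k * D ^ (e - s k))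

variable {F : Type*} [CommRing F] [Algebra F R] [Algebra F S] {m : ℕ}

lemma map_clear (f : R →ₐ[F] S) (e : ℕ) (H : MvPolynomial (Fin m) F) (N : Fin m → R) (D : R) :
    f (clear e H N D) = clear e H (f ∘ N) (f D) := by
  simp [clear, map_sum, map_mul, map_prod, map_pow]

lemma clear_mul {e : ℕ} {H : MvPolynomial (Fin m) F} (hH : ∀ s ∈ H.support, ∀ k, s k ≤ e)
    (a : Fin m → R) (D : R) :
    clear e H (fun k => D * a k) D = D ^ (e * m) * MvPolynomial.aeval a H := by
  rw [MvPolynomial.aeval_def, MvPolynomial.eval₂_eq', Finset.mul_sum, clear]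
  refine Finset.sum_congr rfl fun s hs => ?_
  have : ∀ k, (D * a k) ^ s k * D ^ (e - s k) = D ^ e * a k ^ s k := fun k => by
    rw [mul_pow, mul_right_comm, ← pow_add, Nat.add_sub_cancel' (hH s hs k)]
  simp_rw [this, Finset.prod_mul_distrib, Finset.prod_const, Finset.card_univ, Fintype.card_fin,
    ← pow_mul]
  ring

end Points

end SLWord

namespace SLWord

open scoped MatrixGroups
open Module Matrix

section EmbGL

variable {ι κ R : Type*} [Fintype ι] [DecidableEq ι] [Fintype κ] [DecidableEq κ] [CommRing R]

lemma embM_injective (f : κ ↪ ι) : Function.Injective (embM (R := R) f) := fun A B h => by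
  have key : ∀ A : Matrix κ κ R, (1 : Matrix ι ι R).submatrix f id * (embM f A - 1) *
      (1 : Matrix ι ι R).submatrix id f = A - 1 := fun A => by
    rw [embM_apply, add_sub_cancel_left, Matrix.mul_assoc, Matrix.mul_assoc,
      submatrix_one_mul_submatrix_one, Matrix.mul_one, ← Matrix.mul_assoc,
      submatrix_one_mul_submatrix_one, Matrix.one_mul]
  have := key A
  rw [h, key B] at this
  exact (sub_left_injective this).symm

/-- The embedding of general linear groups given by an embedding of index types. -/
def embGL (f : κ ↪ ι) : GL κ R →* GL ι R := Units.map (embM f)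

lemma lift_embGL {α : Type*} (f : κ ↪ ι) (y : α → GL κ R) (u : FreeGroup α) :
    FreeGroup.lift (fun i => embGL f (y i)) u = embGL f (FreeGroup.lift y u) := by
  have : FreeGroup.lift (fun i => embGL f (y i)) = (embGL f).comp (FreeGroup.lift y) := by
    ext1 i; simp
  exact DFunLike.congr_fun this u

end EmbGL

section Generic

variable {κ : Type} {L : List (κ × Bool)}

/-- A word takes a non-scalar value in `GL 2` over some extension of every field. -/
def IsNonscalar (L : List (κ × Bool)) : Prop := ∀ (F : Type) [Field F],
  ∃ (E : Type) (_ : Field E) (_ : Algebra F E) (y : κ → GL (Fin 2) E),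
    (FreeGroup.lift y (FreeGroup.mk L) : Matrix (Fin 2) (Fin 2) E) 0 1 ≠ 0

theorem IsNonscalar.exists_det_sub_one_ne_zero (hL : IsNonscalar L) {n : ℕ} (hn : 2 ≤ n)
    (F : Type) [Field F] : ∃ (E : Type) (_ : Field E) (_ : Algebra F E) (y : κ → GL (Fin n) E),
      ((FreeGroup.lift y (FreeGroup.mk L) : Matrix (Fin n) (Fin n) E) - 1).det ≠ 0 := by
  obtain ⟨E, _, _, y, hy⟩ := hL F
  obtain ⟨m, rfl⟩ : ∃ m, n = m + 1 := ⟨n - 1, by omega⟩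
  refine exists_det_sub_one_ne_zero_zmod (n := m + 1) L
    (fun i => embGL (Fin.castLEEmb hn) (y i)) fun h => hy ?_
  have h1 : embGL (Fin.castLEEmb hn) (FreeGroup.lift y (FreeGroup.mk L)) = 1 :=
    (lift_embGL _ _ _).symm.trans h
  have h2 : (FreeGroup.lift y (FreeGroup.mk L)).1 = 1 :=
    embM_injective (Fin.castLEEmb hn) ((congrArg Units.val h1).trans (map_one _).symm)
  rw [h2]
  rfl

variable {n m : ℕ} {E : Type*} [Field E]

/-- The lower coefficients of the characteristic polynomial of a word value minus one. -/
noncomputable def charCoeff (L : List (κ × Bool)) (y : κ → GL (Fin n) E) (k : Fin m) : E :=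
  ((FreeGroup.lift y (FreeGroup.mk L) : Matrix (Fin n) (Fin n) E) - 1).charpoly.coeff k

/-- A polynomial in the coefficients of the characteristic polynomial of a word, with denominators
cleared, as a polynomial in the coordinates. -/
noncomputable def clearPoly {F : Type*} [CommRing F] (L : List (κ × Bool)) (n e : ℕ)
    (H : MvPolynomial (Fin m) F) : MvPolynomial (Coord κ n) F :=
  clear e H (fun k => charNum L k MvPolynomial.X) (charDen L MvPolynomial.X)

lemma aeval_clearPoly {F : Type*} [Field F] [Algebra F E] {e : ℕ} {H : MvPolynomial (Fin m) F}
    (hH : ∀ s ∈ H.support, ∀ k, s k ≤ e) (y : κ → GL (Fin n) E) (v : Fin n → E) :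
    MvPolynomial.aeval (mkPt y v) (clearPoly L n e H) =
      charDen L (mkPt y v) ^ (e * m) * MvPolynomial.aeval (charCoeff L y) H := by
  have hX : ⇑(MvPolynomial.aeval (R := F) (mkPt y v)).toRingHom ∘ MvPolynomial.X = mkPt y v :=
    funext fun x => MvPolynomial.aeval_X _ x
  rw [clearPoly, map_clear, ← clear_mul hH]
  congr 1
  · funext k
    have := map_charNum L (MvPolynomial.aeval (R := F) (mkPt y v)).toRingHom k MvPolynomial.X
    rw [hX, charNum_mkPt] at this
    exact this.symm
  · have := map_charDen L (MvPolynomial.aeval (R := F) (mkPt y v)).toRingHom MvPolynomial.X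
    rw [hX] at this
    exact this.symm

lemma aeval_regDet {F : Type*} [Field F] [Algebra F E] [Fintype κ] (z : Coord κ n → E) :
    MvPolynomial.aeval z (regDet L (MvPolynomial.X : _ → MvPolynomial (Coord κ n) F)) =
      regDet L z := by
  have hX : ⇑(MvPolynomial.aeval (R := F) z).toRingHom ∘ MvPolynomial.X = z :=
    funext fun x => MvPolynomial.aeval_X _ x
  have := (map_regDet L (MvPolynomial.aeval (R := F) z).toRingHom MvPolynomial.X).symm
  rwa [hX] at this

variable (κ n) in
/-- The field of rational functions in the coordinates. -/
abbrev GenField (F : Type) [Field F] : Type := FractionRing (MvPolynomial (Coord κ n) F)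

variable {F : Type} [Field F]

/-- The coordinates as rational functions. -/
noncomputable def genPt : Coord κ n → GenField κ n F :=
  fun x => algebraMap (MvPolynomial (Coord κ n) F) _ (MvPolynomial.X x)

lemma aeval_genPt_ne_zero {P : MvPolynomial (Coord κ n) F} (hP : P ≠ 0) :
    MvPolynomial.aeval (genPt (κ := κ) (n := n) (F := F)) P ≠ 0 := by
  have : MvPolynomial.aeval (genPt (κ := κ) (n := n) (F := F)) P =
      algebraMap (MvPolynomial (Coord κ n) F) (GenField κ n F) P := by
    have h : MvPolynomial.aeval (genPt (κ := κ) (n := n) (F := F)) =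
        IsScalarTower.toAlgHom F (MvPolynomial (Coord κ n) F) (GenField κ n F) := by
      ext x
      simp [genPt]
    rw [h]
    rfl
  rw [this]
  exact fun h => hP (IsFractionRing.injective (MvPolynomial (Coord κ n) F) (GenField κ n F)
    (h.trans (map_zero _).symm))

lemma det_ptMat_genPt_ne_zero (i : κ) : (ptMat (genPt (κ := κ) (n := n) (F := F)) i).det ≠ 0 := by
  have h : (ptMat (MvPolynomial.X : _ → MvPolynomial (Coord κ n) F) i).det ≠ 0 := fun h => by
    have h1 := congrArg (MvPolynomial.aeval (mkPt (fun _ : κ => (1 : GL (Fin n) F)) 0)) h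
    rw [AlgHom.map_det, map_zero] at h1
    have h2 : (MvPolynomial.aeval (mkPt (fun _ : κ => (1 : GL (Fin n) F)) 0)).mapMatrix
        (ptMat (MvPolynomial.X : _ → MvPolynomial (Coord κ n) F) i) = 1 := by
      ext r c
      simp [ptMat, mkPt]
    rw [h2, det_one] at h1
    exact one_ne_zero h1
  refine fun h0 => h (IsFractionRing.injective (MvPolynomial (Coord κ n) F) (GenField κ n F) ?_)
  rw [RingHom.map_det, map_zero]
  exact h0

/-- The generic tuple of invertible matrices. -/
noncomputable def genGL (i : κ) : GL (Fin n) (GenField κ n F) :=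
  GeneralLinearGroup.mkOfDetNeZero _ (det_ptMat_genPt_ne_zero i)

/-- The generic vector. -/
noncomputable def genVec : Fin n → GenField κ n F := ptVec (κ := κ) genPt

lemma mkPt_gen : mkPt genGL genVec = (genPt : Coord κ n → GenField κ n F) := by
  funext x
  rcases x with x | x <;> rfl

lemma exists_bound {σ R : Type*} [CommSemiring R] (H : MvPolynomial σ R) :
    ∃ e, ∀ s ∈ H.support, ∀ k, s k ≤ e :=
  ⟨H.totalDegree, fun _ hs k => (MvPolynomial.le_degreeOf_of_mem_support k hs).trans
    (MvPolynomial.degreeOf_le_totalDegree H k)⟩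

lemma clearPoly_ne_zero [Algebra F E] {e : ℕ} {H : MvPolynomial (Fin m) F}
    (hH : ∀ s ∈ H.support, ∀ k, s k ≤ e) {y : κ → GL (Fin n) E}
    (h : MvPolynomial.aeval (charCoeff L y) H ≠ 0) : clearPoly L n e H ≠ 0 := fun h0 => by
  have h1 := aeval_clearPoly (L := L) hH y 0
  rw [h0, map_zero] at h1
  exact mul_ne_zero (pow_ne_zero _ (isUnit_charDen_mkPt L y 0).ne_zero) h h1.symm

lemma aeval_charCoeff_genGL_ne_zero [Algebra F E] {H : MvPolynomial (Fin m) F}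
    {y : κ → GL (Fin n) E} (h : MvPolynomial.aeval (charCoeff L y) H ≠ 0) :
    MvPolynomial.aeval (charCoeff L (genGL (κ := κ) (n := n) (F := F))) H ≠ 0 := fun h0 => by
  obtain ⟨e, he⟩ := exists_bound H
  have h1 := aeval_clearPoly (L := L) he (genGL (κ := κ) (n := n) (F := F)) genVec
  rw [h0, mul_zero, mkPt_gen] at h1
  exact aeval_genPt_ne_zero (clearPoly_ne_zero he h) h1

lemma regDet_ne_zero [Fintype κ] [Algebra F E] {y : κ → GL (Fin n) E} {v : Fin n → E}
    (h : (krylov (FreeGroup.lift y (FreeGroup.mk L)).1 v).det ≠ 0) :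
    regDet L (MvPolynomial.X : _ → MvPolynomial (Coord κ n) F) ≠ 0 := fun h0 => by
  obtain ⟨c, hc, h1⟩ := regDet_mkPt L y v
  rw [← aeval_regDet (F := F), h0, map_zero] at h1
  exact mul_ne_zero hc.ne_zero h h1.symm

lemma det_krylov_gen_ne_zero [Fintype κ] [Algebra F E] {y : κ → GL (Fin n) E} {v : Fin n → E}
    (h : (krylov (FreeGroup.lift y (FreeGroup.mk L)).1 v).det ≠ 0) :
    (krylov (FreeGroup.lift (genGL (κ := κ) (n := n) (F := F)) (FreeGroup.mk L)).1
      genVec).det ≠ 0 :=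
  fun h0 => by
  obtain ⟨c, hc, h1⟩ := regDet_mkPt L (genGL (κ := κ) (n := n) (F := F)) genVec
  rw [h0, mul_zero, mkPt_gen, ← aeval_regDet (F := F)] at h1
  exact aeval_genPt_ne_zero (regDet_ne_zero h) h1

end Generic

end SLWord

namespace SLWord

open scoped MatrixGroups
open Module Matrix

lemma charpoly_embM_succ_sub_one {R : Type*} [CommRing R] {n : ℕ} (A : Matrix (Fin n) (Fin n) R) :
    (embM (Fin.succEmb n) A - 1).charpoly = Polynomial.X * (A - 1).charpoly := by
  rw [embM_apply, add_sub_cancel_left, Matrix.mul_assoc, charpoly_mul_comm_of_le _ _ (by simp),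
    Matrix.mul_assoc, submatrix_one_mul_submatrix_one, Matrix.mul_one]
  simp

lemma embM_succ_mulVec {R : Type*} [CommRing R] {n : ℕ} (A : Matrix (Fin n) (Fin n) R) (c : R)
    (v : Fin n → R) :
    embM (Fin.succEmb n) A *ᵥ (vecCons c v) = vecCons c (A *ᵥ v) := by
  have h1 : (1 : Matrix (Fin (n + 1)) (Fin (n + 1)) R).submatrix (Fin.succEmb n) id *ᵥ
      (vecCons c v) = v := by
    ext i
    simp [mulVec, dotProduct, one_apply]
  have h2 : ∀ x : Fin n → R, (1 : Matrix (Fin (n + 1)) (Fin (n + 1)) R).submatrix id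
      (Fin.succEmb n) *ᵥ x = vecCons 0 x := fun x => by
    ext i
    refine Fin.cases ?_ (fun i => ?_) i
    · simp [mulVec, dotProduct, one_apply, (Fin.succ_ne_zero _).symm]
    · simp [mulVec, dotProduct, one_apply]
  rw [embM_apply, add_mulVec, one_mulVec, ← mulVec_mulVec, ← mulVec_mulVec, h1, h2, cons_add_cons,
    add_zero, sub_mulVec, one_mulVec, add_sub_cancel]

lemma det_krylov_embM_ne_zero {E : Type*} [Field E] {n : ℕ} {A : Matrix (Fin n) (Fin n) E}
    {v : Fin n → E} (h : (krylov A v).det ≠ 0) (h1 : (A - 1).det ≠ 0) :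
    (krylov (embM (Fin.succEmb n) A) (vecCons 1 v)).det ≠ 0 := fun h0 => by
  obtain ⟨φ, hφ, h2⟩ := exists_mulVec_eq_zero_iff.2 h0
  have hpow : ∀ k : ℕ, (embM (Fin.succEmb n) A) ^ k *ᵥ (vecCons 1 v) = vecCons 1 (A ^ k *ᵥ v) :=
    fun k => by rw [← map_pow, embM_succ_mulVec]
  have h3 : ∀ k : Fin (n + 1), φ 0 + (A ^ (k : ℕ) *ᵥ v) ⬝ᵥ (vecTail φ) = 0 := fun k => by
    have := congrFun h2 k
    change ((embM (Fin.succEmb n) A) ^ (k : ℕ) *ᵥ (vecCons 1 v)) ⬝ᵥ φ = 0 at this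
    rw [hpow, cons_dotProduct, one_mul] at this
    exact this
  have h4 : krylov A v *ᵥ ((A - 1)ᵀ *ᵥ vecTail φ) = 0 := by
    ext k
    change (A ^ (k : ℕ) *ᵥ v) ⬝ᵥ ((A - 1)ᵀ *ᵥ vecTail φ) = 0
    rw [dotProduct_mulVec, vecMul_transpose, sub_mulVec, one_mulVec, mulVec_mulVec, ← pow_succ',
      sub_dotProduct]
    have e1 := h3 k.succ
    have e2 := h3 k.castSucc
    rw [Fin.val_succ] at e1
    rw [Fin.val_castSucc] at e2
    linear_combination e1 - e2
  have h5 : (A - 1)ᵀ *ᵥ vecTail φ = 0 := by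
    by_contra hne
    exact h (exists_mulVec_eq_zero_iff.1 ⟨_, hne, h4⟩)
  have h6 : vecTail φ = 0 := by
    by_contra hne
    refine h1 ?_
    rw [← det_transpose]
    exact exists_mulVec_eq_zero_iff.1 ⟨_, hne, h5⟩
  refine hφ (funext fun i => ?_)
  refine Fin.cases ?_ (fun i => ?_) i
  · simpa [h6] using h3 0
  · exact congrFun h6 i

section

variable {κ : Type} {L : List (κ × Bool)}

lemma charCoeff_zero_ne_zero {n : ℕ} [NeZero n] {E : Type*} [Field E] {y : κ → GL (Fin n) E}
    {m : ℕ} :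
    charCoeff (m := m + 1) L y 0 ≠ 0 ↔
      ((FreeGroup.lift y (FreeGroup.mk L) : Matrix (Fin n) (Fin n) E) - 1).det ≠ 0 := by
  rw [det_eq_sign_charpoly_coeff, charCoeff]
  simp

lemma IsNonscalar.charCoeff_genGL_zero_ne_zero (hL : IsNonscalar L) {n : ℕ} (hn : 2 ≤ n)
    (F : Type) [Field F] (m : ℕ) :
    charCoeff (m := m + 1) L (genGL (κ := κ) (n := n) (F := F)) 0 ≠ 0 := by
  have : NeZero n := ⟨by omega⟩
  obtain ⟨E, _, _, y, hy⟩ := hL.exists_det_sub_one_ne_zero hn F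
  have := aeval_charCoeff_genGL_ne_zero (L := L) (y := y)
    (H := (MvPolynomial.X 0 : MvPolynomial (Fin (m + 1)) F))
    (by rw [MvPolynomial.aeval_X]; exact charCoeff_zero_ne_zero.2 hy)
  rwa [MvPolynomial.aeval_X] at this

lemma charCoeff_embGL {n m : ℕ} {E : Type*} [Field E] (y : κ → GL (Fin n) E) :
    charCoeff (m := m + 1) L (fun i => embGL (Fin.succEmb n) (y i)) =
      vecCons 0 (charCoeff L y) := by
  funext k
  rw [charCoeff, lift_embGL]
  change (embM (Fin.succEmb n) (FreeGroup.lift y (FreeGroup.mk L)).1 - 1).charpoly.coeff k = _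
  rw [charpoly_embM_succ_sub_one]
  refine Fin.cases ?_ (fun i => ?_) k
  · simp
  · rw [Fin.val_succ, Polynomial.coeff_X_mul]
    rfl

lemma aeval_eq_eval₂_finSuccEquiv {F E : Type*} [Field F] [Field E] [Algebra F E] {m : ℕ}
    (a : Fin (m + 1) → E) (H : MvPolynomial (Fin (m + 1)) F) :
    MvPolynomial.aeval a H = Polynomial.eval₂RingHom
      (MvPolynomial.aeval (R := F) (vecTail a)).toRingHom (a 0)
        (MvPolynomial.finSuccEquiv F m H) := by
  induction H using MvPolynomial.induction_on with
  | C c => simp [MvPolynomial.finSuccEquiv_apply]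
  | add p r hp hr => rw [map_add, map_add, map_add, hp, hr]
  | mul_X p i hp =>
    rw [map_mul, map_mul, map_mul, hp, MvPolynomial.aeval_X]
    congr 1
    refine Fin.cases ?_ (fun i => ?_) i
    · rw [MvPolynomial.finSuccEquiv_X_zero]; simp
    · rw [MvPolynomial.finSuccEquiv_X_succ]; simp [vecTail]

/-- The coefficients of the characteristic polynomial of the generic value of a word, other than
the determinant, are algebraically independent. -/
theorem IsNonscalar.aeval_charCoeff_ne_zero (hL : IsNonscalar L) (F : Type) [Field F] {m : ℕ}
    {H : MvPolynomial (Fin m) F} (hH : H ≠ 0) :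
    MvPolynomial.aeval (charCoeff L (genGL (κ := κ) (n := m + 1) (F := F))) H ≠ 0 := by
  induction m with
  | zero =>
    rw [MvPolynomial.eq_C_of_isEmpty H] at hH ⊢
    rw [MvPolynomial.aeval_C]
    exact fun h => hH (by rw [(map_eq_zero _).1 h, map_zero])
  | succ m ih =>
    obtain ⟨Q, hQ, hdvd⟩ := Polynomial.exists_eq_pow_rootMultiplicity_mul_and_not_dvd
      (MvPolynomial.finSuccEquiv F m H) (by simpa using hH) 0
    rw [Polynomial.dvd_iff_isRoot, Polynomial.IsRoot.def] at hdvd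
    have h1 := ih hdvd
    have h2 : MvPolynomial.aeval (charCoeff L fun i => embGL (Fin.succEmb (m + 1))
        (genGL (κ := κ) (n := m + 1) (F := F) i)) ((MvPolynomial.finSuccEquiv F m).symm Q) ≠ 0 := by
      rw [aeval_eq_eval₂_finSuccEquiv, AlgEquiv.apply_symm_apply, charCoeff_embGL,
        Polynomial.coe_eval₂RingHom, cons_val_zero, Polynomial.eval₂_at_zero]
      rw [← Polynomial.coeff_zero_eq_eval_zero] at h1
      exact h1
    have h3 := aeval_charCoeff_genGL_ne_zero h2
    rw [aeval_eq_eval₂_finSuccEquiv, AlgEquiv.apply_symm_apply] at h3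
    rw [aeval_eq_eval₂_finSuccEquiv, hQ, map_mul]
    refine mul_ne_zero ?_ h3
    rw [map_pow, Polynomial.C_0, sub_zero, Polynomial.coe_eval₂RingHom, Polynomial.eval₂_X]
    exact pow_ne_zero _ (hL.charCoeff_genGL_zero_ne_zero (by omega) F m)

/-- The generic value of a word has a cyclic vector. -/
theorem IsNonscalar.exists_det_krylov_ne_zero (hL : IsNonscalar L) [Fintype κ] {n : ℕ} (hn : 2 ≤ n)
    (F : Type) [Field F] : ∃ (E : Type) (_ : Field E) (_ : Algebra F E) (y : κ → GL (Fin n) E)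
      (v : Fin n → E), (krylov (FreeGroup.lift y (FreeGroup.mk L)).1 v).det ≠ 0 := by
  induction n, hn using Nat.le_induction with
  | base =>
    obtain ⟨E, _, _, y, hy⟩ := hL F
    refine ⟨E, inferInstance, inferInstance, y, ![0, 1], fun h => hy ?_⟩
    rw [det_fin_two] at h
    simpa [krylov, mulVec, dotProduct, Fin.sum_univ_two] using h
  | succ n hn ih =>
    have : NeZero n := ⟨by omega⟩
    obtain ⟨E, _, _, y, v, hy⟩ := ih
    refine ⟨GenField κ n F, inferInstance, inferInstance,
      fun i => embGL (Fin.succEmb n) (genGL i), vecCons 1 genVec, ?_⟩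
    rw [lift_embGL]
    exact det_krylov_embM_ne_zero (det_krylov_gen_ne_zero hy)
      (charCoeff_zero_ne_zero.1 (hL.charCoeff_genGL_zero_ne_zero hn F 0))

end

end SLWord

namespace SLWord

open scoped MatrixGroups
open Module Matrix

section Degree

open MvPolynomial

lemma totalDegree_map_le {σ R S : Type*} [CommSemiring R] [CommSemiring S] (f : R →+* S)
    (p : MvPolynomial σ R) : (map f p).totalDegree ≤ p.totalDegree :=
  Finset.sup_mono (support_map_subset f p)

lemma map_comp_X {σ R S : Type*} [CommSemiring R] [CommSemiring S] (f : R →+* S) :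
    ⇑(map f) ∘ (X : σ → MvPolynomial σ R) = X := funext fun _ => map_X f _

variable {κ : Type} [Fintype κ] (L : List (κ × Bool)) (n m : ℕ)

lemma exists_totalDegree_le : ∃ B : ℕ, ∀ (F : Type) [Field F],
    (∀ k : Fin m, (charNum L k (X : _ → MvPolynomial (Coord κ n) F)).totalDegree ≤ B) ∧
    (charDen L (X : _ → MvPolynomial (Coord κ n) F)).totalDegree ≤ B ∧
    (regDet L (X : _ → MvPolynomial (Coord κ n) F)).totalDegree ≤ B := by
  refine ⟨(∑ k : Fin m, (charNum L k (X : _ → MvPolynomial (Coord κ n) ℤ)).totalDegree) +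
    (charDen L (X : _ → MvPolynomial (Coord κ n) ℤ)).totalDegree +
    (regDet L (X : _ → MvPolynomial (Coord κ n) ℤ)).totalDegree, fun F _ => ⟨fun k => ?_, ?_, ?_⟩⟩
  · rw [← map_comp_X (Int.castRingHom F), map_charNum]
    refine (totalDegree_map_le _ _).trans ?_
    have := Finset.single_le_sum (f := fun k : Fin m =>
      (charNum L k (X : _ → MvPolynomial (Coord κ n) ℤ)).totalDegree)
      (fun _ _ => Nat.zero_le _) (Finset.mem_univ k)
    omega
  · rw [← map_comp_X (Int.castRingHom F), map_charDen]
    exact (totalDegree_map_le _ _).trans (by omega)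
  · rw [← map_comp_X (Int.castRingHom F), map_regDet]
    exact (totalDegree_map_le _ _).trans (by omega)

variable {L n m}

lemma totalDegree_clearPoly_le {F : Type} [Field F] {B e : ℕ}
    (h1 : ∀ k : Fin m, (charNum L k (X : _ → MvPolynomial (Coord κ n) F)).totalDegree ≤ B)
    (h2 : (charDen L (X : _ → MvPolynomial (Coord κ n) F)).totalDegree ≤ B)
    {H : MvPolynomial (Fin m) F} (hH : ∀ s ∈ H.support, ∀ k, s k ≤ e) :
    (clearPoly L n e H).totalDegree ≤ m * (e * B) := by
  refine totalDegree_finsetSum_le fun s hs => (totalDegree_mul _ _).trans ?_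
  rw [algebraMap_eq, totalDegree_C, zero_add]
  refine (totalDegree_finsetProd _ _).trans
    ((Finset.sum_le_card_nsmul _ _ (e * B) fun k _ => ?_).trans
    (by simp))
  refine (totalDegree_mul _ _).trans ?_
  have e1 := (totalDegree_pow (charNum L k (X : _ → MvPolynomial (Coord κ n) F)) (s k)).trans
    (Nat.mul_le_mul_left _ (h1 k))
  have e2 := (totalDegree_pow (charDen L (X : _ → MvPolynomial (Coord κ n) F)) (e - s k)).trans
    (Nat.mul_le_mul_left _ h2)
  have e3 := hH s hs k
  calc _ ≤ s k * B + (e - s k) * B := add_le_add e1 e2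
    _ = e * B := by rw [← add_mul, Nat.add_sub_cancel' e3]

lemma exists_polynomial_vanishing {F : Type*} [Field F] {m e : ℕ} (S : Finset (Fin m → F))
    (hS : S.card < (e + 1) ^ m) : ∃ H : MvPolynomial (Fin m) F, H ≠ 0 ∧
      (∀ s ∈ H.support, ∀ k, s k ≤ e) ∧ ∀ a ∈ S, eval a H = 0 := by
  classical
  let toExp : (Fin m → Fin (e + 1)) → (Fin m →₀ ℕ) := fun f =>
    Finsupp.equivFunOnFinite.symm fun k => (f k : ℕ)
  have hinj : Function.Injective toExp := fun f g h => by
    funext k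
    exact Fin.ext (DFunLike.congr_fun h k)
  let P : ((Fin m → Fin (e + 1)) → F) →ₗ[F] MvPolynomial (Fin m) F :=
    Fintype.linearCombination F fun f => monomial (toExp f) (1 : F)
  have hP : ∀ c, P c = ∑ f, monomial (toExp f) (c f) := fun c => by
    simp [P, Fintype.linearCombination_apply, smul_monomial]
  have hcoeff : ∀ c f, (P c).coeff (toExp f) = c f := fun c f => by
    rw [hP, coeff_sum, Finset.sum_eq_single f]
    · rw [coeff_monomial, if_pos rfl]
    · intro g _ hg
      rw [coeff_monomial, if_neg fun h => hg (hinj h)]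
    · simp
  let T : ((Fin m → Fin (e + 1)) → F) →ₗ[F] (S → F) :=
    LinearMap.pi fun a => (aeval (R := F) a.1).toLinearMap ∘ₗ P
  have hker := LinearMap.ker_ne_bot_of_finrank_lt (f := T) (by simpa using hS)
  obtain ⟨c, hc, hc0⟩ := Submodule.exists_mem_ne_zero_of_ne_bot hker
  refine ⟨P c, fun h => hc0 (funext fun f => ?_), fun s hs k => ?_, fun a ha => ?_⟩
  · rw [← hcoeff c f, h, coeff_zero]; rfl
  · rw [hP] at hs
    obtain ⟨f, -, hf⟩ := Finset.mem_biUnion.1 (support_sum hs)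
    have := support_monomial_subset hf
    rw [Finset.mem_singleton] at this
    rw [this]
    exact Nat.lt_succ_iff.1 (f k).2
  · exact congrFun (LinearMap.mem_ker.1 hc) ⟨a, ha⟩

/-- The regular values of a word have many characteristic polynomials. -/
theorem IsNonscalar.exists_card_charCoeff (hL : IsNonscalar L) (hm : m ≠ 0) : ∃ K : ℕ, K ≠ 0 ∧
    ∀ (F : Type) [Field F] [Fintype F] (e : ℕ), K * (e + 1) ≤ Fintype.card F →
      ∀ S : Finset (Fin m → F), (∀ (y : κ → GL (Fin (m + 1)) F) (v : Fin (m + 1) → F),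
        (krylov (FreeGroup.lift y (FreeGroup.mk L)).1 v).det ≠ 0 → charCoeff L y ∈ S) →
      (e + 1) ^ m ≤ S.card := by
  obtain ⟨B, hB⟩ := exists_totalDegree_le L (m + 1) m
  refine ⟨(m + 1) * (B + 1), by positivity, fun F _ _ e he S hS => ?_⟩
  by_contra! hlt
  obtain ⟨H, hH0, hHe, hHS⟩ := exists_polynomial_vanishing S hlt
  obtain ⟨h1, h2, h3⟩ := hB F
  obtain ⟨E, _, _, y, v, hyv⟩ := hL.exists_det_krylov_ne_zero (n := m + 1) (by omega) F
  have hne : regDet L (X : _ → MvPolynomial (Coord κ (m + 1)) F) * clearPoly L (m + 1) e H ≠ 0 :=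
    mul_ne_zero (regDet_ne_zero hyv) (clearPoly_ne_zero hHe (hL.aeval_charCoeff_ne_zero F hH0))
  refine hne (eq_zero_of_eval_eq_zero _ _ _ (fun z => ?_) ?_)
  · rw [map_mul]
    by_cases hz : regDet L z = 0
    · have : eval z (regDet L (X : _ → MvPolynomial (Coord κ (m + 1)) F)) = regDet L z :=
        aeval_regDet z
      rw [this, hz, zero_mul]
    · obtain ⟨y, hy⟩ := exists_eq_mkPt L hz
      have hmem : charCoeff L y ∈ S := by
        refine hS y (ptVec z) fun h0 => hz ?_
        obtain ⟨c, -, hc⟩ := regDet_mkPt L y (ptVec z)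
        rw [hy, hc, h0, mul_zero]
      have : eval z (clearPoly L (m + 1) e H) = 0 := by
        have := aeval_clearPoly (L := L) hHe y (ptVec z)
        rw [← hy] at this
        refine this.trans ?_
        rw [show aeval (charCoeff L y) H = 0 from hHS _ hmem, mul_zero]
      rw [this, mul_zero]
  · rw [mem_restrictDegree]
    intro s hs i
    refine (le_degreeOf_of_mem_support i hs).trans ((degreeOf_le_totalDegree _ _).trans
        ((totalDegree_mul _ _).trans ?_))
    have h4 := totalDegree_clearPoly_le h1 h2 hHe
    have h5 : B + m * (e * B) + 1 ≤ (m + 1) * (B + 1) * (e + 1) := by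
        nlinarith [Nat.zero_le (m * e), Nat.zero_le (m * B), Nat.zero_le (e * B),
          Nat.zero_le (m * e * B)]
    omega

end Degree

end SLWord

namespace SLWord

open scoped MatrixGroups commutatorElement
open Module Matrix

section Commutators

variable {d : ℕ}

/-- A word evaluated at commutators of free variables. -/
def commWord (w : FreeGroup (Fin d)) : FreeGroup (Fin d × Bool) :=
  FreeGroup.lift (fun i => ⁅FreeGroup.of (i, true), FreeGroup.of (i, false)⁆) w

lemma lift_commWord {G : Type*} [Group G] (y : Fin d × Bool → G) (w : FreeGroup (Fin d)) :
    FreeGroup.lift y (commWord w) = FreeGroup.lift (fun i => ⁅y (i, true), y (i, false)⁆) w := by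
  have : (FreeGroup.lift y).comp
      (FreeGroup.lift fun i => ⁅FreeGroup.of (i, true), FreeGroup.of (i, false)⁆) =
      FreeGroup.lift fun i : Fin d => ⁅y (i, true), y (i, false)⁆ := by
    ext1 i
    simp [map_commutatorElement]
  exact DFunLike.congr_fun this w

lemma isNonscalar_commWord {w : FreeGroup (Fin d)} (hw : w ≠ 1) :
    IsNonscalar (commWord w).toWord := fun F _ => by
  obtain ⟨E, _, _, a, b, h⟩ := exists_lift_commutator_apply_ne_zero hw F
  refine ⟨E, inferInstance, inferInstance, fun x => cond x.2 (a x.1) (b x.1), ?_⟩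
  rw [FreeGroup.mk_toWord, lift_commWord]
  exact h

lemma lift_commWord_mem {n : ℕ} {F : Type*} [Field F] (w : FreeGroup (Fin d))
    (y : Fin d × Bool → GL (Fin n) F) : FreeGroup.lift y (commWord w) ∈
      (Matrix.SpecialLinearGroup.toGL : SL(n, F) →* GL (Fin n) F) '' wordImage w SL(n, F) := by
  have hs : ∀ i, ∃ s : SL(n, F), s.toGL = ⁅y (i, true), y (i, false)⁆ := fun i => by
    have h : GeneralLinearGroup.det ⁅y (i, true), y (i, false)⁆ = 1 := by
      rw [map_commutatorElement, commutatorElement_eq_one_iff_mul_comm]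
      exact mul_comm _ _
    exact ⟨⟨(⁅y (i, true), y (i, false)⁆ : GL (Fin n) F).1, congrArg Units.val h⟩, Units.ext rfl⟩
  choose s hs using hs
  refine ⟨_, ⟨s, rfl⟩, ?_⟩
  have : (Matrix.SpecialLinearGroup.toGL : SL(n, F) →* GL (Fin n) F).comp (FreeGroup.lift s) =
      FreeGroup.lift fun i => ⁅y (i, true), y (i, false)⁆ := by
    ext1 i
    simpa using hs i
  rw [lift_commWord, ← this]
  rfl

end Commutators

section Counting

variable {n : ℕ} {F : Type*} [Field F]

lemma eq_of_conj_eq_of_mulVec_eq {A g g' : GL (Fin n) F} {v : Fin n → F}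
    (h : (krylov A.1 v).det ≠ 0) (h1 : g * A * g⁻¹ = g' * A * g'⁻¹) (h2 : g.1 *ᵥ v = g'.1 *ᵥ v) :
    g = g' := by
  obtain ⟨z, hz⟩ : ∃ z, z = g'⁻¹ * g := ⟨_, rfl⟩
  have hc : z * A = A * z := by
    have h3 : g * A = g' * A * g'⁻¹ * g := mul_inv_eq_iff_eq_mul.1 h1
    rw [hz, mul_assoc, h3]
    group
  have hv : z.1 *ᵥ v = v := by
    rw [hz, Units.val_mul, ← mulVec_mulVec, h2, mulVec_mulVec, ← Units.val_mul, inv_mul_cancel,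
      Units.val_one, one_mulVec]
  have hpow : ∀ k : ℕ, z.1 *ᵥ (A.1 ^ k *ᵥ v) = A.1 ^ k *ᵥ v := fun k => by
    have : z * A ^ k = A ^ k * z := (show Commute z A from hc).pow_right k
    have h3 := congrArg Units.val this
    rw [Units.val_mul, Units.val_mul, Units.val_pow_eq_pow_val] at h3
    rw [mulVec_mulVec, h3, ← mulVec_mulVec, hv]
  have hk : krylov A.1 v * (z.1 - 1)ᵀ = 0 := by
    ext k i
    rw [mul_apply']
    change (A.1 ^ (k : ℕ) *ᵥ v) ⬝ᵥ (z.1 - 1) i = 0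
    rw [dotProduct_comm]
    change ((z.1 - 1) *ᵥ (A.1 ^ (k : ℕ) *ᵥ v)) i = 0
    rw [sub_mulVec, hpow, one_mulVec, sub_self, Pi.zero_apply]
  have h4 : (z.1 - 1)ᵀ = 0 :=
    ((isUnit_iff_isUnit_det _).2 h.isUnit).mul_right_eq_zero.1 hk
  have h5 : z = 1 := Units.ext (sub_eq_zero.1 (transpose_eq_zero.1 h4))
  rw [h5] at hz
  exact (inv_mul_eq_one.1 hz.symm).symm

lemma card_pred_mul_card_SL_le [Fintype F] [DecidableEq F] [NeZero n] :
    (Fintype.card F - 1) * Fintype.card SL(n, F) ≤ Nat.card (GL (Fin n) F) := by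
  have hdet : ∀ c : Fˣ, ∃ D : GL (Fin n) F, D.1.det = c := fun c => by
    have : (diagonal (Function.update (fun _ : Fin n => (1 : F)) 0 c)).det = c := by
      rw [det_diagonal, Finset.prod_update_of_mem (Finset.mem_univ _)]
      simp
    exact ⟨GeneralLinearGroup.mkOfDetNeZero (diagonal (Function.update (fun _ => 1) 0 c.1))
      (by rw [this]; exact c.ne_zero), this⟩
  choose D hD using hdet
  rw [← Fintype.card_units, ← Fintype.card_prod, ← Nat.card_eq_fintype_card]
  refine Nat.card_le_card_of_injective
    (fun x : Fˣ × SL(n, F) => D x.1 * x.2.toGL) fun x x' h => ?_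
  have h1 := congrArg (fun g : GL (Fin n) F => g.1.det) h
  simp only [Units.val_mul, det_mul, hD, Matrix.SpecialLinearGroup.coe_GL_coe_matrix,
    Matrix.SpecialLinearGroup.det_coe, mul_one] at h1
  have h2 : x.1 = x'.1 := Units.ext h1
  refine Prod.ext h2 (Matrix.SpecialLinearGroup.toGL_injective ?_)
  dsimp only at h
  rw [h2] at h
  exact mul_left_cancel h

lemma lift_conj_eq {κ : Type*} {G : Type*} [Group G] (y : κ → G) (g : G) (u : FreeGroup κ) :
    FreeGroup.lift (fun i => g * y i * g⁻¹) u = g * FreeGroup.lift y u * g⁻¹ := by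
  have : FreeGroup.lift (fun i => g * y i * g⁻¹) =
      (MulAut.conj g).toMonoidHom.comp (FreeGroup.lift y) := by
    ext1 i; simp
  exact DFunLike.congr_fun this _

lemma charCoeff_conj {κ : Type} {L : List (κ × Bool)} {m : ℕ} (y : κ → GL (Fin n) F)
    (g : GL (Fin n) F) : charCoeff (m := m) L (fun i => g * y i * g⁻¹) = charCoeff L y := by
  funext k
  rw [charCoeff, charCoeff, lift_conj_eq]
  obtain ⟨A, hA⟩ : ∃ A, A = FreeGroup.lift y (FreeGroup.mk L) := ⟨_, rfl⟩
  rw [← hA]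
  have h2 : (g * A * g⁻¹ : GL (Fin n) F).1 - 1 = g.1 * (A.1 - 1) * g.1⁻¹ := by
    rw [← coe_units_inv, mul_sub, sub_mul, mul_one, ← Units.val_mul g g⁻¹, mul_inv_cancel]
    rfl
  rw [h2, charpoly_units_conj]

lemma card_mul_card_SL_le {d : ℕ} (w : FreeGroup (Fin d)) {m : ℕ} [NeZero n] [Fintype F]
    [DecidableEq F] (S : Finset (Fin m → F))
    (hS : ∀ a ∈ S, ∃ (y : Fin d × Bool → GL (Fin n) F) (v : Fin n → F),
      (krylov (FreeGroup.lift y (FreeGroup.mk (commWord w).toWord)).1 v).det ≠ 0 ∧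
        charCoeff (commWord w).toWord y = a) :
    S.card * ((Fintype.card F - 1) * Fintype.card SL(n, F)) ≤
      (wordImage w SL(n, F)).ncard * Fintype.card F ^ n := by
  obtain ⟨W, hW⟩ : ∃ W, W = (Matrix.SpecialLinearGroup.toGL : SL(n, F) →* GL (Fin n) F) ''
    wordImage w SL(n, F) := ⟨_, rfl⟩
  have hcard : W.ncard = (wordImage w SL(n, F)).ncard := by
    rw [hW, Set.ncard_image_of_injective _ Matrix.SpecialLinearGroup.toGL_injective]
  choose! y v hyv hya using hS
  have hmem : ∀ x : S × GL (Fin n) F,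
      x.2 * FreeGroup.lift (y x.1) (FreeGroup.mk (commWord w).toWord) * x.2⁻¹ ∈ W := fun x => by
    rw [← lift_conj_eq, hW, FreeGroup.mk_toWord]
    exact lift_commWord_mem w _
  have hinj : Function.Injective fun x : S × GL (Fin n) F =>
      ((⟨_, hmem x⟩, x.2.1 *ᵥ v x.1) : W × (Fin n → F)) := fun x x' h => by
    have h1 := congrArg Subtype.val (congrArg Prod.fst h)
    have h2 := congrArg Prod.snd h
    dsimp only at h1 h2
    have h3 : x.1 = x'.1 := Subtype.ext <| by
      rw [← hya x.1 x.1.2, ← hya x'.1 x'.1.2, ← charCoeff_conj (y x.1) x.2,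
        ← charCoeff_conj (y x'.1) x'.2]
      funext k
      rw [charCoeff, charCoeff, lift_conj_eq, lift_conj_eq, h1]
    rw [h3] at h1 h2
    exact Prod.ext h3 (eq_of_conj_eq_of_mulVec_eq (hyv _ x'.1.2) h1 h2)
  have h := Nat.card_le_card_of_injective _ hinj
  rw [Nat.card_prod, Nat.card_prod, Nat.card_coe_set_eq, hcard, Nat.card_fun, Nat.card_fin,
    Nat.card_eq_fintype_card, Fintype.card_coe, Nat.card_eq_fintype_card (α := F)] at h
  exact (Nat.mul_le_mul_left _ card_pred_mul_card_SL_le).trans h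

/-- Word images in special linear groups of bounded rank have positive proportion. -/
theorem exists_card_SL_le {d : ℕ} {w : FreeGroup (Fin d)} (hw : w ≠ 1) {n : ℕ} (hn : 2 ≤ n) :
    ∃ C : ℕ, ∀ (F : Type) [Field F] [Fintype F] [DecidableEq F],
      Fintype.card SL(n, F) ≤ C * (wordImage w SL(n, F)).ncard := by
  classical
  obtain ⟨m, rfl⟩ : ∃ m, n = m + 1 := ⟨n - 1, by omega⟩
  obtain ⟨K, hK0, hK⟩ := (isNonscalar_commWord hw).exists_card_charCoeff (m := m) (by omega)
  refine ⟨2 * (2 * K) ^ m + K ^ ((m + 1) * (m + 1)), fun F _ _ _ => ?_⟩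
  have hpos : 1 ≤ (wordImage w SL(m + 1, F)).ncard :=
    (Set.ncard_pos (Set.toFinite _)).2 ⟨_, fun _ => 1, rfl⟩
  have hq : 2 ≤ Fintype.card F := Fintype.one_lt_card
  rw [add_mul]
  rcases lt_or_ge (Fintype.card F) K with hlt | hge
  · refine le_trans ?_ (Nat.le_add_left _ _)
    have h1 : Fintype.card SL(m + 1, F) ≤ Fintype.card (Matrix (Fin (m + 1)) (Fin (m + 1)) F) :=
      Fintype.card_le_of_injective _ Subtype.val_injective
    have h2 : Fintype.card (Matrix (Fin (m + 1)) (Fin (m + 1)) F) =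
        Fintype.card F ^ ((m + 1) * (m + 1)) := by
      change Fintype.card (Fin (m + 1) → Fin (m + 1) → F) = _
      simp [pow_mul]
    rw [h2] at h1
    calc _ ≤ _ := h1
      _ ≤ K ^ ((m + 1) * (m + 1)) := Nat.pow_le_pow_left hlt.le _
      _ ≤ _ := Nat.le_mul_of_pos_right _ hpos
  · refine le_trans ?_ (Nat.le_add_right _ _)
    obtain ⟨S, hS⟩ : ∃ S : Finset (Fin m → F), ∀ a, a ∈ S ↔
        ∃ (y : Fin d × Bool → GL (Fin (m + 1)) F) (v : Fin (m + 1) → F),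
        (krylov (FreeGroup.lift y (FreeGroup.mk (commWord w).toWord)).1 v).det ≠ 0 ∧
          charCoeff (commWord w).toWord y = a :=
      ⟨Finset.univ.filter fun a => _, fun a => Finset.mem_filter_univ a⟩
    have hdiv : 1 ≤ Fintype.card F / K := (Nat.one_le_div_iff (by omega)).2 hge
    have h1 := hK F (Fintype.card F / K - 1)
      (by rw [Nat.sub_add_cancel hdiv]; exact Nat.mul_div_le _ _) S
      fun y v h => (hS _).2 ⟨y, v, h, rfl⟩
    rw [Nat.sub_add_cancel hdiv] at h1
    have h2 := card_mul_card_SL_le w S fun a ha => (hS a).1 ha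
    have h3 : Fintype.card F ≤ 2 * K * (Fintype.card F / K) := by
      have := Nat.lt_mul_div_succ (Fintype.card F) (Nat.pos_of_ne_zero hK0)
      nlinarith
    have h4 : Fintype.card F ^ m ≤ (2 * K) ^ m * S.card :=
      calc _ ≤ (2 * K * (Fintype.card F / K)) ^ m := Nat.pow_le_pow_left h3 m
        _ = (2 * K) ^ m * (Fintype.card F / K) ^ m := mul_pow _ _ _
        _ ≤ _ := Nat.mul_le_mul_left _ h1
    have h5 : Fintype.card F ≤ 2 * (Fintype.card F - 1) := by omega
    refine le_of_mul_le_mul_left (a := Fintype.card F ^ (m + 1)) ?_ (by positivity)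
    calc Fintype.card F ^ (m + 1) * Fintype.card SL(m + 1, F)
        = Fintype.card F ^ m * Fintype.card F * Fintype.card SL(m + 1, F) := by rw [pow_succ]
      _ ≤ ((2 * K) ^ m * S.card) * (2 * (Fintype.card F - 1)) * Fintype.card SL(m + 1, F) := by
        gcongr
      _ = 2 * (2 * K) ^ m * (S.card * ((Fintype.card F - 1) * Fintype.card SL(m + 1, F))) := by
        ring
      _ ≤ 2 * (2 * K) ^ m * ((wordImage w SL(m + 1, F)).ncard * Fintype.card F ^ (m + 1)) := by
        gcongr
      _ = _ := by ring

end Counting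

end SLWord

theorem stmt13 (n : ℕ) (hn : 2 ≤ n) (d : ℕ)
    (w₁ w₂ : FreeGroup (Fin d)) (hw₁ : w₁ ≠ 1) (hw₂ : w₂ ≠ 1) :
    ∃ C : ℝ, 0 < C ∧
      ∀ q : ℕ, IsPrimePow q → ¬(n = 2 ∧ (q = 2 ∨ q = 3)) →
      ∀ (F : Type) [Field F] [Fintype F], Fintype.card F = q →
      ∀ g : Matrix.ProjectiveSpecialLinearGroup (Fin n) F, g ≠ 1 →
        |Pab (wordImage w₁ (Matrix.ProjectiveSpecialLinearGroup (Fin n) F))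
              (wordImage w₂ (Matrix.ProjectiveSpecialLinearGroup (Fin n) F)) g -
            1 / (Nat.card (Matrix.ProjectiveSpecialLinearGroup (Fin n) F) : ℝ)| ≤
          C / Real.sqrt (q : ℝ) *
            (1 / (Nat.card (Matrix.ProjectiveSpecialLinearGroup (Fin n) F) : ℝ)) := by
  classical
  obtain ⟨C₁, hC₁⟩ := SLWord.exists_card_SL_le hw₁ hn
  obtain ⟨C₂, hC₂⟩ := SLWord.exists_card_SL_le hw₂ hn
  have hc : (0 : ℝ) < 1 / ((C₁ : ℝ) + C₂ + 1) := by positivity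
  refine ⟨(4 * n + 1) / (1 / ((C₁ : ℝ) + C₂ + 1)), by positivity, ?_⟩
  rintro q - - F _ _ rfl g hg
  have key : ∀ {a b C : ℕ}, a ≤ C * b → C ≤ C₁ + C₂ + 1 →
      1 / ((C₁ : ℝ) + C₂ + 1) * a ≤ b := fun {a b C} h hC => by
    rw [one_div_mul_eq_div, div_le_iff₀ (by positivity), mul_comm]
    exact_mod_cast h.trans (Nat.mul_le_mul_right b hC)
  exact SLWord.abs_Pab_wordImage_sub_le hn w₁ w₂ hc (key (hC₁ F) (by omega))
    (key (hC₂ F) (by omega)) hg
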